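/- arXiv:1402.0829 — 2 statements merged into one kernel-verified Lean document; each statement's English description precedes it below -/
import Mathlib

section
/- For any r = 2, 3, ... and any concave modulus of continuity ω, sup over f ∈ W̃^r H_ω of the total variation of f over [0, 2π] equals 4 Σ_{i=0}^∞ (−1)^{ir} b_{2i+1}/(2i+1)^r, where b_m = (2/π)∫₀^{π/2} ω(2t) sin(mt) dt. -/
open MeasureTheory Real Filter Set

noncomputable section

/-- ω is a concave modulus of continuity. -/
def IsConcaveModulus (ω : ℝ → ℝ) : Prop :=
  Continuous ω ∧ MonotoneOn ω (Ici 0) ∧ ω 0 = 0 ∧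
    (∀ s t : ℝ, 0 ≤ s → 0 ≤ t → ω (s + t) ≤ ω s + ω t) ∧
    (∀ t : ℝ, 0 ≤ t → 0 ≤ ω t) ∧ ConcaveOn ℝ (Ici 0) ω

/-- The Dini condition: ∫₀^ε ω(t)/t dt < ∞ for some ε > 0. -/
def DiniCondition (ω : ℝ → ℝ) : Prop :=
  ∃ ε > 0, IntegrableOn (fun t => ω t / t) (Ioo 0 ε)

/-- f is 2π-periodic with modulus of continuity bounded by ω. -/
def MemH (ω f : ℝ → ℝ) : Prop :=
  Function.Periodic f (2 * π) ∧ ∀ x y : ℝ, |f x - f y| ≤ ω |x - y|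

/-- The principal value integral defining the conjugate function converges to L at x. -/
def ConjAt (f : ℝ → ℝ) (x L : ℝ) : Prop :=
  Tendsto (fun δ : ℝ =>
      -(1 / π) * ∫ t in {t : ℝ | δ ≤ |t - x| ∧ |t - x| ≤ π},
        f t / (2 * Real.tan ((t - x) / 2)))
    (nhdsWithin 0 (Ioi 0)) (nhds L)

/-- g is the trigonometric conjugate of f. -/
def ConjFn (f g : ℝ → ℝ) : Prop := ∀ x : ℝ, ConjAt f x (g x)

/-- f belongs to W^r H_ω. -/
def MemWrH (r : ℕ) (ω f : ℝ → ℝ) : Prop :=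
  Function.Periodic f (2 * π) ∧ ContDiff ℝ r f ∧
    ∀ x y : ℝ, |iteratedDeriv r f x - iteratedDeriv r f y| ≤ ω |x - y|

/-- Odd continuous functions, symmetric about `π / 2` and increasing on `[0, π / 2]`. -/
structure IsProfile (F : ℝ → ℝ) : Prop where
  cont : Continuous F
  odd : ∀ x, F (-x) = -F x
  symm : ∀ x, F (π - x) = F x
  mono : MonotoneOn F (Icc 0 (π / 2))

/-- The primitive of `-F` vanishing at `π / 2`. -/
def slope₂ (F : ℝ → ℝ) (u : ℝ) : ℝ := ∫ v in u..(π / 2), F v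

/-- The second primitive of `-F` which is again a profile when `F` is. -/
def lift₂ (F : ℝ → ℝ) (x : ℝ) : ℝ := ∫ u in (0 : ℝ)..x, slope₂ F u

/-- The differences of `φ` over distance `d ≤ 2π` are bounded by `2 F (d / 2)`. -/
def HasModulus (F φ : ℝ → ℝ) : Prop :=
  ∀ x d, 0 ≤ d → d ≤ 2 * π → |φ (x + d) - φ x| ≤ 2 * F (d / 2)

lemma eq_of_hasDerivAt_zero {f : ℝ → ℝ} (h : ∀ x, HasDerivAt f 0 x) (x y : ℝ) : f x = f y :=
  is_const_of_deriv_eq_zero (fun x => (h x).differentiableAt) (fun x => (h x).deriv) x y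

namespace IsProfile

variable {F : ℝ → ℝ}

lemma zero (hF : IsProfile F) : F 0 = 0 := by
  have := hF.odd 0
  rw [neg_zero] at this
  linarith

lemma add_pi (hF : IsProfile F) (x : ℝ) : F (x + π) = -F x := by
  rw [← hF.odd, ← hF.symm (-x)]
  congr 1
  ring

lemma periodic (hF : IsProfile F) : Function.Periodic F (2 * π) := fun x => by
  rw [two_mul, ← add_assoc, hF.add_pi, hF.add_pi, neg_neg]

lemma nonneg (hF : IsProfile F) {x : ℝ} (h0 : 0 ≤ x) (h1 : x ≤ π) : 0 ≤ F x := by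
  have key : ∀ y, 0 ≤ y → y ≤ π / 2 → 0 ≤ F y := fun y hy hy' => by
    have := hF.mono ⟨le_rfl, by positivity⟩ ⟨hy, hy'⟩ hy
    rwa [hF.zero] at this
  rcases le_total x (π / 2) with h | h
  · exact key x h0 h
  · rw [← hF.symm]
    exact key _ (by linarith) (by linarith)

lemma hasDerivAt_slope (hF : IsProfile F) (u : ℝ) : HasDerivAt (slope₂ F) (-F u) u :=
  intervalIntegral.integral_hasDerivAt_left (hF.cont.intervalIntegrable _ _)
    (hF.cont.stronglyMeasurableAtFilter _ _) hF.cont.continuousAt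

lemma continuous_slope (hF : IsProfile F) : Continuous (slope₂ F) :=
  continuous_iff_continuousAt.2 fun u => (hF.hasDerivAt_slope u).continuousAt

lemma hasDerivAt_lift (hF : IsProfile F) (x : ℝ) : HasDerivAt (lift₂ F) (slope₂ F x) x :=
  intervalIntegral.integral_hasDerivAt_right (hF.continuous_slope.intervalIntegrable _ _)
    (hF.continuous_slope.stronglyMeasurableAtFilter _ _) hF.continuous_slope.continuousAt

lemma slope_neg (hF : IsProfile F) (u : ℝ) : slope₂ F (-u) = slope₂ F u := by
  have h : ∀ x, HasDerivAt (fun u => slope₂ F (-u) - slope₂ F u) 0 x := fun x => by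
    have := ((hF.hasDerivAt_slope (-x)).comp x (hasDerivAt_neg x)).sub (hF.hasDerivAt_slope x)
    exact this.congr_deriv (by rw [hF.odd]; ring)
  have := eq_of_hasDerivAt_zero h u 0
  simp only [neg_zero, sub_self] at this
  linarith

lemma slope_pi_sub (hF : IsProfile F) (u : ℝ) : slope₂ F (π - u) = -slope₂ F u := by
  have h : ∀ x, HasDerivAt (fun u => slope₂ F (π - u) + slope₂ F u) 0 x := fun x => by
    have := ((hF.hasDerivAt_slope (π - x)).comp x ((hasDerivAt_id x).const_sub π)).add
      (hF.hasDerivAt_slope x)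
    exact this.congr_deriv (by rw [hF.symm]; ring)
  have := eq_of_hasDerivAt_zero h u (π / 2)
  have h2 : slope₂ F (π / 2) = 0 := by simp [slope₂]
  have h3 : π - π / 2 = π / 2 := by ring
  simp only [h3, h2] at this
  linarith

lemma slope_nonneg (hF : IsProfile F) {u : ℝ} (h0 : 0 ≤ u) (h1 : u ≤ π / 2) :
    0 ≤ slope₂ F u :=
  intervalIntegral.integral_nonneg h1 fun v hv =>
    hF.nonneg (h0.trans hv.1) (by linarith [hv.2, pi_pos])

lemma slope_antitone (hF : IsProfile F) : AntitoneOn (slope₂ F) (Icc 0 π) :=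
  antitoneOn_of_deriv_nonpos (convex_Icc _ _) hF.continuous_slope.continuousOn
    (fun x _ => (hF.hasDerivAt_slope x).differentiableAt.differentiableWithinAt)
    fun x hx => by
      rw [interior_Icc] at hx
      rw [(hF.hasDerivAt_slope x).deriv]
      linarith [hF.nonneg hx.1.le hx.2.le]

lemma lift (hF : IsProfile F) : IsProfile (lift₂ F) where
  cont := continuous_iff_continuousAt.2 fun u => (hF.hasDerivAt_lift u).continuousAt
  odd x := by
    have h : ∀ x, HasDerivAt (fun u => lift₂ F (-u) + lift₂ F u) 0 x := fun x => by
      have := ((hF.hasDerivAt_lift (-x)).comp x (hasDerivAt_neg x)).add (hF.hasDerivAt_lift x)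
      exact this.congr_deriv (by rw [hF.slope_neg]; ring)
    have := eq_of_hasDerivAt_zero h x 0
    have h0 : lift₂ F 0 = 0 := by simp [lift₂]
    simp only [neg_zero, h0] at this
    linarith
  symm x := by
    have h : ∀ x, HasDerivAt (fun u => lift₂ F (π - u) - lift₂ F u) 0 x := fun x => by
      have := ((hF.hasDerivAt_lift (π - x)).comp x ((hasDerivAt_id x).const_sub π)).sub
        (hF.hasDerivAt_lift x)
      exact this.congr_deriv (by rw [hF.slope_pi_sub]; ring)
    have := eq_of_hasDerivAt_zero h x (π / 2)
    have h3 : π - π / 2 = π / 2 := by ring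
    simp only [h3, sub_self] at this
    linarith
  mono := monotoneOn_of_deriv_nonneg (convex_Icc _ _)
    (fun x _ => (hF.hasDerivAt_lift x).continuousAt.continuousWithinAt)
    (fun x _ => (hF.hasDerivAt_lift x).differentiableAt.differentiableWithinAt)
    fun x hx => by
      rw [interior_Icc] at hx
      rw [(hF.hasDerivAt_lift x).deriv]
      exact hF.slope_nonneg hx.1.le hx.2.le

end IsProfile

lemma abs_arcsin_sin_sub_le (x y : ℝ) :
    |arcsin (sin x) - arcsin (sin y)| ≤ |x - y| := by
  have hb : |arcsin (sin x) - arcsin (sin y)| ≤ π := by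
    rw [abs_le]
    constructor <;> linarith [neg_pi_div_two_le_arcsin (sin x), arcsin_le_pi_div_two (sin x),
      neg_pi_div_two_le_arcsin (sin y), arcsin_le_pi_div_two (sin y)]
  rcases le_total |x - y| π with h | h
  · by_contra! hlt
    have h1 := strictAntiOn_cos ⟨abs_nonneg _, h⟩ ⟨abs_nonneg _, hb⟩ hlt
    rw [cos_abs, cos_abs, cos_sub, cos_sub, sin_arcsin (neg_one_le_sin x) (sin_le_one x),
      sin_arcsin (neg_one_le_sin y) (sin_le_one y), cos_arcsin, cos_arcsin,
      ← cos_sq', ← cos_sq', sqrt_sq_eq_abs, sqrt_sq_eq_abs, ← abs_mul] at h1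
    linarith [le_abs_self (cos x * cos y)]
  · exact hb.trans h

/-- The odd function `½ ω(2 |t|) sign t`. -/
def oddHalf (ω : ℝ → ℝ) (t : ℝ) : ℝ := (ω (2 * max t 0) - ω (2 * max (-t) 0)) / 2

/-- The extremal profile of the class `H_ω`. -/
def baseProfile (ω : ℝ → ℝ) (x : ℝ) : ℝ := oddHalf ω (arcsin (sin x))

section base

variable {ω : ℝ → ℝ}

lemma oddHalf_of_nonneg (hω : IsConcaveModulus ω) {t : ℝ} (ht : 0 ≤ t) :
    oddHalf ω t = ω (2 * t) / 2 := by
  simp [oddHalf, max_eq_left ht, max_eq_right (neg_nonpos.2 ht), hω.2.2.1]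

lemma oddHalf_neg (ω : ℝ → ℝ) (t : ℝ) : oddHalf ω (-t) = -oddHalf ω t := by
  simp only [oddHalf, neg_neg]; ring

lemma oddHalf_sub_le (hω : IsConcaveModulus ω) {s t : ℝ} (hst : s ≤ t) :
    0 ≤ oddHalf ω t - oddHalf ω s ∧ oddHalf ω t - oddHalf ω s ≤ ω (t - s) := by
  have key : ∀ s t, 0 ≤ s → s ≤ t →
      0 ≤ oddHalf ω t - oddHalf ω s ∧ oddHalf ω t - oddHalf ω s ≤ ω (t - s) := fun s t h0 hst => by
    rw [oddHalf_of_nonneg hω h0, oddHalf_of_nonneg hω (h0.trans hst)]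
    have h1 := hω.2.1 (mem_Ici.2 (by linarith : 0 ≤ 2 * s)) (mem_Ici.2 (by linarith : 0 ≤ 2 * t))
      (by linarith)
    have h2 := hω.2.2.2.1 (2 * s) (2 * (t - s)) (by linarith) (by linarith)
    have h3 := hω.2.2.2.1 (t - s) (t - s) (by linarith) (by linarith)
    rw [← two_mul] at h3
    rw [show 2 * s + 2 * (t - s) = 2 * t by ring] at h2
    constructor <;> linarith
  rcases le_total 0 s with hs | hs
  · exact key s t hs hst
  rcases le_total t 0 with ht | ht
  · have := key (-t) (-s) (by linarith) (by linarith)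
    rw [oddHalf_neg, oddHalf_neg, show -s - -t = t - s by ring] at this
    constructor <;> linarith
  · have e : oddHalf ω s = -(ω (2 * -s) / 2) := by
      rw [← oddHalf_of_nonneg hω (neg_nonneg.2 hs), oddHalf_neg, neg_neg]
    rw [oddHalf_of_nonneg hω ht, e]
    have h1 := hω.2.2.2.2.1 (2 * t) (by linarith)
    have h2 := hω.2.2.2.2.1 (2 * -s) (by linarith)
    have h3 := hω.2.2.2.2.2.2 (mem_Ici.2 (by linarith : 0 ≤ 2 * t))
      (mem_Ici.2 (by linarith : 0 ≤ 2 * -s)) (by norm_num : (0 : ℝ) ≤ 1 / 2)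
      (by norm_num : (0 : ℝ) ≤ 1 / 2) (by norm_num)
    simp only [smul_eq_mul] at h3
    rw [show 1 / 2 * (2 * t) + 1 / 2 * (2 * -s) = t - s by ring] at h3
    constructor <;> linarith

lemma abs_oddHalf_sub_le (hω : IsConcaveModulus ω) (s t : ℝ) :
    |oddHalf ω s - oddHalf ω t| ≤ ω |s - t| := by
  rcases le_total s t with h | h
  · obtain ⟨h1, h2⟩ := oddHalf_sub_le hω h
    rwa [abs_sub_comm, abs_of_nonneg h1, abs_sub_comm, abs_of_nonneg (sub_nonneg.2 h)]
  · obtain ⟨h1, h2⟩ := oddHalf_sub_le hω h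
    rwa [abs_of_nonneg h1, abs_of_nonneg (sub_nonneg.2 h)]

lemma abs_baseProfile_sub_le (hω : IsConcaveModulus ω) (x y : ℝ) :
    |baseProfile ω x - baseProfile ω y| ≤ ω |x - y| :=
  (abs_oddHalf_sub_le hω _ _).trans
    (hω.2.1 (mem_Ici.2 (abs_nonneg _)) (mem_Ici.2 (abs_nonneg _)) (abs_arcsin_sin_sub_le x y))

lemma baseProfile_eq (hω : IsConcaveModulus ω) {t : ℝ} (h0 : 0 ≤ t) (h1 : t ≤ π / 2) :
    baseProfile ω t = ω (2 * t) / 2 := by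
  rw [baseProfile, arcsin_sin (by linarith) h1, oddHalf_of_nonneg hω h0]

lemma isProfile_base (hω : IsConcaveModulus ω) : IsProfile (baseProfile ω) where
  cont := by
    have := hω.1
    unfold baseProfile oddHalf
    fun_prop
  odd x := by rw [baseProfile, sin_neg, arcsin_neg, oddHalf_neg, baseProfile]
  symm x := by rw [baseProfile, sin_pi_sub, baseProfile]
  mono x hx y hy hxy := by
    rw [baseProfile_eq hω hx.1 hx.2, baseProfile_eq hω hy.1 hy.2]
    have := hω.2.1 (mem_Ici.2 (by linarith [hx.1] : 0 ≤ 2 * x))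
      (mem_Ici.2 (by linarith [hy.1] : 0 ≤ 2 * y)) (by linarith)
    linarith

lemma hasModulus_base (hω : IsConcaveModulus ω) {φ : ℝ → ℝ} (hp : Function.Periodic φ (2 * π))
    (h : ∀ x y, |φ x - φ y| ≤ ω |x - y|) : HasModulus (baseProfile ω) φ := fun x d h0 h1 => by
  rcases le_total d π with hd | hd
  · rw [baseProfile_eq hω (by linarith) (by linarith)]
    refine (h _ _).trans_eq ?_
    rw [add_sub_cancel_left, abs_of_nonneg h0]
    ring_nf
  · rw [← (isProfile_base hω).symm, baseProfile_eq hω (by linarith) (by linarith), ← hp x]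
    refine (h _ _).trans_eq ?_
    rw [show x + d - (x + 2 * π) = -(2 * π - d) by ring, abs_neg, abs_of_nonneg (by linarith)]
    ring_nf

end base

/-- The kernel `log |sin (u / 2)|`. -/
def logSin (u : ℝ) : ℝ := log (sin (u / 2))

lemma logSin_neg (u : ℝ) : logSin (-u) = logSin u := by
  rw [logSin, neg_div, sin_neg, log_neg_eq_log, logSin]

lemma logSin_periodic : Function.Periodic logSin (2 * π) := fun u => by
  rw [logSin, show (u + 2 * π) / 2 = u / 2 + π by ring, sin_add_pi, log_neg_eq_log, logSin]

lemma logSin_pi : logSin π = 0 := by simp [logSin]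

lemma intervalIntegrable_logSin (a b : ℝ) : IntervalIntegrable logSin volume a b := by
  have h := (intervalIntegrable_log_sin (a := a / 2) (b := b / 2)).comp_mul_left (c := 1 / 2)
  convert h using 1
  · ext x; simp [logSin]; ring_nf
  · ring
  · ring

lemma intervalIntegrable_logSin_sub (a b c : ℝ) :
    IntervalIntegrable (fun t => logSin (t - c)) volume a b := by
  have h := (intervalIntegrable_logSin (a - c) (b - c)).comp_sub_right c
  simpa using h

lemma intervalIntegrable_mul_logSin_sub {h : ℝ → ℝ} (hh : Continuous h) (a b c : ℝ) :
    IntervalIntegrable (fun t => h t * logSin (t - c)) volume a b :=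
  (intervalIntegrable_logSin_sub a b c).continuousOn_mul hh.continuousOn

lemma hasDerivAt_logSin_sub {t c : ℝ} (hs : sin ((t - c) / 2) ≠ 0) :
    HasDerivAt (fun t => logSin (t - c)) (cos ((t - c) / 2) / (2 * sin ((t - c) / 2))) t := by
  have h := ((((hasDerivAt_id t).sub_const c).div_const 2).sin).log hs
  exact h.congr_deriv (by simp; ring)

lemma div_two_mul_tan (a y : ℝ) : a / (2 * tan y) = a * (cos y / (2 * sin y)) := by
  rw [tan_eq_sin_div_cos]
  rcases eq_or_ne (cos y) 0 with h | h
  · simp [h]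
  rcases eq_or_ne (sin y) 0 with h' | h'
  · simp [h']
  field_simp

/-- Integral formula for the conjugate of a function with derivative `h`. -/
def conjLog (h : ℝ → ℝ) (x : ℝ) : ℝ := (1 / π) * ∫ t in (0 : ℝ)..(2 * π), h t * logSin (t - x)

lemma integral_mul_cot_eq {f h : ℝ → ℝ} (hf : ∀ x, HasDerivAt f (h x) x) (hh : Continuous h)
    {a b c : ℝ} (hs : ∀ t ∈ uIcc a b, sin ((t - c) / 2) ≠ 0) :
    ∫ t in a..b, f t / (2 * tan ((t - c) / 2)) =
      f b * logSin (b - c) - f a * logSin (a - c) - ∫ t in a..b, h t * logSin (t - c) := by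
  simp_rw [div_two_mul_tan]
  refine intervalIntegral.integral_mul_deriv_eq_deriv_mul (fun t _ => hf t)
    (fun t ht => hasDerivAt_logSin_sub (hs t ht)) (hh.intervalIntegrable _ _) ?_
  refine ContinuousOn.intervalIntegrable ?_
  refine ContinuousOn.div (by fun_prop) (by fun_prop) fun t ht => ?_
  exact mul_ne_zero two_ne_zero (hs t ht)

lemma sin_half_ne_zero {u : ℝ} (h0 : 0 < |u|) (h1 : |u| < 2 * π) : sin (u / 2) ≠ 0 := by
  rcases lt_or_gt_of_ne (abs_pos.1 h0) with h | h
  · rw [abs_of_neg h] at h1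
    exact (sin_neg_of_neg_of_neg_pi_lt (by linarith) (by linarith)).ne
  · rw [abs_of_pos h] at h1
    exact (sin_pos_of_pos_of_lt_pi (by linarith) (by linarith)).ne'

lemma annulus_eq {x δ : ℝ} (hδ : 0 < δ) :
    {t : ℝ | δ ≤ |t - x| ∧ |t - x| ≤ π} = Icc (x - π) (x - δ) ∪ Icc (x + δ) (x + π) := by
  ext t
  simp only [mem_ofPred_eq, mem_union, mem_Icc]
  rcases le_total 0 (t - x) with h | h
  · rw [abs_of_nonneg h]
    constructor
    · rintro ⟨h1, h2⟩; right; constructor <;> linarith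
    · rintro (⟨h1, h2⟩ | ⟨h1, h2⟩) <;> constructor <;> linarith
  · rw [abs_of_nonpos h]
    constructor
    · rintro ⟨h1, h2⟩; left; constructor <;> linarith
    · rintro (⟨h1, h2⟩ | ⟨h1, h2⟩) <;> constructor <;> linarith

lemma integral_annulus {f h : ℝ → ℝ} (hf : ∀ x, HasDerivAt f (h x) x) (hh : Continuous h)
    {x δ : ℝ} (hδ : 0 < δ) (hδ' : δ < π) :
    ∫ t in {t : ℝ | δ ≤ |t - x| ∧ |t - x| ≤ π}, f t / (2 * tan ((t - x) / 2)) =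
      (f (x - δ) - f (x + δ)) * logSin δ - ((∫ t in (x - π)..(x - δ), h t * logSin (t - x)) +
        ∫ t in (x + δ)..(x + π), h t * logSin (t - x)) := by
  have hf' : Continuous f := continuous_iff_continuousAt.2 fun x => (hf x).continuousAt
  have s1 : ∀ t ∈ Icc (x - π) (x - δ), sin ((t - x) / 2) ≠ 0 := fun t ht => by
    apply sin_half_ne_zero <;> rw [abs_of_neg (by linarith [ht.2])] <;>
      linarith [ht.1, ht.2, pi_pos]
  have s2 : ∀ t ∈ Icc (x + δ) (x + π), sin ((t - x) / 2) ≠ 0 := fun t ht => by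
    apply sin_half_ne_zero <;> rw [abs_of_pos (by linarith [ht.1])] <;>
      linarith [ht.1, ht.2, pi_pos]
  have hint : ∀ a b, (∀ t ∈ Icc a b, sin ((t - x) / 2) ≠ 0) →
      IntegrableOn (fun t => f t / (2 * tan ((t - x) / 2))) (Icc a b) := fun a b hs => by
    simp_rw [div_two_mul_tan]
    refine ContinuousOn.integrableOn_Icc ?_
    refine hf'.continuousOn.mul (ContinuousOn.div (by fun_prop) (by fun_prop) fun t ht => ?_)
    exact mul_ne_zero two_ne_zero (hs t ht)
  have hd : Disjoint (Icc (x - π) (x - δ)) (Icc (x + δ) (x + π)) :=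
    Set.disjoint_left.2 fun t h1 h2 => by linarith [h1.2, h2.1]
  rw [annulus_eq hδ, setIntegral_union hd measurableSet_Icc (hint _ _ s1) (hint _ _ s2),
    integral_Icc_eq_integral_Ioc, integral_Icc_eq_integral_Ioc,
    ← intervalIntegral.integral_of_le (by linarith),
    ← intervalIntegral.integral_of_le (by linarith),
    integral_mul_cot_eq hf hh (by rwa [uIcc_of_le (by linarith)]),
    integral_mul_cot_eq hf hh (by rwa [uIcc_of_le (by linarith)]),
    show x - π - x = -π by ring, show x - δ - x = -δ by ring, show x + π - x = π by ring,
    show x + δ - x = δ by ring, logSin_neg, logSin_neg, logSin_pi]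
  ring

lemma tendsto_boundary {f h : ℝ → ℝ} (hf : ∀ x, HasDerivAt f (h x) x) (x : ℝ) :
    Tendsto (fun δ => (f (x - δ) - f (x + δ)) * logSin δ) (nhdsWithin 0 (Ioi 0)) (nhds 0) := by
  have hD : HasDerivAt (fun δ => f (x - δ) - f (x + δ)) (h x * -1 - h x * 1) 0 := by
    have h1 : HasDerivAt (fun δ => f (x - δ)) (h x * -1) 0 := by
      have := (hf (x - 0)).comp 0 ((hasDerivAt_id (0 : ℝ)).const_sub x)
      rw [sub_zero] at this
      exact this
    have h2 : HasDerivAt (fun δ => f (x + δ)) (h x * 1) 0 := by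
      have := (hf (x + 0)).comp 0 ((hasDerivAt_id (0 : ℝ)).const_add x)
      rw [add_zero] at this
      exact this
    exact h1.sub h2
  have h1 : (fun δ => f (x - δ) - f (x + δ)) =O[nhdsWithin 0 (Ioi 0)] fun δ => δ := by
    have := hD.isBigO_sub
    simp only [sub_zero, add_zero, sub_self] at this
    exact this.mono nhdsWithin_le_nhds
  have h2 : (fun δ : ℝ => δ) =O[nhdsWithin 0 (Ioi 0)] fun δ => sin (δ / 2) := by
    refine Asymptotics.IsBigO.of_bound π ?_
    filter_upwards [Ioc_mem_nhdsGT pi_pos] with δ hδ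
    have := mul_le_sin (x := δ / 2) (by linarith [hδ.1]) (by linarith [hδ.2])
    rw [norm_of_nonneg hδ.1.le]
    calc δ = π * (2 / π * (δ / 2)) := by field_simp
      _ ≤ π * ‖sin (δ / 2)‖ := by gcongr; exact this.trans (le_abs_self _)
  have h3 : Tendsto (fun δ => sin (δ / 2) * logSin δ) (nhdsWithin 0 (Ioi 0)) (nhds 0) := by
    have hc : Continuous fun δ => sin (δ / 2) * log (sin (δ / 2)) :=
      continuous_mul_log.comp (by fun_prop)
    have := hc.tendsto 0
    simp only [zero_div, sin_zero, zero_mul] at this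
    exact this.mono_left nhdsWithin_le_nhds
  exact ((h1.trans h2).mul (Asymptotics.isBigO_refl logSin _)).trans_tendsto h3

lemma conjLog_eq {h : ℝ → ℝ} (hp : Function.Periodic h (2 * π)) (x : ℝ) :
    conjLog h x = (1 / π) * ∫ t in (x - π)..(x + π), h t * logSin (t - x) := by
  have hper : Function.Periodic (fun t => h t * logSin (t - x)) (2 * π) := fun t => by
    simp only
    rw [hp, show t + 2 * π - x = t - x + 2 * π by ring, logSin_periodic]
  have := hper.intervalIntegral_add_eq 0 (x - π)
  rw [zero_add, show x - π + 2 * π = x + π by ring] at this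
  rw [conjLog, this]

theorem conjAt_conjLog {f h : ℝ → ℝ} (hf : ∀ x, HasDerivAt f (h x) x) (hh : Continuous h)
    (hp : Function.Periodic h (2 * π)) (x : ℝ) : ConjAt f x (conjLog h x) := by
  have hI := intervalIntegrable_mul_logSin_sub hh (c := x)
  have hc := intervalIntegral.continuous_primitive hI
  have t1 : Tendsto (fun δ => ∫ t in (x - π)..(x - δ), h t * logSin (t - x))
      (nhdsWithin 0 (Ioi 0)) (nhds (∫ t in (x - π)..x, h t * logSin (t - x))) := by
    have := ((hc (x - π)).comp
      (by fun_prop : Continuous fun δ => x - δ)).tendsto 0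
    simp only [Function.comp_def, sub_zero] at this
    exact this.mono_left nhdsWithin_le_nhds
  have t2 : Tendsto (fun δ => ∫ t in (x + δ)..(x + π), h t * logSin (t - x))
      (nhdsWithin 0 (Ioi 0)) (nhds (∫ t in x..(x + π), h t * logSin (t - x))) := by
    have := ((hc (x + π)).comp
      (by fun_prop : Continuous fun δ => x + δ)).tendsto 0
    simp only [Function.comp_def, add_zero] at this
    have := this.neg.mono_left (nhdsWithin_le_nhds (s := Ioi 0))
    simpa only [← intervalIntegral.integral_symm] using this
  have t3 := ((tendsto_boundary hf x).sub (t1.add t2)).const_mul (-(1 / π))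
  rw [intervalIntegral.integral_add_adjacent_intervals (hI _ _) (hI _ _)] at t3
  rw [ConjAt, conjLog_eq hp]
  rw [show (1 / π) * ∫ t in (x - π)..(x + π), h t * logSin (t - x) =
    -(1 / π) * (0 - ∫ t in (x - π)..(x + π), h t * logSin (t - x)) by ring]
  refine t3.congr' ?_
  filter_upwards [Ioo_mem_nhdsGT pi_pos] with δ hδ
  rw [integral_annulus hf hh hδ.1 hδ.2]

theorem conjFn_iff {f h : ℝ → ℝ} (hf : ∀ x, HasDerivAt f (h x) x) (hh : Continuous h)
    (hp : Function.Periodic h (2 * π)) (g : ℝ → ℝ) : ConjFn f g ↔ g = conjLog h :=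
  ⟨fun H => funext fun x => tendsto_nhds_unique (H x) (conjAt_conjLog hf hh hp x),
    fun H x => H ▸ conjAt_conjLog hf hh hp x⟩

lemma conjLog_sub {h : ℝ → ℝ} (hh : Continuous h) (a b : ℝ) :
    conjLog h b - conjLog h a =
      ∫ t in (0 : ℝ)..(2 * π), h t * ((1 / π) * (logSin (t - b) - logSin (t - a))) := by
  rw [conjLog, conjLog, ← mul_sub, ← intervalIntegral.integral_sub
    (intervalIntegrable_mul_logSin_sub hh _ _ _) (intervalIntegrable_mul_logSin_sub hh _ _ _),
    ← intervalIntegral.integral_const_mul]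
  congr 1
  ext t
  ring

/-- Holomorphic function in the disc whose boundary values have real part
`π⁻¹ log |2 sin ((t - a) / 2)|` and imaginary part a step function. -/
def arcFun (a : ℝ) (z : ℂ) : ℂ :=
  ((a / (2 * π) : ℝ) : ℂ) * Complex.I +
    ((1 / π : ℝ) : ℂ) * Complex.log (1 - z * Complex.exp (-(a * Complex.I)))

lemma norm_exp_neg_mul_I (a : ℝ) : ‖Complex.exp (-(a * Complex.I))‖ = 1 := by
  rw [← neg_mul, ← Complex.ofReal_neg, Complex.norm_exp_ofReal_mul_I]

lemma one_sub_mem_slitPlane {ζ : ℂ} (h : ‖ζ‖ < 1) : 1 - ζ ∈ Complex.slitPlane := by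
  left
  have := (Complex.re_le_norm ζ).trans_lt h
  simpa using this

lemma arcFun_arg_mem {z : ℂ} (hz : ‖z‖ < 1) (a : ℝ) :
    1 - z * Complex.exp (-(a * Complex.I)) ∈ Complex.slitPlane :=
  one_sub_mem_slitPlane (by rwa [norm_mul, norm_exp_neg_mul_I, mul_one])

lemma differentiableAt_arcFun {z : ℂ} (hz : ‖z‖ < 1) (a : ℝ) :
    DifferentiableAt ℂ (arcFun a) z := by
  unfold arcFun
  have : DifferentiableAt ℂ (fun z => Complex.log (1 - z * Complex.exp (-(a * Complex.I)))) z :=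
    DifferentiableAt.clog (by fun_prop) (arcFun_arg_mem hz a)
  fun_prop

lemma arcFun_zero (a : ℝ) : arcFun a 0 = ((a / (2 * π) : ℝ) : ℂ) * Complex.I := by
  simp [arcFun]

lemma re_div_one_sub {ζ : ℂ} (h : ‖ζ‖ < 1) : -(1 / 2) ≤ (ζ / (1 - ζ)).re := by
  have h1 : 0 < Complex.normSq (1 - ζ) := by
    rw [Complex.normSq_pos]
    exact Complex.slitPlane_ne_zero (one_sub_mem_slitPlane h)
  have h2 : Complex.normSq ζ < 1 := by
    rw [Complex.normSq_eq_norm_sq]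
    nlinarith [norm_nonneg ζ]
  rw [Complex.div_re, ← add_div, le_div_iff₀ h1]
  simp only [Complex.normSq_apply, Complex.sub_re, Complex.one_re, Complex.sub_im,
    Complex.one_im] at h2 ⊢
  nlinarith

lemma hasDerivAt_arcFun {z : ℂ} (hz : ‖z‖ < 1) (a : ℝ) :
    HasDerivAt (fun a : ℝ => arcFun a z) (((1 / (2 * π) : ℝ) : ℂ) * Complex.I +
      ((1 / π : ℝ) : ℂ) * (z * Complex.exp (-(a * Complex.I)) /
        (1 - z * Complex.exp (-(a * Complex.I))) * Complex.I)) a := by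
  have h1 : HasDerivAt (fun a : ℝ => (a : ℂ)) 1 a := Complex.ofRealCLM.hasDerivAt
  have h2 : HasDerivAt (fun a : ℝ => Complex.log (1 - z * Complex.exp (-(a * Complex.I))))
      (-(z * (Complex.exp (-(a * Complex.I)) * -(1 * Complex.I))) /
        (1 - z * Complex.exp (-(a * Complex.I)))) a :=
    ((((h1.mul_const Complex.I).neg.cexp).const_mul z).const_sub 1).clog_real
    (arcFun_arg_mem hz a)
  have h3 : HasDerivAt (fun a : ℝ => (((a / (2 * π) : ℝ) : ℂ) * Complex.I))
      (((1 / (2 * π) : ℝ) : ℂ) * Complex.I) a :=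
    (((hasDerivAt_id a).div_const (2 * π)).ofReal_comp).mul_const _
  refine (h3.add (h2.const_mul ((1 / π : ℝ) : ℂ))).congr_deriv ?_
  ring

lemma arcFun_im_monotone {z : ℂ} (hz : ‖z‖ < 1) : Monotone fun a : ℝ => (arcFun a z).im := by
  have hd : ∀ a : ℝ, HasDerivAt (fun a : ℝ => (arcFun a z).im) _ a := fun a =>
    Complex.imCLM.hasFDerivAt.comp_hasDerivAt a (hasDerivAt_arcFun hz a)
  refine monotone_of_deriv_nonneg (fun a => (hd a).differentiableAt) fun a => ?_
  rw [(hd a).deriv]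
  have := re_div_one_sub (ζ := z * Complex.exp (-(a * Complex.I)))
    (by rwa [norm_mul, norm_exp_neg_mul_I, mul_one])
  rw [Complex.imCLM_apply, Complex.add_im, Complex.im_ofReal_mul, Complex.im_ofReal_mul,
    Complex.I_im, Complex.mul_I_im]
  have e : 1 / (2 * π) * 1 + 1 / π * (z * Complex.exp (-(a * Complex.I)) /
      (1 - z * Complex.exp (-(a * Complex.I)))).re = (1 / π) * ((z * Complex.exp (-(a * Complex.I)) /
      (1 - z * Complex.exp (-(a * Complex.I)))).re + 1 / 2) := by ring
  rw [e]
  exact mul_nonneg (by positivity) (by linarith)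

lemma arcFun_two_pi (z : ℂ) : (arcFun (2 * π) z).im - (arcFun 0 z).im = 1 := by
  have : Complex.exp (-(((2 * π : ℝ) : ℂ) * Complex.I)) = 1 := by
    rw [Complex.exp_neg, Complex.ofReal_mul, Complex.ofReal_ofNat, Complex.exp_two_pi_mul_I,
      inv_one]
  simp only [arcFun, this]
  simp [pi_ne_zero]

lemma one_sub_exp_eq (θ : ℝ) : 1 - Complex.exp (θ * Complex.I) =
    ((2 * sin (θ / 2) : ℝ) : ℂ) * Complex.exp (((θ - π) / 2 : ℝ) * Complex.I) := by
  have h : θ = 2 * (θ / 2) := by ring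
  apply Complex.ext
  · rw [Complex.sub_re, Complex.one_re, Complex.exp_ofReal_mul_I_re, Complex.re_ofReal_mul,
      Complex.exp_ofReal_mul_I_re, sub_div, cos_sub_pi_div_two]
    nth_rw 1 [h]
    rw [cos_two_mul]
    nlinarith [sin_sq_add_cos_sq (θ / 2)]
  · rw [Complex.sub_im, Complex.one_im, Complex.exp_ofReal_mul_I_im, Complex.im_ofReal_mul,
      Complex.exp_ofReal_mul_I_im, sub_div, sin_sub_pi_div_two]
    nth_rw 1 [h]
    rw [sin_two_mul]
    ring

lemma log_one_sub_exp_of_pos {θ : ℝ} (h0 : 0 < θ) (h1 : θ < 2 * π) :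
    Complex.log (1 - Complex.exp (θ * Complex.I)) =
      ((log 2 + logSin θ : ℝ) : ℂ) + ((θ - π) / 2 : ℝ) * Complex.I := by
  have hs : 0 < sin (θ / 2) := sin_pos_of_pos_of_lt_pi (by linarith) (by linarith)
  rw [one_sub_exp_eq, Complex.log_ofReal_mul (by positivity) (Complex.exp_ne_zero _),
    log_mul two_ne_zero hs.ne', Complex.log_exp, logSin] <;>
  · rw [Complex.im_ofReal_mul, Complex.I_im]
    linarith

lemma log_one_sub_exp_of_neg {θ : ℝ} (h0 : θ < 0) (h1 : -(2 * π) < θ) :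
    Complex.log (1 - Complex.exp (θ * Complex.I)) =
      ((log 2 + logSin θ : ℝ) : ℂ) + ((θ + π) / 2 : ℝ) * Complex.I := by
  have e : Complex.exp (θ * Complex.I) = Complex.exp (((θ + 2 * π : ℝ) : ℂ) * Complex.I) := by
    rw [Complex.ofReal_add, add_mul, Complex.exp_add, Complex.ofReal_mul, Complex.ofReal_ofNat,
      Complex.exp_two_pi_mul_I, mul_one]
  rw [e, log_one_sub_exp_of_pos (by linarith) (by linarith), logSin_periodic]
  congr 3
  ring

lemma arcFun_circle (a t : ℝ) : arcFun a (Complex.exp (t * Complex.I)) =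
    ((a / (2 * π) : ℝ) : ℂ) * Complex.I + ((1 / π : ℝ) : ℂ) *
      Complex.log (1 - Complex.exp (((t - a : ℝ) : ℂ) * Complex.I)) := by
  rw [arcFun, ← Complex.exp_add, Complex.ofReal_sub]
  ring_nf

lemma arcFun_circle_re {a t : ℝ} (h0 : 0 < |t - a|) (h1 : |t - a| < 2 * π) :
    (arcFun a (Complex.exp (t * Complex.I))).re = (1 / π) * (log 2 + logSin (t - a)) := by
  rw [arcFun_circle]
  rcases lt_or_gt_of_ne (abs_pos.1 h0) with h | h
  · rw [abs_of_neg h] at h1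
    rw [log_one_sub_exp_of_neg h (by linarith)]
    simp only [Complex.add_re, Complex.re_ofReal_mul, Complex.ofReal_re, Complex.I_re]
    ring
  · rw [abs_of_pos h] at h1
    rw [log_one_sub_exp_of_pos h h1]
    simp only [Complex.add_re, Complex.re_ofReal_mul, Complex.ofReal_re, Complex.I_re]
    ring

lemma arcFun_circle_im {a t : ℝ} (h0 : 0 < |t - a|) (h1 : |t - a| < 2 * π) :
    (arcFun a (Complex.exp (t * Complex.I))).im =
      (t - π) / (2 * π) + if t < a then 1 else 0 := by
  rw [arcFun_circle]
  rcases lt_or_gt_of_ne (abs_pos.1 h0) with h | h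
  · rw [abs_of_neg h] at h1
    rw [log_one_sub_exp_of_neg h (by linarith), if_pos (by linarith)]
    simp only [Complex.add_im, Complex.im_ofReal_mul, Complex.ofReal_im, Complex.I_im]
    field_simp
    ring
  · rw [abs_of_pos h] at h1
    rw [log_one_sub_exp_of_pos h h1, if_neg (by linarith)]
    simp only [Complex.add_im, Complex.im_ofReal_mul, Complex.ofReal_im, Complex.I_im]
    field_simp
    ring

lemma continuousAt_arcFun_circle {a t : ℝ} (h0 : 0 < |t - a|) (h1 : |t - a| < 2 * π) :
    ContinuousAt (arcFun a) (Complex.exp (t * Complex.I)) := by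
  have : 1 - Complex.exp (t * Complex.I) * Complex.exp (-(a * Complex.I)) ∈ Complex.slitPlane := by
    rw [← Complex.exp_add, ← sub_eq_add_neg, ← sub_mul, ← Complex.ofReal_sub]
    left
    rw [Complex.sub_re, Complex.one_re, Complex.exp_ofReal_mul_I_re]
    have hs := sin_half_ne_zero h0 h1
    have hc : cos (t - a) = 1 - 2 * sin ((t - a) / 2) ^ 2 := by
      nth_rw 1 [show t - a = 2 * ((t - a) / 2) by ring]
      rw [cos_two_mul]
      nlinarith [sin_sq_add_cos_sq ((t - a) / 2)]
    rw [hc]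
    have := sq_pos_of_ne_zero hs
    linarith
  unfold arcFun
  have : ContinuousAt (fun z => Complex.log (1 - z * Complex.exp (-(a * Complex.I))))
      (Complex.exp (t * Complex.I)) := ContinuousAt.clog (by fun_prop) this
  fun_prop

/-- The Cayley type transform mapping the right half plane to the upper half plane. -/
def cayley (w : ℂ) : ℂ := (1 + Complex.I * w) / (1 - Complex.I * w)

lemma cayley_denom_ne_zero {w : ℂ} (hw : 0 < w.re) : 1 - Complex.I * w ≠ 0 := fun h => by
  have := congrArg Complex.im h
  simp at this
  linarith

lemma cayley_re (w : ℂ) :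
    (cayley w).re = (1 - Complex.normSq w) / Complex.normSq (1 - Complex.I * w) := by
  rw [cayley, Complex.div_re, ← add_div]
  congr 1
  simp [Complex.normSq_apply]
  ring

lemma cayley_im (w : ℂ) : (cayley w).im = 2 * w.re / Complex.normSq (1 - Complex.I * w) := by
  rw [cayley, Complex.div_im, ← sub_div]
  congr 1
  simp
  ring

lemma cayley_im_pos {w : ℂ} (hw : 0 < w.re) : 0 < (cayley w).im := by
  rw [cayley_im]
  have := Complex.normSq_pos.2 (cayley_denom_ne_zero hw)
  positivity

lemma arg_cayley_le {w : ℂ} (hw : 0 < w.re) (h1 : ‖w‖ < 1) :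
    (cayley w).arg ≤ 2 * arctan ‖w‖ := by
  have hd := Complex.normSq_pos.2 (cayley_denom_ne_zero hw)
  have hn : Complex.normSq w < 1 := by
    rw [Complex.normSq_eq_norm_sq]
    nlinarith [norm_nonneg w]
  have hre : 0 < (cayley w).re := by
    rw [cayley_re]
    exact div_pos (by linarith) hd
  have h2 := abs_lt.1 (Complex.abs_arg_lt_pi_div_two_iff.2 (Or.inl hre))
  rw [two_mul_arctan (by linarith [norm_nonneg w]) h1, ← arctan_tan h2.1 h2.2, Complex.tan_arg]
  apply arctan_mono
  rw [cayley_im, cayley_re, div_div_div_cancel_right₀ hd.ne', Complex.normSq_eq_norm_sq]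
  rw [Complex.normSq_eq_norm_sq] at hn
  gcongr
  exact Complex.re_le_norm w

lemma lintegral_arg_cayley_le {W : ℂ → ℂ} (hW : ∀ z, ‖z‖ ≤ 1 → DifferentiableAt ℂ W z)
    (hre : ∀ z, ‖z‖ ≤ 1 → 0 < (W z).re) (h0 : ‖W 0‖ < 1) :
    ∫⁻ t in Ioc (0 : ℝ) (2 * π), ENNReal.ofReal (cayley (W (Complex.exp (t * Complex.I)))).arg ≤
      ENNReal.ofReal (4 * π * arctan ‖W 0‖) := by
  set Φ : ℂ → ℂ := fun z => Complex.log (cayley (W z)) with hΦ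
  have hd : ∀ z, ‖z‖ ≤ 1 → DifferentiableAt ℂ Φ z := fun z hz => by
    have hn := cayley_denom_ne_zero (hre z hz)
    have hWz := hW z hz
    have h1 : DifferentiableAt ℂ (fun z => cayley (W z)) z := by
      unfold cayley
      exact DifferentiableAt.div (by fun_prop) (by fun_prop) hn
    exact h1.clog (Or.inr (cayley_im_pos (hre z hz)).ne')
  have hav := circleAverage_of_differentiable_on_off_countable (f := Φ) (c := 0) (R := 1)
    countable_empty
    (fun z hz => (hd z (by simpa using hz)).continuousAt.continuousWithinAt)
    (fun z hz => hd z (by have := hz.1; simp at this; exact this.le))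
  have hcirc : ∀ t : ℝ, circleMap 0 1 t = Complex.exp (t * Complex.I) := fun t => by
    simp [circleMap]
  have hnorm : ∀ t : ℝ, ‖Complex.exp (t * Complex.I)‖ ≤ 1 := fun t =>
    (Complex.norm_exp_ofReal_mul_I t).le
  have hcont : Continuous fun t : ℝ => Φ (Complex.exp (t * Complex.I)) :=
    continuous_iff_continuousAt.2 fun t =>
      (hd _ (hnorm t)).continuousAt.comp (f := fun t : ℝ => Complex.exp (t * Complex.I))
        (by fun_prop)
  rw [Real.circleAverage_def] at hav
  simp_rw [hcirc] at hav
  have him := congrArg Complex.im hav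
  rw [Complex.smul_im, smul_eq_mul] at him
  have hswap : (∫ t in (0 : ℝ)..(2 * π), Φ (Complex.exp (t * Complex.I))).im =
      ∫ t in (0 : ℝ)..(2 * π), (Φ (Complex.exp (t * Complex.I))).im :=
    (Complex.imCLM.intervalIntegral_comp_comm (hcont.intervalIntegrable _ _)).symm
  rw [hswap] at him
  have hcont' : Continuous fun t : ℝ => (Φ (Complex.exp (t * Complex.I))).im :=
    Complex.continuous_im.comp hcont
  simp only [hΦ, Complex.log_im] at him hcont'
  have hnn : ∀ t : ℝ, 0 ≤ (cayley (W (Complex.exp (t * Complex.I)))).arg := fun t =>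
    Complex.arg_nonneg_iff.2 (cayley_im_pos (hre _ (hnorm t))).le
  rw [← ofReal_integral_eq_lintegral_ofReal hcont'.integrableOn_Ioc (ae_of_all _ hnn),
    ← intervalIntegral.integral_of_le (by positivity)]
  refine ENNReal.ofReal_le_ofReal ?_
  have hle := arg_cayley_le (hre 0 (by simp)) h0
  rw [← him] at hle
  calc _ = (2 * π) * ((2 * π)⁻¹ * ∫ t in (0 : ℝ)..(2 * π),
        (cayley (W (Complex.exp (t * Complex.I)))).arg) := by
          rw [mul_inv_cancel_left₀ (by positivity)]
    _ ≤ (2 * π) * (2 * arctan ‖W 0‖) := by gcongr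
    _ = _ := by ring

lemma tendsto_arg_cayley {ι : Type*} {l : Filter ι} {W : ι → ℂ} {y : ℝ} (hy : 1 < |y|)
    (hW : Tendsto W l (nhds (y * Complex.I))) (hre : ∀ᶠ i in l, 0 < (W i).re) :
    Tendsto (fun i => (cayley (W i)).arg) l (nhds π) := by
  have hne : 1 + y ≠ 0 := fun h => by
    rw [show y = -1 by linarith] at hy
    norm_num at hy
  have hden : 1 - Complex.I * (y * Complex.I) = ((1 + y : ℝ) : ℂ) := by
    push_cast
    linear_combination (-y : ℂ) * Complex.I_sq
  have hnum : 1 + Complex.I * (y * Complex.I) = ((1 - y : ℝ) : ℂ) := by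
    push_cast
    linear_combination (y : ℂ) * Complex.I_sq
  have hval : cayley (y * Complex.I) = (((1 - y) / (1 + y) : ℝ) : ℂ) := by
    rw [cayley, hden, hnum, Complex.ofReal_div]
  have hc : ContinuousAt cayley (y * Complex.I) := by
    unfold cayley
    refine ContinuousAt.div (by fun_prop) (by fun_prop) ?_
    rw [hden]
    exact_mod_cast hne
  have h1 := hc.tendsto.comp hW
  rw [hval] at h1
  have hneg : (1 - y) / (1 + y) < 0 := by
    rcases lt_abs.1 hy with h | h
    · exact div_neg_of_neg_of_pos (by linarith) (by linarith)
    · exact div_neg_of_pos_of_neg (by linarith) (by linarith)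
  refine (Complex.tendsto_arg_nhdsWithin_im_nonneg_of_re_neg_of_im_zero
    (by simpa only [Complex.ofReal_re] using hneg) (Complex.ofReal_im _)).comp ?_
  exact tendsto_nhdsWithin_iff.2 ⟨h1, hre.mono fun i hi => (cayley_im_pos hi).le⟩

/-- The alternating sum of increments of a function along a sequence. -/
def signedSum (n : ℕ) (ε x : ℕ → ℝ) (φ : ℝ → ℝ) : ℝ :=
  ∑ i ∈ Finset.range n, ε i * (φ (x (i + 1)) - φ (x i))

/-- The kernel representing a signed sum of increments of a conjugate function. -/
def jumpKernel (n : ℕ) (ε x : ℕ → ℝ) (t : ℝ) : ℝ :=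
  signedSum n ε x fun a => (1 / π) * logSin (t - a)

/-- Holomorphic extension of `jumpKernel`. -/
def arcSum (n : ℕ) (ε x : ℕ → ℝ) (z : ℂ) : ℂ :=
  ∑ i ∈ Finset.range n, (ε i : ℂ) * (arcFun (x (i + 1)) z - arcFun (x i) z)

section arcs

variable {n : ℕ} {ε x : ℕ → ℝ}

lemma arcSum_re (z : ℂ) : (arcSum n ε x z).re = signedSum n ε x fun a => (arcFun a z).re := by
  rw [arcSum, Complex.re_sum, signedSum]
  exact Finset.sum_congr rfl fun i _ => by rw [Complex.re_ofReal_mul, Complex.sub_re]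

lemma arcSum_im (z : ℂ) : (arcSum n ε x z).im = signedSum n ε x fun a => (arcFun a z).im := by
  rw [arcSum, Complex.im_sum, signedSum]
  exact Finset.sum_congr rfl fun i _ => by rw [Complex.im_ofReal_mul, Complex.sub_im]

lemma abs_signedSum_le (hε : ∀ i, |ε i| = 1) (hx : Monotone x) {φ : ℝ → ℝ} (hφ : Monotone φ) :
    |signedSum n ε x φ| ≤ φ (x n) - φ (x 0) := by
  refine (Finset.abs_sum_le_sum_abs _ _).trans_eq ?_
  rw [← Finset.sum_range_sub (fun i => φ (x i))]
  refine Finset.sum_congr rfl fun i _ => ?_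
  rw [abs_mul, hε, one_mul, abs_of_nonneg (sub_nonneg.2 (hφ (hx i.le_succ)))]

lemma abs_arcSum_im_le (hε : ∀ i, |ε i| = 1) (hx : Monotone x) (h0 : x 0 = 0)
    (hn : x n = 2 * π) {z : ℂ} (hz : ‖z‖ < 1) : |(arcSum n ε x z).im| ≤ 1 := by
  rw [arcSum_im, ← arcFun_two_pi z, ← hn, ← h0]
  exact abs_signedSum_le hε hx (arcFun_im_monotone hz)

lemma arcSum_zero_re : (arcSum n ε x 0).re = 0 := by
  rw [arcSum_re, signedSum]
  refine Finset.sum_eq_zero fun i _ => ?_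
  simp only [arcFun_zero, Complex.re_ofReal_mul, Complex.I_re]
  ring

lemma differentiableAt_arcSum {z : ℂ} (hz : ‖z‖ < 1) : DifferentiableAt ℂ (arcSum n ε x) z := by
  unfold arcSum
  have := fun a => differentiableAt_arcFun hz a
  fun_prop

lemma arcs_dist (hx : Monotone x) (h0 : x 0 = 0) (hn : x n = 2 * π) {t : ℝ}
    (ht : t ∈ Ioo 0 (2 * π)) (hne : ∀ i, t ≠ x i) {i : ℕ} (hi : i ≤ n) :
    0 < |t - x i| ∧ |t - x i| < 2 * π := by
  have h1 := hx (Nat.zero_le i)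
  have h2 := hx hi
  exact ⟨abs_pos.2 (sub_ne_zero.2 (hne i)), abs_lt.2 ⟨by linarith [ht.1], by linarith [ht.2]⟩⟩

lemma continuousAt_arcSum_circle (hx : Monotone x) (h0 : x 0 = 0) (hn : x n = 2 * π) {t : ℝ}
    (ht : t ∈ Ioo 0 (2 * π)) (hne : ∀ i, t ≠ x i) :
    ContinuousAt (arcSum n ε x) (Complex.exp (t * Complex.I)) := by
  unfold arcSum
  refine tendsto_finsetSum _ fun i hi => ?_
  have hi := Finset.mem_range.1 hi
  obtain ⟨a1, a2⟩ := arcs_dist hx h0 hn ht hne (Nat.succ_le_of_lt hi)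
  obtain ⟨b1, b2⟩ := arcs_dist hx h0 hn ht hne hi.le
  exact ((continuousAt_arcFun_circle a1 a2).sub (continuousAt_arcFun_circle b1 b2)).const_mul _

lemma arcSum_circle_re (hx : Monotone x) (h0 : x 0 = 0) (hn : x n = 2 * π) {t : ℝ}
    (ht : t ∈ Ioo 0 (2 * π)) (hne : ∀ i, t ≠ x i) :
    (arcSum n ε x (Complex.exp (t * Complex.I))).re = jumpKernel n ε x t := by
  rw [arcSum_re, jumpKernel, signedSum, signedSum]
  refine Finset.sum_congr rfl fun i hi => ?_
  have hi := Finset.mem_range.1 hi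
  obtain ⟨a1, a2⟩ := arcs_dist hx h0 hn ht hne (Nat.succ_le_of_lt hi)
  obtain ⟨b1, b2⟩ := arcs_dist hx h0 hn ht hne hi.le
  rw [arcFun_circle_re a1 a2, arcFun_circle_re b1 b2]
  ring

lemma arcSum_circle_im (hε : ∀ i, |ε i| = 1) (hx : Monotone x) (h0 : x 0 = 0)
    (hn : x n = 2 * π) {t : ℝ} (ht : t ∈ Ioo 0 (2 * π)) (hne : ∀ i, t ≠ x i) :
    |(arcSum n ε x (Complex.exp (t * Complex.I))).im| = 1 := by
  have hex : ∃ i, t < x i := ⟨n, by rw [hn]; exact ht.2⟩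
  classical
  obtain ⟨j, hj⟩ : ∃ j, Nat.find hex = j + 1 := by
    refine Nat.exists_eq_succ_of_ne_zero fun h => ?_
    have := Nat.find_spec hex
    rw [h, h0] at this
    linarith [ht.1]
  have hj1 : t < x (j + 1) := hj ▸ Nat.find_spec hex
  have hj0 : x j < t := lt_of_le_of_ne (not_lt.1 (Nat.find_min hex (by omega))) (hne j).symm
  have hjn : j < n := by
    by_contra! h
    have := hx h
    linarith [ht.2]
  have key : ∀ i < n, (arcFun (x (i + 1)) (Complex.exp (t * Complex.I))).im -
      (arcFun (x i) (Complex.exp (t * Complex.I))).im = if i = j then 1 else 0 := fun i hi => by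
    obtain ⟨a1, a2⟩ := arcs_dist hx h0 hn ht hne (Nat.succ_le_of_lt hi)
    obtain ⟨b1, b2⟩ := arcs_dist hx h0 hn ht hne hi.le
    rw [arcFun_circle_im a1 a2, arcFun_circle_im b1 b2]
    rcases lt_trichotomy i j with h | h | h
    · have e1 := hx (Nat.succ_le_of_lt h)
      have e2 := hx h.le
      rw [if_neg (by linarith), if_neg (by linarith), if_neg h.ne]
      ring
    · subst h
      rw [if_pos hj1, if_neg (by linarith), if_pos rfl]
      ring
    · have e1 := hx (Nat.succ_le_of_lt h)
      have e2 := hx (Nat.succ_le_of_lt (h.trans i.lt_succ_self))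
      rw [if_pos (by linarith), if_pos (by linarith), if_neg h.ne']
      ring
  rw [arcSum_im, signedSum, Finset.sum_congr rfl fun i hi => by
    rw [key i (Finset.mem_range.1 hi)]]
  simp [hjn, hε]

lemma tendsto_arcSum_radial (hx : Monotone x) (h0 : x 0 = 0) (hn : x n = 2 * π) {t : ℝ}
    (ht : t ∈ Ioo 0 (2 * π)) (hne : ∀ i, t ≠ x i) {ρ : ℕ → ℝ} (hρ : Tendsto ρ atTop (nhds 1)) :
    Tendsto (fun m => arcSum n ε x (ρ m * Complex.exp (t * Complex.I))) atTop
      (nhds (arcSum n ε x (Complex.exp (t * Complex.I)))) := by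
  have h1 : Tendsto (fun m => (ρ m : ℂ) * Complex.exp (t * Complex.I)) atTop
      (nhds (Complex.exp (t * Complex.I))) := by
    have := ((Complex.continuous_ofReal.tendsto 1).comp hρ).mul_const
      (Complex.exp (t * Complex.I))
    simpa using this
  exact (continuousAt_arcSum_circle hx h0 hn ht hne).tendsto.comp h1

lemma measurable_jumpKernel (n : ℕ) (ε x : ℕ → ℝ) : Measurable (jumpKernel n ε x) := by
  unfold jumpKernel signedSum logSin
  refine Finset.measurable_sum _ fun i _ => ?_
  fun_prop

/-- Sharp weak type estimate for the kernels `jumpKernel`. -/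
theorem volume_jumpKernel_gt_le (hε : ∀ i, |ε i| = 1) (hx : Monotone x) (h0 : x 0 = 0)
    (hn : x n = 2 * π) {τ : ℝ} (hτ : 0 < τ) :
    volume {t ∈ Ioc 0 (2 * π) | τ < jumpKernel n ε x t} ≤
      ENNReal.ofReal (4 * arctan (exp (-(π * τ / 2)))) := by
  set k := exp (-(π * τ / 2)) with hk
  have hk0 : 0 < k := exp_pos _
  have hk1 : k < 1 := exp_lt_one_iff.2 (neg_lt_zero.2 (by positivity))
  set ρ : ℕ → ℝ := fun m => 1 - 1 / ((m : ℝ) + 2) with hρ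
  have hρ0 : ∀ m, 0 < ρ m ∧ ρ m < 1 := fun m => by
    have h2 : (0 : ℝ) < (m : ℝ) + 2 := by positivity
    have h3 : 1 / ((m : ℝ) + 2) < 1 := by
      rw [div_lt_one h2]
      linarith [(Nat.cast_nonneg m : (0 : ℝ) ≤ m)]
    have h4 : 0 < 1 / ((m : ℝ) + 2) := by positivity
    exact ⟨by simp only [hρ]; linarith, by simp only [hρ]; linarith⟩
  have hρt : Tendsto ρ atTop (nhds 1) := by
    have : Tendsto (fun m : ℕ => 1 / ((m : ℝ) + 2)) atTop (nhds 0) := by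
      simp only [one_div]
      exact tendsto_inv_atTop_zero.comp
        (tendsto_atTop_add_const_right _ _ tendsto_natCast_atTop_atTop)
    simpa only [sub_zero] using this.const_sub 1
  set W : ℕ → ℂ → ℂ := fun m z =>
    k * Complex.exp (((ρ m * (π / 2) : ℝ) : ℂ) * arcSum n ε x (ρ m * z)) with hW
  have hρz : ∀ m z, ‖z‖ ≤ 1 → ‖(ρ m : ℂ) * z‖ < 1 := fun m z hz => by
    rw [norm_mul, Complex.norm_real, norm_of_nonneg (hρ0 m).1.le]
    calc ρ m * ‖z‖ ≤ ρ m * 1 := by gcongr; exact (hρ0 m).1.le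
      _ < 1 := by linarith [(hρ0 m).2]
  have hWd : ∀ m z, ‖z‖ ≤ 1 → DifferentiableAt ℂ (W m) z := fun m z hz => by
    have h1 : DifferentiableAt ℂ (fun z => arcSum n ε x (ρ m * z)) z :=
      (differentiableAt_arcSum (hρz m z hz)).comp z (f := fun z => (ρ m : ℂ) * z) (by fun_prop)
    simp only [hW]
    fun_prop
  have hWre : ∀ m z, ‖z‖ ≤ 1 → 0 < (W m z).re := fun m z hz => by
    have h1 := abs_arcSum_im_le hε hx h0 hn (hρz m z hz)
    simp only [hW]
    rw [Complex.re_ofReal_mul, Complex.exp_re, Complex.re_ofReal_mul, Complex.im_ofReal_mul]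
    have h2 : |ρ m * (π / 2) * (arcSum n ε x (ρ m * z)).im| < π / 2 := by
      rw [abs_mul, abs_of_pos (mul_pos (hρ0 m).1 pi_div_two_pos)]
      calc _ ≤ ρ m * (π / 2) * 1 :=
            mul_le_mul_of_nonneg_left h1 (mul_pos (hρ0 m).1 pi_div_two_pos).le
        _ < π / 2 := by nlinarith [(hρ0 m).2, pi_pos]
    have := cos_pos_of_mem_Ioo (abs_lt.1 h2)
    positivity
  have hW0 : ∀ m, ‖W m 0‖ = k := fun m => by
    simp only [hW]
    rw [norm_mul, Complex.norm_exp, Complex.re_ofReal_mul, mul_zero, arcSum_zero_re, mul_zero,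
      exp_zero, mul_one, Complex.norm_real, norm_of_nonneg hk0.le]
  set g : ℕ → ℝ → ENNReal := fun m t =>
    ENNReal.ofReal (cayley (W m (Complex.exp (t * Complex.I)))).arg with hg
  have hI : ∀ m, ∫⁻ t in Ioc (0 : ℝ) (2 * π), g m t ≤ ENNReal.ofReal (4 * π * arctan k) :=
    fun m => by
      have := lintegral_arg_cayley_le (hWd m) (hWre m) (by rw [hW0]; exact hk1)
      rwa [hW0] at this
  have hgm : ∀ m, Measurable (g m) := fun m => by
    have hc : Continuous fun t : ℝ => W m (Complex.exp (t * Complex.I)) :=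
      continuous_iff_continuousAt.2 fun t =>
        (hWd m _ (Complex.norm_exp_ofReal_mul_I t).le).continuousAt.comp
          (f := fun t : ℝ => Complex.exp (t * Complex.I)) (by fun_prop)
    have := hc.measurable
    have hcay : Measurable cayley := by
      unfold cayley
      fun_prop
    exact (Complex.measurable_arg.comp (hcay.comp this)).ennreal_ofReal
  set E := {t ∈ Ioc 0 (2 * π) | τ < jumpKernel n ε x t} with hE
  have hlim : ∀ᵐ t ∂(volume.restrict (Ioc 0 (2 * π))),
      E.indicator (fun _ => ENNReal.ofReal π) t ≤ liminf (fun m => g m t) atTop := by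
    have hc : (range x ∪ {2 * π}).Countable := (countable_range x).union (countable_singleton _)
    have h1 : ∀ᵐ t ∂(volume.restrict (Ioc 0 (2 * π))), t ∉ range x ∪ {2 * π} :=
      ae_restrict_of_ae (hc.ae_notMem _)
    filter_upwards [h1, ae_restrict_mem measurableSet_Ioc] with t ht htm
    by_cases htE : t ∈ E
    · rw [indicator_of_mem htE]
      have hne : ∀ i, t ≠ x i := fun i h => ht (Or.inl ⟨i, h.symm⟩)
      have ht2 : t ∈ Ioo 0 (2 * π) := ⟨htm.1, lt_of_le_of_ne htm.2 fun h => ht (Or.inr h)⟩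
      have hlimW : Tendsto (fun m => W m (Complex.exp (t * Complex.I))) atTop
          (nhds (k * Complex.exp (((1 * (π / 2) : ℝ) : ℂ) *
            arcSum n ε x (Complex.exp (t * Complex.I))))) := by
        refine Tendsto.const_mul _ ((Complex.continuous_exp.tendsto _).comp (Tendsto.mul ?_
          (tendsto_arcSum_radial hx h0 hn ht2 hne hρt)))
        exact (Complex.continuous_ofReal.tendsto _).comp (hρt.mul_const _)
      set s := (arcSum n ε x (Complex.exp (t * Complex.I))).im with hs
      have hs1 : |s| = 1 := arcSum_circle_im hε hx h0 hn ht2 hne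
      have hval : (k : ℂ) * Complex.exp (((1 * (π / 2) : ℝ) : ℂ) *
            arcSum n ε x (Complex.exp (t * Complex.I))) =
          ((s * (k * exp (π / 2 * jumpKernel n ε x t)) : ℝ) : ℂ) * Complex.I := by
        have hre := arcSum_circle_re (ε := ε) hx h0 hn ht2 hne
        have hcos : cos (π / 2 * s) = 0 ∧ sin (π / 2 * s) = s := by
          rcases (abs_eq zero_le_one).1 hs1 with h | h <;> rw [h] <;> simp
        apply Complex.ext
        · rw [Complex.re_ofReal_mul, Complex.exp_re, Complex.im_ofReal_mul, Complex.re_ofReal_mul,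
            ← hs, one_mul, hcos.1, Complex.re_ofReal_mul, Complex.I_re]
          ring
        · rw [Complex.im_ofReal_mul, Complex.exp_im, Complex.im_ofReal_mul, Complex.re_ofReal_mul,
            Complex.im_ofReal_mul, ← hs, one_mul, hcos.2, Complex.I_im, hre]
          ring
      rw [hval] at hlimW
      have hbig : 1 < |s * (k * exp (π / 2 * jumpKernel n ε x t))| := by
        rw [abs_mul, hs1, one_mul, hk, ← exp_add, abs_of_pos (exp_pos _), one_lt_exp_iff]
        have := mul_lt_mul_of_pos_left htE.2 pi_div_two_pos
        linarith
      have := tendsto_arg_cayley hbig hlimW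
        (Eventually.of_forall fun m => hWre m _ (Complex.norm_exp_ofReal_mul_I t).le)
      exact ((ENNReal.continuous_ofReal.tendsto π).comp this).liminf_eq.ge
    · rw [indicator_of_notMem htE]
      exact zero_le
  have hmeas := measurable_jumpKernel n ε x
  have hEm : MeasurableSet E :=
    measurableSet_Ioc.inter (measurableSet_lt measurable_const hmeas)
  have hfinal : ENNReal.ofReal π * volume E ≤ ENNReal.ofReal (4 * π * arctan k) := by
    calc ENNReal.ofReal π * volume E
        = ∫⁻ t in Ioc (0 : ℝ) (2 * π), E.indicator (fun _ => ENNReal.ofReal π) t := by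
          rw [lintegral_indicator hEm, lintegral_const, Measure.restrict_restrict hEm,
            Measure.restrict_apply_univ, inter_eq_left.2 fun t ht => ht.1]
      _ ≤ ∫⁻ t in Ioc (0 : ℝ) (2 * π), liminf (fun m => g m t) atTop := lintegral_mono_ae hlim
      _ ≤ liminf (fun m => ∫⁻ t in Ioc (0 : ℝ) (2 * π), g m t) atTop := lintegral_liminf_le hgm
      _ ≤ ENNReal.ofReal (4 * π * arctan k) := by
          refine (liminf_le_liminf (Eventually.of_forall hI)).trans ?_
          simp
  rw [show 4 * π * arctan k = π * (4 * arctan k) by ring, ENNReal.ofReal_mul pi_pos.le] at hfinal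
  exact (ENNReal.mul_le_mul_iff_right (by simpa using pi_pos) ENNReal.ofReal_ne_top).1 hfinal

end arcs

/-- The distribution function of `h` over one period. -/
def distr (h : ℝ → ℝ) (l : ℝ) : ℝ := volume.real ({x | l < h x} ∩ Ioc 0 (2 * π))

lemma measureReal_period_eq {A : Set ℝ} (hA : MeasurableSet A)
    (hp : ∀ x, x + 2 * π ∈ A ↔ x ∈ A) (t : ℝ) :
    volume.real (A ∩ Ioc t (t + 2 * π)) = volume.real (A ∩ Ioc 0 (2 * π)) := by
  have key : ∀ t, volume.real (A ∩ Ioc t (t + 2 * π)) =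
      ∫ x in t..(t + 2 * π), A.indicator (fun _ => (1 : ℝ)) x := fun t => by
    rw [intervalIntegral.integral_of_le (by linarith [pi_pos]), setIntegral_indicator hA,
      setIntegral_const, smul_eq_mul, mul_one, inter_comm]
  have hper : Function.Periodic (A.indicator (fun _ => (1 : ℝ))) (2 * π) := fun x => by
    by_cases hx : x ∈ A
    · rw [indicator_of_mem hx, indicator_of_mem ((hp x).2 hx)]
    · rw [indicator_of_notMem hx, indicator_of_notMem (mt (hp x).1 hx)]
  rw [key, hper.intervalIntegral_add_eq t 0, ← key, zero_add]

lemma measureReal_period_ne_top (A : Set ℝ) (t : ℝ) : volume (A ∩ Ioc t (t + 2 * π)) ≠ ⊤ :=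
  measure_ne_top_of_subset inter_subset_right measure_Ioc_lt_top.ne

section

variable {h : ℝ → ℝ}

lemma distr_nonneg (l : ℝ) : 0 ≤ distr h l := measureReal_nonneg

lemma distr_antitone : Antitone (distr h) := fun _ _ hab =>
  measureReal_mono (inter_subset_inter_left _ fun _ hx => hab.trans_lt hx)
    (measure_ne_top_of_subset inter_subset_right measure_Ioc_lt_top.ne)

lemma measureReal_le_distr_sub (hh : Measurable h) {l l' : ℝ} (hl : l ≤ l') :
    volume.real ({x | l < h x ∧ h x < l'} ∩ Ioc 0 (2 * π)) ≤ distr h l - distr h l' := by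
  have h1 : MeasurableSet ({x | l' < h x} ∩ Ioc 0 (2 * π)) :=
    (measurableSet_lt measurable_const hh).inter measurableSet_Ioc
  have hfin : ∀ A : Set ℝ, volume (A ∩ Ioc 0 (2 * π)) ≠ ⊤ := fun A =>
    measure_ne_top_of_subset inter_subset_right measure_Ioc_lt_top.ne
  rw [le_sub_iff_add_le, distr, ← measureReal_union ?_ h1 (hfin _) (hfin _)]
  · refine measureReal_mono ?_ (hfin _)
    rintro x (⟨⟨hx, -⟩, hx2⟩ | ⟨hx, hx2⟩)
    · exact ⟨hx, hx2⟩
    · exact ⟨hl.trans_lt hx, hx2⟩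
  · rw [Set.disjoint_left]
    rintro x ⟨⟨-, hx⟩, -⟩ ⟨hx', -⟩
    exact lt_asymm hx hx'

lemma measureReal_lt_le (hh : Measurable h) (l : ℝ) :
    volume.real ({x | h x < l} ∩ Ioc 0 (2 * π)) ≤ 2 * π - distr h l := by
  have h1 : MeasurableSet ({x | l < h x} ∩ Ioc 0 (2 * π)) :=
    (measurableSet_lt measurable_const hh).inter measurableSet_Ioc
  have hfin : ∀ A : Set ℝ, volume (A ∩ Ioc 0 (2 * π)) ≠ ⊤ := fun A =>
    measure_ne_top_of_subset inter_subset_right measure_Ioc_lt_top.ne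
  rw [le_sub_iff_add_le, distr, ← measureReal_union ?_ h1 (hfin _) (hfin _),
    ← union_inter_distrib_right]
  · have := measureReal_mono (μ := volume)
      (inter_subset_right : ({x | h x < l} ∪ {x | l < h x}) ∩ Ioc 0 (2 * π) ⊆ _)
      measure_Ioc_lt_top.ne
    rwa [volume_real_Ioc_of_le (by positivity), sub_zero] at this
  · rw [Set.disjoint_left]
    rintro x ⟨hx, -⟩ ⟨hx', -⟩
    exact lt_asymm (show h x < l from hx) hx'

lemma exists_gt_of_distr_pos {l : ℝ} (hl : 0 < distr h l) : ∃ x, l < h x := by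
  by_contra! hc
  have : {x | l < h x} ∩ Ioc 0 (2 * π) = ∅ := by
    rw [eq_empty_iff_forall_notMem]
    rintro x ⟨hx, -⟩
    exact (hc x).not_gt hx
  rw [distr, this, measureReal_empty] at hl
  exact lt_irrefl _ hl

lemma exists_le_of_distr_lt {l : ℝ} (hl : distr h l < 2 * π) : ∃ x, h x ≤ l := by
  by_contra! hc
  have : {x | l < h x} ∩ Ioc 0 (2 * π) = Ioc 0 (2 * π) := inter_eq_right.2 fun x _ => hc x
  rw [distr, this, volume_real_Ioc_of_le (by positivity), sub_zero] at hl
  exact lt_irrefl _ hl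

lemma exists_crossing_left (hh : Continuous h) {l l' p q : ℝ} (hl : l < l') (hqp : q ≤ p)
    (hq : h q ≤ l) (hp : l' ≤ h p) :
    ∃ c d, q ≤ c ∧ c < d ∧ d ≤ p ∧ h c = l ∧ h d = l' ∧ (∀ t ∈ Ioo c d, l < h t ∧ h t < l') ∧
      ∀ t ∈ Ioc c p, l < h t := by
  obtain ⟨c, ⟨hc, hc'⟩⟩ := (isCompact_Icc.inter_right (isClosed_Iic.preimage hh) :
    IsCompact (Icc q p ∩ h ⁻¹' Iic l)).exists_isGreatest ⟨q, ⟨le_rfl, hqp⟩, hq⟩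
  have hgt : ∀ t ∈ Ioc c p, l < h t := fun t ht => by
    by_contra! hcon
    exact (hc' ⟨⟨hc.1.1.trans ht.1.le, ht.2⟩, hcon⟩).not_gt ht.1
  have hcl : h c = l := by
    obtain ⟨t, ht, hte⟩ := intermediate_value_Icc hc.1.2 hh.continuousOn
      (⟨hc.2, hl.le.trans hp⟩ : l ∈ Icc (h c) (h p))
    have := hc' ⟨⟨hc.1.1.trans ht.1, ht.2⟩, hte.le⟩
    rw [← hte, le_antisymm this ht.1]
  obtain ⟨d, ⟨hd, hd'⟩⟩ := (isCompact_Icc.inter_right (isClosed_Ici.preimage hh) :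
    IsCompact (Icc c p ∩ h ⁻¹' Ici l')).exists_isLeast ⟨p, ⟨hc.1.2, le_rfl⟩, hp⟩
  have hdl : h d = l' := by
    obtain ⟨t, ht, hte⟩ := intermediate_value_Icc hd.1.1 hh.continuousOn
      (⟨hcl.le.trans hl.le, hd.2⟩ : l' ∈ Icc (h c) (h d))
    have := hd' ⟨⟨ht.1, ht.2.trans hd.1.2⟩, hte.ge⟩
    rw [← hte, le_antisymm ht.2 this]
  refine ⟨c, d, hc.1.1, lt_of_le_of_ne hd.1.1 fun e => ?_, hd.1.2, hcl, hdl, fun t ht => ⟨?_, ?_⟩,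
    hgt⟩
  · rw [← e, hcl] at hdl
    exact hl.ne hdl
  · exact hgt t ⟨ht.1, ht.2.le.trans hd.1.2⟩
  · by_contra! hcon
    exact (hd' ⟨⟨ht.1.le, ht.2.le.trans hd.1.2⟩, hcon⟩).not_gt ht.2

lemma exists_crossing_right (hh : Continuous h) {l l' p q : ℝ} (hl : l < l') (hqp : p ≤ q)
    (hq : h q ≤ l) (hp : l' ≤ h p) :
    ∃ a b, p ≤ a ∧ a < b ∧ b ≤ q ∧ h a = l' ∧ h b = l ∧ (∀ t ∈ Ioo a b, l < h t ∧ h t < l') ∧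
      ∀ t ∈ Ico p b, l < h t := by
  obtain ⟨c, d, h1, h2, h3, h4, h5, h6, h7⟩ := exists_crossing_left (h := fun t => h (-t))
    (by fun_prop) hl (neg_le_neg hqp) (by simpa using hq) (by simpa using hp)
  refine ⟨-d, -c, by linarith, by linarith, by linarith, h5, h4, fun t ht => ?_, fun t ht => ?_⟩
  · have := h6 (-t) ⟨by linarith [ht.2], by linarith [ht.1]⟩
    simpa using this
  · have := h7 (-t) ⟨by linarith [ht.2], by linarith [ht.1]⟩
    simpa using this

/-- A continuous periodic function reaching `l'` somewhere and not exceeding `l` somewhere has a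
rising and a falling crossing of `(l, l')` bounding an interval where it exceeds `l`. -/
lemma exists_hump (hh : Continuous h) (hp : Function.Periodic h (2 * π)) {l l' : ℝ} (hl : l < l')
    (h1 : ∃ x, l' ≤ h x) (h2 : ∃ x, h x ≤ l) :
    ∃ c d a b, c < d ∧ d ≤ a ∧ a < b ∧ b ≤ c + 2 * π ∧ h c = l ∧ h d = l' ∧ h a = l' ∧ h b = l ∧
      (d - c) + (b - a) ≤ volume.real ({x | l < h x ∧ h x < l'} ∩ Ioc 0 (2 * π)) ∧
      b - c ≤ distr h l := by
  obtain ⟨p, hpp⟩ := h1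
  obtain ⟨y, hy⟩ := h2
  obtain ⟨q, hq, hqy⟩ := hp.exists_mem_Ico two_pi_pos y (p - 2 * π)
  rw [sub_add_cancel] at hq
  rw [hqy] at hy
  obtain ⟨c, d, c1, c2, c3, c4, c5, c6, c7⟩ :=
    exists_crossing_left hh hl hq.2.le hy hpp
  obtain ⟨a, b, b1, b2, b3, b4, b5, b6, b7⟩ :=
    exists_crossing_right (q := q + 2 * π) hh hl (by linarith [hq.1]) (by rwa [hp]) hpp
  have hbc : b ≤ c + 2 * π := by linarith
  refine ⟨c, d, a, b, c2, c3.trans b1, b2, hbc, c4, c5, b4, b5, ?_, ?_⟩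
  · rw [← measureReal_period_eq (A := {x | l < h x ∧ h x < l'})
      ((measurableSet_lt measurable_const hh.measurable).inter
      (measurableSet_lt hh.measurable measurable_const)) (fun x => by simp [hp x]) c]
    have hd : Disjoint (Ioo c d) (Ioo a b) :=
      Set.disjoint_left.2 fun t h1 h2 => by linarith [h1.2, h2.1]
    calc (d - c) + (b - a) = volume.real (Ioo c d ∪ Ioo a b) := by
          rw [measureReal_union hd measurableSet_Ioo measure_Ioo_lt_top.ne
            measure_Ioo_lt_top.ne, volume_real_Ioo_of_le c2.le,
            volume_real_Ioo_of_le b2.le]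
      _ ≤ _ := by
          refine measureReal_mono ?_ (measureReal_period_ne_top _ _)
          rintro t (ht | ht)
          · exact ⟨c6 t ht, ht.1, by linarith [ht.2]⟩
          · exact ⟨b6 t ht, by linarith [ht.1], by linarith [ht.2]⟩
  · rw [distr, ← measureReal_period_eq (measurableSet_lt measurable_const hh.measurable)
      (fun x => by simp [hp x]) c, ← volume_real_Ioo_of_le (by linarith)]
    refine measureReal_mono ?_ (measureReal_period_ne_top _ _)
    intro t ht
    refine ⟨?_, ht.1, by linarith [ht.2]⟩
    rcases le_total t p with h' | h'
    · exact c7 t ⟨ht.1, h'⟩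
    · exact b7 t ⟨h', ht.2⟩

lemma exists_abs_le_of_periodic (hh : Continuous h) (hp : Function.Periodic h (2 * π)) :
    ∃ M, ∀ x, |h x| ≤ M := by
  obtain ⟨M, hM⟩ := isCompact_Icc.exists_bound_of_continuousOn (s := Icc 0 (2 * π)) hh.continuousOn
  refine ⟨M, fun x => ?_⟩
  obtain ⟨y, hy, hxy⟩ := hp.exists_mem_Ico₀ two_pi_pos x
  rw [hxy]
  exact hM y ⟨hy.1, hy.2.le⟩

lemma exists_distr_level (hh : Continuous h) (hp : Function.Periodic h (2 * π)) {l : ℝ} (h0 : 0 < l)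
    (h1 : l ≤ 2 * π) : ∃ c, (∀ x, c < x → distr h x < l) ∧ ∀ x, x < c → l ≤ distr h x := by
  obtain ⟨M, hM⟩ := exists_abs_le_of_periodic hh hp
  have hne : (-M - 1) ∈ {x | l ≤ distr h x} := by
    by_contra hc
    obtain ⟨x, hx⟩ := exists_le_of_distr_lt ((not_le.1 hc).trans_le h1)
    linarith [(abs_le.1 (hM x)).1]
  have hbd : BddAbove {x | l ≤ distr h x} := ⟨M, fun y hy => by
    obtain ⟨x, hx⟩ := exists_gt_of_distr_pos (h0.trans_le hy)
    linarith [(abs_le.1 (hM x)).2]⟩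
  refine ⟨sSup {x | l ≤ distr h x}, fun x hx => ?_, fun x hx => ?_⟩
  · by_contra! hc
    exact (le_csSup hbd hc).not_gt hx
  · obtain ⟨y, hy, hxy⟩ := exists_lt_of_lt_csSup ⟨_, hne⟩ hx
    exact (show l ≤ distr h y from hy).trans (distr_antitone hxy.le)

end

lemma volume_le_of_abs_sub_le {T : Set ℝ} {D : ℝ} (hT : ∀ x ∈ T, ∀ y ∈ T, x < y → y - x ≤ D)
    (hD : 0 ≤ D) : volume T ≤ ENNReal.ofReal D := by
  refine (Real.volume_le_diam T).trans (Metric.ediam_le fun x hx y hy => ?_)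
  rw [edist_dist, Real.dist_eq]
  refine ENNReal.ofReal_le_ofReal ?_
  rcases lt_trichotomy x y with h | h | h
  · rw [abs_sub_comm, abs_of_nonneg (sub_nonneg.2 h.le)]
    exact hT x hx y hy h
  · simpa [h] using hD
  · rw [abs_of_nonneg (sub_nonneg.2 h.le)]
    exact hT y hy x hx h

/-- A function whose decrease is bounded below in terms of its value cannot spend too long between
two levels. -/
lemma volume_le_of_gap {T : Set ℝ} {m Q : ℝ → ℝ} (hQ : Monotone Q) (hQ0 : ∀ x, 0 ≤ Q x) {s e : ℝ}
    (hse : s ≤ e) (hm : ∀ x ∈ T, m x ∈ Icc s e)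
    (hT : ∀ x ∈ T, ∀ y ∈ T, x < y → y - x ≤ 1 / 2 * ((m x - m y) * Q (m x))) :
    volume T ≤ ENNReal.ofReal (1 / 2 * ∫ u in s..e, Q u) := by
  have hint : ∀ a b, IntervalIntegrable Q volume a b := fun a b => hQ.intervalIntegrable
  have hpiece : ∀ u v, u ≤ v →
      volume (T ∩ m ⁻¹' Icc u v) ≤ ENNReal.ofReal (1 / 2 * ((v - u) * Q v)) := fun u v huv => by
    refine volume_le_of_abs_sub_le (fun x hx y hy hxy => (hT x hx.1 y hy.1 hxy).trans ?_)
      (mul_nonneg (by norm_num) (mul_nonneg (sub_nonneg.2 huv) (hQ0 _)))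
    have h1 : m x - m y ≤ v - u := by linarith [hx.2.2, hy.2.1]
    exact mul_le_mul_of_nonneg_left (mul_le_mul h1 (hQ hx.2.2) (hQ0 _) (sub_nonneg.2 huv))
      (by norm_num)
  have hstep : ∀ δ, 0 ≤ δ → ∀ n : ℕ, volume (T ∩ m ⁻¹' Icc s (s + n * δ)) ≤
      ENNReal.ofReal (1 / 2 * (∫ u in s..(s + n * δ), Q u) +
        1 / 2 * (δ * (Q (s + n * δ) - Q s))) := fun δ hδ n => by
    induction n with
    | zero => simpa using hpiece s s le_rfl
    | succ n ih =>
      have hn : s + n * δ ≤ s + (n + 1 : ℕ) * δ := by push_cast; nlinarith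
      have hn0 : s ≤ s + n * δ := by linarith [mul_nonneg n.cast_nonneg hδ]
      have hI : 0 ≤ ∫ u in s..(s + n * δ), Q u :=
        intervalIntegral.integral_nonneg hn0 fun u _ => hQ0 u
      have hlow : δ * Q (s + n * δ) ≤ ∫ u in (s + n * δ)..(s + (n + 1 : ℕ) * δ), Q u := by
        have := intervalIntegral.integral_mono_on hn intervalIntegrable_const (hint _ _)
          fun u hu => hQ hu.1
        rw [intervalIntegral.integral_const, smul_eq_mul] at this
        refine le_of_eq_of_le ?_ this
        push_cast
        ring
      have hsub : T ∩ m ⁻¹' Icc s (s + (n + 1 : ℕ) * δ) ⊆ (T ∩ m ⁻¹' Icc s (s + n * δ)) ∪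
          (T ∩ m ⁻¹' Icc (s + n * δ) (s + (n + 1 : ℕ) * δ)) := fun x hx => by
        rcases le_total (m x) (s + n * δ) with h | h
        · exact Or.inl ⟨hx.1, hx.2.1, h⟩
        · exact Or.inr ⟨hx.1, h, hx.2.2⟩
      refine (measure_mono hsub).trans ((measure_union_le _ _).trans
        ((add_le_add ih (hpiece _ _ hn)).trans ?_))
      rw [← ENNReal.ofReal_add]
      · refine ENNReal.ofReal_le_ofReal ?_
        rw [← intervalIntegral.integral_add_adjacent_intervals (hint s (s + n * δ))
          (hint (s + n * δ) (s + (n + 1 : ℕ) * δ))]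
        have : s + (n + 1 : ℕ) * δ - (s + n * δ) = δ := by push_cast; ring
        rw [this]
        linarith
      · exact add_nonneg (by linarith) (mul_nonneg (by norm_num)
          (mul_nonneg hδ (sub_nonneg.2 (hQ hn0))))
      · exact mul_nonneg (by norm_num) (mul_nonneg (sub_nonneg.2 hn) (hQ0 _))
  have hN : ∀ n : ℕ, volume T ≤ ENNReal.ofReal (1 / 2 * (∫ u in s..e, Q u) +
      1 / 2 * ((e - s) / (n + 1 : ℕ) * (Q e - Q s))) := fun n => by
    have h := hstep ((e - s) / (n + 1 : ℕ)) (div_nonneg (sub_nonneg.2 hse) (Nat.cast_nonneg _)) (n + 1)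
    have he : s + (n + 1 : ℕ) * ((e - s) / (n + 1 : ℕ)) = e := by
      rw [mul_div_cancel₀ _ (Nat.cast_ne_zero.2 n.succ_ne_zero)]
      ring
    rw [he] at h
    exact (measure_mono (fun x hx => ⟨hx, hm x hx⟩ : T ⊆ T ∩ m ⁻¹' Icc s e)).trans h
  have h0 : Tendsto (fun n : ℕ => (e - s) / (n + 1 : ℕ)) atTop (nhds 0) :=
    (tendsto_const_div_atTop_nhds_zero_nat (e - s)).comp (tendsto_add_atTop_nat 1)
  have := ((h0.mul_const (Q e - Q s)).const_mul (1 / 2)).const_add (1 / 2 * ∫ u in s..e, Q u)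
  rw [zero_mul, mul_zero, add_zero] at this
  exact ge_of_tendsto' (ENNReal.tendsto_ofReal this) hN

namespace IsProfile

variable {F : ℝ → ℝ}

lemma monotone_min (hF : IsProfile F) : MonotoneOn (fun u => F (min (u / 2) (π / 2))) (Ici 0) :=
  fun u hu v hv huv => hF.mono
    ⟨le_min (by linarith [mem_Ici.1 hu]) (by positivity), min_le_right _ _⟩
    ⟨le_min (by linarith [mem_Ici.1 hv]) (by positivity), min_le_right _ _⟩
    (min_le_min_right _ (by linarith))

lemma le_min (hF : IsProfile F) {u v : ℝ} (h0 : 0 ≤ v) (h1 : v ≤ π) (hu : v ≤ u / 2) :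
    F v ≤ F (min (u / 2) (π / 2)) := by
  rcases le_total v (π / 2) with h | h
  · exact hF.mono ⟨h0, h⟩ ⟨_root_.le_min (h0.trans hu) (by positivity), min_le_right _ _⟩
      (_root_.le_min hu h)
  · rw [min_eq_right (h.trans hu), ← hF.symm]
    exact hF.mono ⟨by linarith, by linarith⟩ ⟨by positivity, le_rfl⟩ (by linarith)

end IsProfile

section

variable {F h ψ : ℝ → ℝ}

/-- The profile rescaled to lengths and made constant beyond the half period. -/
def capped (F : ℝ → ℝ) (u : ℝ) : ℝ := F (min (max u 0 / 2) (π / 2))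

lemma capped_monotone (hF : IsProfile F) : Monotone (capped F) := fun _ _ huv =>
  hF.monotone_min (mem_Ici.2 (le_max_right _ _)) (mem_Ici.2 (le_max_right _ _))
    (max_le_max_right _ huv)

lemma capped_nonneg (hF : IsProfile F) (u : ℝ) : 0 ≤ capped F u :=
  hF.nonneg (_root_.le_min (by positivity) (by positivity))
    ((min_le_right _ _).trans (by linarith [pi_pos]))

lemma integral_capped {s e : ℝ} (h0 : 0 ≤ s) (hse : s ≤ e) (he : e ≤ π) (hF : IsProfile F) :
    1 / 2 * ∫ u in s..e, capped F u = slope₂ F (s / 2) - slope₂ F (e / 2) := by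
  have h1 : ∫ u in s..e, capped F u = ∫ u in s..e, F (u / 2) := by
    refine intervalIntegral.integral_congr fun u hu => ?_
    rw [uIcc_of_le hse] at hu
    simp only [capped]
    rw [max_eq_left (h0.trans hu.1), min_eq_left (by linarith [hu.2])]
  have h2 := intervalIntegral.integral_add_adjacent_intervals
    (hF.cont.intervalIntegrable (μ := volume) (s / 2) (e / 2))
    (hF.cont.intervalIntegrable (e / 2) (π / 2))
  rw [h1, intervalIntegral.integral_comp_div _ two_ne_zero, smul_eq_mul, slope₂, slope₂, ← h2]
  ring

lemma sub_le_of_hasModulus (hF : IsProfile F) (hd : ∀ x, HasDerivAt h (ψ x) x)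
    (hψ : HasModulus F ψ) (hp : Function.Periodic h (2 * π)) {l l' : ℝ} (hl : l < l')
    (h1 : ∃ x, l' ≤ h x) (h2 : ∃ x, h x ≤ l) :
    l' - l ≤ 1 / 2 * (volume.real ({x | l < h x ∧ h x < l'} ∩ Ioc 0 (2 * π)) *
      capped F (distr h l)) := by
  have hc : Continuous h := continuous_iff_continuousAt.2 fun x => (hd x).continuousAt
  obtain ⟨c, d, a, b, hcd, hda, hab, hbc, hcl, hdl, hal, hbl, hlen, hlen'⟩ :=
    exists_hump hc hp hl h1 h2
  obtain ⟨x, hx, hxe⟩ := exists_hasDerivAt_eq_slope h ψ hcd hc.continuousOn fun x _ => hd x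
  obtain ⟨y, hy, hye⟩ := exists_hasDerivAt_eq_slope h ψ hab hc.continuousOn fun x _ => hd x
  rw [hcl, hdl] at hxe
  rw [hal, hbl] at hye
  have hxy : x ≤ y := by linarith [hx.2, hy.1]
  have hm := hψ x (y - x) (by linarith) (by linarith [hx.1, hy.2])
  rw [add_sub_cancel] at hm
  have hQ : F ((y - x) / 2) ≤ capped F (distr h l) := by
    rw [capped, max_eq_left (distr_nonneg l)]
    exact hF.le_min (by linarith) (by linarith [hx.1, hy.2]) (by linarith [hx.1, hy.2])
  have hQ0 := capped_nonneg hF (distr h l)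
  have hε : 0 < l' - l := sub_pos.2 hl
  have hp1 : 0 < d - c := sub_pos.2 hcd
  have hp2 : 0 < b - a := sub_pos.2 hab
  have h3 : (l' - l) / (d - c) + (l' - l) / (b - a) ≤ 2 * capped F (distr h l) := by
    have e : (l - l') / (b - a) = -((l' - l) / (b - a)) := by rw [← neg_div, neg_sub]
    rw [e] at hye
    linarith [(abs_le.1 hm).1]
  have h4 : 4 * (l' - l) ≤ ((d - c) + (b - a)) * ((l' - l) / (d - c) + (l' - l) / (b - a)) := by
    have : ((d - c) + (b - a)) * ((l' - l) / (d - c) + (l' - l) / (b - a)) - 4 * (l' - l) =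
        (l' - l) * ((d - c) - (b - a)) ^ 2 / ((d - c) * (b - a)) := by
      field_simp
      ring
    have h5 : 0 ≤ (l' - l) * ((d - c) - (b - a)) ^ 2 / ((d - c) * (b - a)) := by positivity
    linarith
  have h6 := mul_le_mul_of_nonneg_left h3 (add_pos hp1 hp2).le
  have h7 := mul_le_mul_of_nonneg_right hlen hQ0
  linarith

lemma HasModulus.neg (hψ : HasModulus F ψ) : HasModulus F (fun x => -ψ x) := fun x d h0 h1 => by
  rw [← abs_neg]
  convert hψ x d h0 h1 using 2
  ring

variable (hF : IsProfile F) (hd : ∀ x, HasDerivAt h (ψ x) x) (hψ : HasModulus F ψ)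
  (hp : Function.Periodic h (2 * π))
include hF hd hψ hp

lemma volume_distr_le_of_le_pi {s e : ℝ} (hs : 0 < s) (hse : s ≤ e) (he : e ≤ π) :
    volume {l | distr h l ∈ Icc s e} ≤ ENNReal.ofReal (slope₂ F (s / 2) - slope₂ F (e / 2)) := by
  have hc : Continuous h := continuous_iff_continuousAt.2 fun x => (hd x).continuousAt
  rw [← integral_capped hs.le hse he hF]
  refine volume_le_of_gap (m := distr h) (capped_monotone hF) (capped_nonneg hF) hse (fun x hx => hx)
    fun x hx y hy hxy => ?_
  obtain ⟨z, hz⟩ := exists_gt_of_distr_pos (hs.trans_le hy.1)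
  refine (sub_le_of_hasModulus hF hd hψ hp hxy ⟨z, hz.le⟩
    (exists_le_of_distr_lt (by linarith [hx.2, pi_pos]))).trans ?_
  exact mul_le_mul_of_nonneg_left (mul_le_mul_of_nonneg_right
    (measureReal_le_distr_sub hc.measurable hxy.le) (capped_nonneg hF _)) (by norm_num)

lemma volume_distr_le_of_pi_le {s e : ℝ} (hs : π ≤ s) (hse : s ≤ e) (he : e < 2 * π) :
    volume {l | distr h l ∈ Icc s e} ≤ ENNReal.ofReal (slope₂ F (s / 2) - slope₂ F (e / 2)) := by
  have hc : Continuous h := continuous_iff_continuousAt.2 fun x => (hd x).continuousAt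
  have e1 : slope₂ F (s / 2) - slope₂ F (e / 2) =
      slope₂ F ((2 * π - e) / 2) - slope₂ F ((2 * π - s) / 2) := by
    rw [show (2 * π - e) / 2 = π - e / 2 by ring, show (2 * π - s) / 2 = π - s / 2 by ring,
      hF.slope_pi_sub, hF.slope_pi_sub]
    ring
  rw [e1, ← integral_capped (by linarith) (by linarith) (by linarith) hF,
    ← Measure.measure_neg]
  refine volume_le_of_gap (m := fun x => 2 * π - distr h (-x)) (capped_monotone hF)
    (capped_nonneg hF) (by linarith) (fun x hx => ?_) fun x hx y hy hxy => ?_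
  · have : distr h (-x) ∈ Icc s e := hx
    exact ⟨by linarith [this.2], by linarith [this.1]⟩
  · have hx' : distr h (-x) ∈ Icc s e := hx
    have hy' : distr h (-y) ∈ Icc s e := hy
    obtain ⟨z, hz⟩ := exists_gt_of_distr_pos (h := h) (l := -x) (by linarith [hx'.1, pi_pos])
    obtain ⟨w, hw⟩ := exists_le_of_distr_lt (h := h) (l := -y) (by linarith [hy'.2, pi_pos])
    have key := sub_le_of_hasModulus (h := fun x => -h x) (ψ := fun x => -ψ x) hF
      (fun x => (hd x).neg) hψ.neg (fun x => by simp only [hp x]) hxy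
      ⟨w, by linarith⟩ ⟨z, by linarith⟩
    have h1 : distr (fun x => -h x) x ≤ 2 * π - distr h (-x) := by
      refine le_of_eq_of_le ?_ (measureReal_lt_le hc.measurable _)
      rw [distr]
      congr 2
      ext t
      show x < -h t ↔ h t < -x
      exact lt_neg
    have h2 : volume.real ({t | x < -h t ∧ -h t < y} ∩ Ioc 0 (2 * π)) ≤
        2 * π - distr h (-x) - (2 * π - distr h (-y)) := by
      have := measureReal_le_distr_sub hc.measurable (neg_le_neg hxy.le)
      have e : {t | x < -h t ∧ -h t < y} = {t | -y < h t ∧ h t < -x} := by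
        ext t
        exact ⟨fun ⟨a, b⟩ => ⟨by linarith, by linarith⟩, fun ⟨a, b⟩ => ⟨by linarith, by linarith⟩⟩
      rw [e]
      linarith
    exact key.trans (mul_le_mul_of_nonneg_left (mul_le_mul h2 (capped_monotone hF h1)
      (capped_nonneg hF _) (measureReal_nonneg.trans h2)) (by norm_num))

lemma volume_distr_le {s e : ℝ} (hs : 0 < s) (hse : s ≤ e) (he : e < 2 * π) :
    volume {l | distr h l ∈ Icc s e} ≤ ENNReal.ofReal (slope₂ F (s / 2) - slope₂ F (e / 2)) := by
  rcases le_total e π with h1 | h1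
  · exact volume_distr_le_of_le_pi hF hd hψ hp hs hse h1
  rcases le_total π s with h2 | h2
  · exact volume_distr_le_of_pi_le hF hd hψ hp h2 hse he
  have hsub : {l | distr h l ∈ Icc s e} ⊆
      {l | distr h l ∈ Icc s π} ∪ {l | distr h l ∈ Icc π e} := fun l hl => by
    rcases le_total (distr h l) π with h | h
    · exact Or.inl ⟨hl.1, h⟩
    · exact Or.inr ⟨h, hl.2⟩
  have hs' : ∀ a b, 0 ≤ a → a ≤ b → b ≤ 2 * π → 0 ≤ slope₂ F (a / 2) - slope₂ F (b / 2) :=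
    fun a b h0 hab hb => sub_nonneg.2 (hF.slope_antitone ⟨by linarith, by linarith⟩
      ⟨by linarith, by linarith⟩ (by linarith))
  refine (measure_mono hsub).trans ((measure_union_le _ _).trans ((add_le_add
    (volume_distr_le_of_le_pi hF hd hψ hp hs h2 le_rfl)
    (volume_distr_le_of_pi_le hF hd hψ hp le_rfl h1 he)).trans_eq ?_))
  rw [← ENNReal.ofReal_add (hs' _ _ hs.le h2 (by linarith [pi_pos])) (hs' _ _ pi_pos.le h1 he.le)]
  congr 1
  ring

end

/-- The levels at which the distribution function lies strictly between `s` and `2π - s`. -/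
lemma volume_distr_Ioo_le_slope {F h ψ : ℝ → ℝ} (hF : IsProfile F)
    (hd : ∀ x, HasDerivAt h (ψ x) x) (hψ : HasModulus F ψ) (hp : Function.Periodic h (2 * π))
    {s : ℝ} (hs : 0 < s) (hs' : s < π) :
    volume {l | distr h l ∈ Ioo s (2 * π - s)} ≤ ENNReal.ofReal (2 * slope₂ F (s / 2)) := by
  refine (measure_mono (fun l hl => Ioo_subset_Icc_self hl :
      _ ⊆ {l | distr h l ∈ Icc s (2 * π - s)})).trans
    ((volume_distr_le hF hd hψ hp hs (by linarith) (by linarith)).trans_eq ?_)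
  rw [show (2 * π - s) / 2 = π - s / 2 by ring, hF.slope_pi_sub]
  congr 1
  ring

lemma volume_distr_Ioo_le_profile {F h : ℝ → ℝ} (hF : IsProfile F) (hc : Continuous h)
    (hh : HasModulus F h) (hp : Function.Periodic h (2 * π)) {s : ℝ} (hs : 0 < s) (hs' : s < π) :
    volume {l | distr h l ∈ Ioo s (2 * π - s)} ≤ ENNReal.ofReal (2 * F ((π - s) / 2)) := by
  refine volume_le_of_abs_sub_le (fun l hl l' hl' hll => ?_)
    (mul_nonneg zero_le_two (hF.nonneg (by linarith) (by linarith)))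
  obtain ⟨z, hz⟩ := exists_gt_of_distr_pos (hs.trans hl'.1)
  obtain ⟨c, d, a, b, hcd, hda, hab, hbc, hcl, hdl, hal, hbl, hlen, -⟩ :=
    exists_hump hc hp hll ⟨z, hz.le⟩ (exists_le_of_distr_lt (by linarith [hl.2]))
  have hlen2 := hlen.trans (measureReal_le_distr_sub hc.measurable hll.le)
  have key : ∀ x y, x < y → y - x ≤ π - s → |h y - h x| ≤ 2 * F ((π - s) / 2) :=
    fun x y hxy hy => by
      have := hh x (y - x) (by linarith) (by linarith)
      rw [add_sub_cancel] at this
      refine this.trans (mul_le_mul_of_nonneg_left (hF.mono ⟨by linarith, by linarith⟩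
        ⟨by linarith, by linarith⟩ (by linarith)) zero_le_two)
  rcases le_total (d - c) (b - a) with h1 | h1
  · have := key c d hcd (by linarith [hl.2, hl'.1])
    rw [hcl, hdl] at this
    exact (le_abs_self _).trans this
  · have := key a b hab (by linarith [hl.2, hl'.1])
    rw [hal, hbl, abs_sub_comm] at this
    exact (le_abs_self _).trans this

section

variable {h : ℝ → ℝ} {v w : ℝ → ENNReal}

/-- Layer-cake estimate: if the masses `∫⁻ x in E, v x` are controlled by the length of `E` through
`w`, then the weighted integral of `h - c` is controlled by the distribution function of `h`. -/
lemma lintegral_layer_le (hh : Measurable h) (hv : Measurable v) (hw : Measurable w)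
    (hvw : ∀ E ⊆ Ioc 0 (2 * π), MeasurableSet E →
      ∫⁻ x in E, v x ≤ ∫⁻ s in Ioo 0 (volume.real E), w s) (c : ℝ) :
    ∫⁻ x in Ioc 0 (2 * π), ENNReal.ofReal (h x - c) * v x ≤
      ∫⁻ s in Ioi 0, w s * volume {l | c < l ∧ s < distr h l} := by
  have hdm : Measurable (distr h) := (distr_antitone (h := h)).measurable
  have hm1 : MeasurableSet {p : ℝ × ℝ | c < p.2 ∧ p.2 < h p.1} :=
    (measurableSet_lt measurable_const measurable_snd).inter
      (measurableSet_lt measurable_snd (hh.comp measurable_fst))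
  have hm2 : MeasurableSet {p : ℝ × ℝ | c < p.2 ∧ p.1 < distr h p.2} :=
    (measurableSet_lt measurable_const measurable_snd).inter
      (measurableSet_lt measurable_fst (hdm.comp measurable_snd))
  calc ∫⁻ x in Ioc 0 (2 * π), ENNReal.ofReal (h x - c) * v x
      = ∫⁻ x in Ioc 0 (2 * π), ∫⁻ l,
          {p : ℝ × ℝ | c < p.2 ∧ p.2 < h p.1}.indicator (fun p => v p.1) (x, l) := by
        refine lintegral_congr fun x => ?_
        have : ∀ l, {p : ℝ × ℝ | c < p.2 ∧ p.2 < h p.1}.indicator (fun p => v p.1) (x, l) =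
            (Ioo c (h x)).indicator (fun _ => v x) l := fun l => rfl
        simp_rw [this]
        rw [lintegral_indicator measurableSet_Ioo, setLIntegral_const, Real.volume_Ioo, mul_comm]
    _ = ∫⁻ l, ∫⁻ x in Ioc 0 (2 * π),
          {p : ℝ × ℝ | c < p.2 ∧ p.2 < h p.1}.indicator (fun p => v p.1) (x, l) :=
        lintegral_lintegral_swap ((hv.comp measurable_fst).indicator hm1).aemeasurable
    _ ≤ ∫⁻ l, ∫⁻ s in Ioi 0,
          {p : ℝ × ℝ | c < p.2 ∧ p.1 < distr h p.2}.indicator (fun p => w p.1) (s, l) := by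
        refine lintegral_mono fun l => ?_
        by_cases hl : c < l
        · have e1 : ∀ x, {p : ℝ × ℝ | c < p.2 ∧ p.2 < h p.1}.indicator (fun p => v p.1) (x, l) =
              {x | l < h x}.indicator v x := fun x => by
            simp [indicator, hl]
          have e2 : ∀ s, {p : ℝ × ℝ | c < p.2 ∧ p.1 < distr h p.2}.indicator
              (fun p => w p.1) (s, l) = (Iio (distr h l)).indicator w s := fun s => by
            simp [indicator, hl]
          have hml : MeasurableSet {x | l < h x} := measurableSet_lt measurable_const hh
          simp_rw [e1, e2]
          rw [lintegral_indicator hml, lintegral_indicator measurableSet_Iio,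
            Measure.restrict_restrict hml, Measure.restrict_restrict measurableSet_Iio, inter_comm (Iio _),
            Ioi_inter_Iio]
          exact hvw _ inter_subset_right (hml.inter measurableSet_Ioc)
        · have e1 : ∀ x, {p : ℝ × ℝ | c < p.2 ∧ p.2 < h p.1}.indicator
              (fun p => v p.1) (x, l) = 0 := fun x => by
            simp [indicator, hl]
          simp [e1]
    _ = ∫⁻ s in Ioi 0, ∫⁻ l,
          {p : ℝ × ℝ | c < p.2 ∧ p.1 < distr h p.2}.indicator (fun p => w p.1) (s, l) :=
        lintegral_lintegral_swap ((hw.comp measurable_snd).indicator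
          (hm2.preimage measurable_swap)).aemeasurable
    _ = _ := by
        refine lintegral_congr fun s => ?_
        have hms : MeasurableSet {l | c < l ∧ s < distr h l} :=
          (measurableSet_lt measurable_const measurable_id).inter
            (measurableSet_lt measurable_const hdm)
        have : ∀ l, {p : ℝ × ℝ | c < p.2 ∧ p.1 < distr h p.2}.indicator (fun p => w p.1) (s, l) =
            {l | c < l ∧ s < distr h l}.indicator (fun _ => w s) l := fun l => rfl
        simp_rw [this]
        rw [lintegral_indicator hms, setLIntegral_const]

lemma lintegral_layer_below_le (hh : Measurable h) (hv : Measurable v) (hw : Measurable w)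
    (hvw : ∀ E ⊆ Ioc 0 (2 * π), MeasurableSet E →
      ∫⁻ x in E, v x ≤ ∫⁻ s in Ioo 0 (volume.real E), w s) (c : ℝ) :
    ∫⁻ x in Ioc 0 (2 * π), ENNReal.ofReal (c - h x) * v x ≤
      ∫⁻ s in Ioi 0, w s * volume {l | l < c ∧ s < 2 * π - distr h l} := by
  have := lintegral_layer_le (h := fun x => -h x) hh.neg hv hw hvw (-c)
  simp only [neg_sub_neg] at this
  refine this.trans (lintegral_mono fun s => mul_le_mul_right ?_ _)
  rw [← Measure.measure_neg]
  refine measure_mono fun l hl => ?_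
  obtain ⟨h1, h2⟩ : -c < -l ∧ s < distr (fun x => -h x) (-l) := hl
  refine ⟨by linarith, h2.trans_le (le_of_eq_of_le ?_ (measureReal_lt_le hh l))⟩
  simp only [distr, neg_lt_neg_iff]

end

lemma integral_le_of_lintegral_ofReal_le {α : Type*} {_ : MeasurableSpace α} {μ : Measure α}
    {f : α → ℝ} {B : ℝ} (hB : 0 ≤ B) (h : ∫⁻ x, ENNReal.ofReal (f x) ∂μ ≤ ENNReal.ofReal B) :
    ∫ x, f x ∂μ ≤ B := by
  by_cases hf : Integrable f μ
  · rw [integral_eq_lintegral_pos_part_sub_lintegral_neg_part hf]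
    have := ENNReal.toReal_mono ENNReal.ofReal_ne_top h
    rw [ENNReal.toReal_ofReal hB] at this
    linarith [ENNReal.toReal_nonneg (a := ∫⁻ a, ENNReal.ofReal (-f a) ∂μ)]
  · rwa [integral_undef hf]

lemma lintegral_Ioo_ofReal {p : ℝ → ℝ} {l : ℝ} (hl : 0 ≤ l) (hp : Continuous p)
    (hp0 : ∀ s, 0 < s → s < l → 0 ≤ p s) :
    ∫⁻ s in Ioo 0 l, ENNReal.ofReal (p s) = ENNReal.ofReal (∫ s in (0 : ℝ)..l, p s) := by
  rw [intervalIntegral.integral_of_le hl, integral_Ioc_eq_integral_Ioo,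
    ofReal_integral_eq_lintegral_ofReal]
  · exact (hp.integrableOn_Icc (a := 0) (b := l)).mono_set Ioo_subset_Icc_self
  · exact (ae_restrict_iff' measurableSet_Ioo).2 (ae_of_all _ fun s hs => hp0 s hs.1 hs.2)

lemma lintegral_indicator_control {I : Set ℝ} (hI : MeasurableSet I) {l : ℝ}
    (hl : volume I ≤ ENNReal.ofReal l) (E : Set ℝ) (hE : E ⊆ Ioc 0 (2 * π)) :
    ∫⁻ x in E, I.indicator 1 x ≤ ∫⁻ s in Ioo 0 (volume.real E), (Iio l).indicator 1 s := by
  have hfin : volume E ≠ ⊤ := measure_ne_top_of_subset hE measure_Ioc_lt_top.ne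
  rw [lintegral_indicator_one hI, lintegral_indicator_one measurableSet_Iio,
    Measure.restrict_apply hI, Measure.restrict_apply measurableSet_Iio, inter_comm (Iio l),
    Ioo_inter_Iio, Real.volume_Ioo, sub_zero, ENNReal.ofReal_min, ofReal_measureReal hfin]
  exact le_min (measure_mono inter_subset_right) ((measure_mono inter_subset_left).trans hl)

lemma setLIntegral_eq_mul_indicator {I : Set ℝ} (hI : MeasurableSet I) (hI' : I ⊆ Ioc 0 (2 * π))
    (f : ℝ → ENNReal) : ∫⁻ x in I, f x = ∫⁻ x in Ioc 0 (2 * π), f x * I.indicator 1 x := by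
  have : ∀ x, f x * I.indicator 1 x = I.indicator f x := fun x => by
    by_cases hx : x ∈ I <;> simp [hx]
  simp_rw [this]
  rw [lintegral_indicator hI, Measure.restrict_restrict hI, inter_eq_left.2 hI']

lemma lintegral_weight_le {l : ℝ} {V : ℝ → ENNReal} {p : ℝ → ℝ} (hl : 0 ≤ l) (hp : Continuous p)
    (hp0 : ∀ s, 0 < s → s < l → 0 ≤ p s)
    (hV : ∀ s, 0 < s → s < l → V s ≤ ENNReal.ofReal (p s)) :
    ∫⁻ s in Ioi 0, (Iio l).indicator 1 s * V s ≤ ENNReal.ofReal (∫ s in (0 : ℝ)..l, p s) := by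
  rw [← lintegral_Ioo_ofReal hl hp hp0]
  have : ∀ s, (Iio l).indicator 1 s * V s = (Iio l).indicator V s := fun s => by
    by_cases hs : s ∈ Iio l <;> simp [hs]
  simp_rw [this]
  rw [lintegral_indicator measurableSet_Iio, Measure.restrict_restrict measurableSet_Iio,
    inter_comm, Ioi_inter_Iio]
  exact setLIntegral_mono' measurableSet_Ioo fun s hs => hV s hs.1 hs.2

section

variable {F h ψ : ℝ → ℝ}

lemma integral_slope_half (F : ℝ → ℝ) (l : ℝ) :
    ∫ s in (0 : ℝ)..l, slope₂ F (s / 2) = 2 * lift₂ F (l / 2) := by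
  rw [intervalIntegral.integral_comp_div _ two_ne_zero, smul_eq_mul, zero_div, lift₂]

lemma integral_le_lift_of_integral_eq_zero (hF : IsProfile F) (hd : ∀ x, HasDerivAt h (ψ x) x)
    (hψ : HasModulus F ψ) (hp : Function.Periodic h (2 * π)) (h0 : ∫ t in 0..(2 * π), h t = 0)
    {l : ℝ} (hl0 : 0 < l) (hl1 : l < 2 * π) : ∫ t in 0..l, h t ≤ 2 * lift₂ F (l / 2) := by
  have hc : Continuous h := continuous_iff_continuousAt.2 fun x => (hd x).continuousAt
  have hint : ∀ a b, IntervalIntegrable h volume a b := fun a b => hc.intervalIntegrable a b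
  obtain ⟨c, hc1, hc2⟩ := exists_distr_level hc hp hl0 hl1.le
  have hpc : Continuous fun s => slope₂ F (s / 2) := hF.continuous_slope.comp (by fun_prop)
  have hanti : ∀ s e, 0 ≤ s → s ≤ e → e ≤ 2 * π → slope₂ F (e / 2) ≤ slope₂ F (s / 2) :=
    fun s e hs hse he => hF.slope_antitone ⟨by linarith, by linarith⟩
      ⟨by linarith, by linarith⟩ (by linarith)
  have hrefl : ∀ s, slope₂ F ((2 * π - s) / 2) = -slope₂ F (s / 2) := fun s => by
    rw [show (2 * π - s) / 2 = π - s / 2 by ring, hF.slope_pi_sub]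
  set q := slope₂ F (l / 2) with hq
  have habove : ∫ t in 0..l, (h t - c) ≤ ∫ s in 0..l, (slope₂ F (s / 2) - q) := by
    rw [intervalIntegral.integral_of_le hl0.le]
    have hpos : ∀ s, 0 ≤ s → s ≤ l → 0 ≤ slope₂ F (s / 2) - q := fun s h1 h2 =>
      sub_nonneg.2 (hanti s l h1 h2 hl1.le)
    refine integral_le_of_lintegral_ofReal_le (intervalIntegral.integral_nonneg hl0.le
      fun s hs => hpos s hs.1 hs.2) ?_
    rw [setLIntegral_eq_mul_indicator measurableSet_Ioc (Ioc_subset_Ioc_right hl1.le)]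
    refine (lintegral_layer_le hc.measurable (measurable_one.indicator measurableSet_Ioc)
      (measurable_one.indicator measurableSet_Iio)
      (fun E hE _ => lintegral_indicator_control (l := l) measurableSet_Ioc (by simp) E hE) c).trans
      (lintegral_weight_le hl0.le (hpc.sub continuous_const)
        (fun s h1 h2 => hpos s h1.le h2.le) fun s hs hs' => ?_)
    refine (measure_mono (fun y hy => ⟨hy.2.le, (hc1 y hy.1).le⟩ :
      _ ⊆ {y | distr h y ∈ Icc s l})).trans (volume_distr_le hF hd hψ hp hs hs'.le hl1)
  have hbelow : ∫ t in l..(2 * π), (c - h t) ≤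
      ∫ s in 0..(2 * π - l), (slope₂ F (s / 2) + q) := by
    rw [intervalIntegral.integral_of_le hl1.le]
    have hpos : ∀ s, 0 ≤ s → s ≤ 2 * π - l → 0 ≤ slope₂ F (s / 2) + q := fun s h1 h2 => by
      have := hanti s (2 * π - l) h1 h2 (by linarith)
      rw [hrefl] at this
      linarith
    refine integral_le_of_lintegral_ofReal_le (intervalIntegral.integral_nonneg (by linarith)
      fun s hs => hpos s hs.1 hs.2) ?_
    rw [setLIntegral_eq_mul_indicator measurableSet_Ioc (Ioc_subset_Ioc_left hl0.le)]
    refine (lintegral_layer_below_le hc.measurable (measurable_one.indicator measurableSet_Ioc)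
      (measurable_one.indicator measurableSet_Iio)
      (fun E hE _ => lintegral_indicator_control (l := 2 * π - l) measurableSet_Ioc (by simp) E hE)
      c).trans (lintegral_weight_le (by linarith) (hpc.add continuous_const)
        (fun s h1 h2 => hpos s h1.le h2.le) fun s hs hs' => ?_)
    refine (measure_mono (fun y hy => ⟨hc2 y hy.1, by linarith [hy.2]⟩ :
      _ ⊆ {y | distr h y ∈ Icc l (2 * π - s)})).trans
      ((volume_distr_le hF hd hψ hp hl0 (by linarith) (by linarith)).trans_eq ?_)
    rw [hrefl, sub_neg_eq_add, add_comm]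
  have hsym : ∫ s in 0..(2 * π - l), slope₂ F (s / 2) = 2 * lift₂ F (l / 2) := by
    rw [integral_slope_half, show (2 * π - l) / 2 = π - l / 2 by ring, hF.lift.symm]
  rw [intervalIntegral.integral_sub (hint _ _) intervalIntegrable_const,
    intervalIntegral.integral_const, intervalIntegral.integral_sub (hpc.intervalIntegrable _ _)
    intervalIntegrable_const, intervalIntegral.integral_const, integral_slope_half, smul_eq_mul,
    smul_eq_mul, sub_zero] at habove
  rw [intervalIntegral.integral_sub intervalIntegrable_const (hint _ _),
    intervalIntegral.integral_const, intervalIntegral.integral_add (hpc.intervalIntegrable _ _)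
    intervalIntegrable_const, intervalIntegral.integral_const, hsym, smul_eq_mul,
    smul_eq_mul, sub_zero] at hbelow
  have hadd := intervalIntegral.integral_add_adjacent_intervals (hint 0 l) (hint l (2 * π))
  rw [h0] at hadd
  have h3 := mul_le_mul_of_nonneg_left habove (sub_nonneg.2 hl1.le)
  have h4 := mul_le_mul_of_nonneg_left hbelow hl0.le
  have h5 : (2 * π) * ∫ t in 0..l, h t ≤ (2 * π) * (2 * lift₂ F (l / 2)) := by
    have e : ∫ t in l..(2 * π), h t = -∫ t in 0..l, h t := by linarith
    rw [e] at h4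
    linarith
  exact le_of_mul_le_mul_left h5 two_pi_pos

lemma HasModulus.lift {f : ℝ → ℝ} (hF : IsProfile F) (hf : ∀ x, HasDerivAt f (h x) x)
    (hd : ∀ x, HasDerivAt h (ψ x) x) (hψ : HasModulus F ψ) (hp : Function.Periodic f (2 * π)) :
    HasModulus (lift₂ F) f := by
  have key : ∀ {f h ψ : ℝ → ℝ}, (∀ x, HasDerivAt f (h x) x) → (∀ x, HasDerivAt h (ψ x) x) →
      HasModulus F ψ → Function.Periodic f (2 * π) → ∀ x d, 0 < d → d < 2 * π →
      f (x + d) - f x ≤ 2 * lift₂ F (d / 2) := by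
    intro f h ψ hf hd hψ hp x d h0 h1
    have hc : Continuous h := continuous_iff_continuousAt.2 fun x => (hd x).continuousAt
    have hhp : Function.Periodic h (2 * π) := fun y => by
      have h2 : HasDerivAt (fun y => f (y + 2 * π)) (h (y + 2 * π)) y :=
        (hf (y + 2 * π)).comp_add_const y (2 * π)
      rw [funext hp] at h2
      exact h2.unique (hf y)
    have hI : ∀ b, ∫ t in 0..b, h (x + t) = f (x + b) - f x := fun b => by
      have := intervalIntegral.integral_eq_sub_of_hasDerivAt (f := fun t => f (x + t)) (a := 0)
        (b := b) (fun t _ => (hf (x + t)).comp_const_add x t)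
        ((hc.comp (by fun_prop)).intervalIntegrable _ _)
      simpa using this
    rw [← hI]
    refine integral_le_lift_of_integral_eq_zero (ψ := fun t => ψ (x + t)) hF
      (fun t => (hd (x + t)).comp_const_add x t) (fun y e h2 h3 => ?_) (fun t => ?_) ?_ h0 h1
    · have := hψ (x + y) e h2 h3
      rwa [add_assoc] at this
    · show h (x + (t + 2 * π)) = h (x + t)
      rw [← add_assoc, hhp]
    · rw [hI, hp, sub_self]
  intro x d h0 h1
  have hF' := hF.lift
  rcases h0.eq_or_lt with rfl | h0
  · simp [hF'.zero]
  rcases h1.eq_or_lt with rfl | h1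
  · have : lift₂ F π = 0 := by
      have := hF'.symm 0
      rwa [sub_zero, hF'.zero] at this
    rw [hp, sub_self, abs_zero, mul_div_cancel_left₀ _ two_ne_zero, this, mul_zero]
  rw [abs_le]
  have h2 := key hf hd hψ hp x d h0 h1
  have h3 := key (fun x => (hf x).neg) (fun x => (hd x).neg) hψ.neg
    (fun x => congrArg Neg.neg (hp x)) x d h0 h1
  simp only [Pi.neg_apply] at h3
  constructor <;> linarith

end

/-- The function `-log (tan (u / 2))`. -/
def logCot (u : ℝ) : ℝ := logSin (u + π) - logSin u

lemma logCot_eq (u : ℝ) : logCot u = -log (tan (u / 2)) := by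
  rw [logCot, logSin, logSin, add_div, sin_add_pi_div_two, tan_eq_sin_div_cos]
  rcases eq_or_ne (sin (u / 2)) 0 with h | h
  · rcases sin_eq_zero_iff_cos_eq.1 h with h' | h' <;> simp [h, h']
  rcases eq_or_ne (cos (u / 2)) 0 with h' | h'
  · have : sin (u / 2) = 1 ∨ sin (u / 2) = -1 := by
      have := sin_sq_add_cos_sq (u / 2)
      rw [h'] at this
      exact sq_eq_one_iff.1 (by linarith)
    rcases this with h'' | h'' <;> simp [h'', h']
  rw [log_div h h']
  ring

lemma intervalIntegrable_logCot (a b : ℝ) : IntervalIntegrable logCot volume a b := by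
  have := (intervalIntegrable_logSin_sub a b (-π)).sub (intervalIntegrable_logSin a b)
  simp only [sub_neg_eq_add] at this
  exact this

lemma logCot_nonneg {u : ℝ} (h0 : 0 ≤ u) (h1 : u ≤ π / 2) : 0 ≤ logCot u := by
  rw [logCot_eq, neg_nonneg]
  refine log_nonpos (tan_nonneg_of_nonneg_of_le_pi_div_two (by linarith) (by linarith)) ?_
  rw [← tan_pi_div_four]
  exact strictMonoOn_tan.monotoneOn ⟨by linarith [pi_pos], by linarith [pi_pos]⟩
    ⟨by linarith [pi_pos], by linarith [pi_pos]⟩ (by linarith)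

lemma lt_logCot {u k : ℝ} (h0 : 0 < u) (hk : u < 2 * arctan (exp (-k))) : k < logCot u := by
  have h2 := arctan_lt_pi_div_two (exp (-k))
  rw [logCot_eq, lt_neg, ← log_exp (-k)]
  refine log_lt_log (tan_pos_of_pos_of_lt_pi_div_two (by linarith) (by linarith)) ?_
  rw [← tan_arctan (exp (-k))]
  exact strictMonoOn_tan ⟨by linarith, by linarith⟩
    ⟨by linarith [neg_pi_div_two_lt_arctan (exp (-k))], h2⟩
    (by linarith)

/-- The rearrangement majorising every `jumpKernel`. -/
def starKernel : ℝ → ℝ := (Ioo 0 π).indicator fun s => 2 / π * logCot (s / 2)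

lemma measurable_starKernel : Measurable starKernel := by
  refine Measurable.indicator ?_ measurableSet_Ioo
  unfold logCot logSin
  fun_prop

lemma starKernel_nonneg (s : ℝ) : 0 ≤ starKernel s :=
  indicator_nonneg (fun s hs => mul_nonneg (by positivity)
    (logCot_nonneg (by linarith [hs.1]) (by linarith [hs.2]))) s

lemma lintegral_jumpKernel_le {n : ℕ} {ε x : ℕ → ℝ} (hε : ∀ i, |ε i| = 1) (hx : Monotone x)
    (h0 : x 0 = 0) (hn : x n = 2 * π) (E : Set ℝ) (hE : E ⊆ Ioc 0 (2 * π)) :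
    ∫⁻ t in E, ENNReal.ofReal (jumpKernel n ε x t) ≤
      ∫⁻ s in Ioo 0 (volume.real E), ENNReal.ofReal (starKernel s) := by
  have hfin : volume E ≠ ⊤ := measure_ne_top_of_subset hE measure_Ioc_lt_top.ne
  have hS : Measurable fun t => max (jumpKernel n ε x t) 0 :=
    (measurable_jumpKernel n ε x).max measurable_const
  have e : ∀ t, ENNReal.ofReal (jumpKernel n ε x t) = ENNReal.ofReal (max (jumpKernel n ε x t) 0) :=
    fun t => by rw [ENNReal.ofReal_max, ENNReal.ofReal_zero, max_eq_left zero_le]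
  simp_rw [e]
  rw [lintegral_eq_lintegral_meas_lt _ (f := fun t => max (jumpKernel n ε x t) 0)
    (ae_of_all _ fun _ => le_max_right _ _) hS.aemeasurable,
    lintegral_eq_lintegral_meas_lt _ (ae_of_all _ starKernel_nonneg)
    measurable_starKernel.aemeasurable]
  refine setLIntegral_mono' measurableSet_Ioi fun τ hτ => ?_
  have hτ : 0 < τ := hτ
  rw [Measure.restrict_apply (measurableSet_lt measurable_const hS),
    Measure.restrict_apply (measurableSet_lt measurable_const measurable_starKernel)]
  set k := arctan (exp (-(π * τ / 2))) with hk
  have hkπ : k < π / 4 := by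
    rw [hk, ← arctan_one]
    exact arctan_strictMono (exp_lt_one_iff.2 (neg_lt_zero.2 (by positivity)))
  calc volume ({t | τ < max (jumpKernel n ε x t) 0} ∩ E)
      ≤ min (volume E) (ENNReal.ofReal (4 * k)) := by
        refine le_min (measure_mono inter_subset_right)
          ((measure_mono ?_).trans (volume_jumpKernel_gt_le hε hx h0 hn hτ))
        rintro t ⟨ht, htE⟩
        exact ⟨hE htE, (lt_max_iff.1 ht).resolve_right hτ.not_gt⟩
    _ = volume (Ioo 0 (min (volume.real E) (4 * k))) := by
        rw [Real.volume_Ioo, sub_zero, ENNReal.ofReal_min, ofReal_measureReal hfin]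
    _ ≤ _ := by
        refine measure_mono fun s hs => ?_
        obtain ⟨h1, h2⟩ := lt_min_iff.1 hs.2
        refine ⟨?_, hs.1, h1⟩
        have : s ∈ Ioo 0 π := ⟨hs.1, by linarith⟩
        show τ < starKernel s
        rw [starKernel, indicator_of_mem this]
        have := lt_logCot (u := s / 2) (k := π * τ / 2) (by linarith [hs.1]) (by linarith)
        have h3 := mul_lt_mul_of_pos_left this (by positivity : 0 < 2 / π)
        refine lt_of_eq_of_lt ?_ h3
        field_simp

lemma neg_jumpKernel (n : ℕ) (ε x : ℕ → ℝ) (t : ℝ) :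
    -jumpKernel n ε x t = jumpKernel n (fun i => -ε i) x t := by
  simp only [jumpKernel, signedSum, neg_mul, Finset.sum_neg_distrib]

lemma signedSum_conjLog {h : ℝ → ℝ} (hh : Continuous h) (n : ℕ) (ε x : ℕ → ℝ) :
    signedSum n ε x (conjLog h) = ∫ t in 0..(2 * π), h t * jumpKernel n ε x t := by
  simp only [signedSum, jumpKernel, Finset.mul_sum]
  rw [intervalIntegral.integral_finsetSum]
  · refine Finset.sum_congr rfl fun i _ => ?_
    rw [conjLog_sub hh, ← intervalIntegral.integral_const_mul]
    refine intervalIntegral.integral_congr fun t _ => ?_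
    ring
  · intro i _
    have := ((((intervalIntegrable_logSin_sub 0 (2 * π) (x (i + 1))).const_mul (1 / π)).sub
      ((intervalIntegrable_logSin_sub 0 (2 * π) (x i)).const_mul (1 / π))).const_mul
      (ε i)).continuousOn_mul hh.continuousOn
    exact this

lemma conjLog_sub_const {h : ℝ → ℝ} (hh : Continuous h) (c : ℝ) :
    ∃ k, ∀ x, conjLog (fun t => h t - c) x = conjLog h x - k := by
  refine ⟨c * ((1 / π) * ∫ t in (-π)..π, logSin t), fun x => ?_⟩
  have h1 := conjLog_eq (h := fun _ => 1) (fun _ => rfl) x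
  simp only [one_mul] at h1
  rw [intervalIntegral.integral_comp_sub_right (fun t => logSin t)] at h1
  simp only [sub_sub_cancel_left, add_sub_cancel_left] at h1
  rw [← h1]
  simp only [conjLog, sub_mul, one_mul]
  rw [intervalIntegral.integral_sub (intervalIntegrable_mul_logSin_sub hh _ _ _)
    ((intervalIntegrable_logSin_sub _ _ _).const_mul c), intervalIntegral.integral_const_mul]
  ring

lemma integral_starKernel (G : ℝ → ℝ) :
    ∫ s in 0..π, 2 / π * logCot (s / 2) * (2 * G (s / 2)) =
      8 / π * ∫ u in 0..(π / 2), G u * logCot u := by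
  rw [intervalIntegral.integral_comp_div (fun u => 2 / π * logCot u * (2 * G u)) two_ne_zero,
    smul_eq_mul, zero_div, ← intervalIntegral.integral_const_mul,
    ← intervalIntegral.integral_const_mul]
  refine intervalIntegral.integral_congr fun u _ => ?_
  ring

lemma signedSum_conjLog_le {h G : ℝ → ℝ} (hh : Continuous h) (hp : Function.Periodic h (2 * π))
    (hG : Continuous G) (hG0 : ∀ u, 0 ≤ u → u ≤ π / 2 → 0 ≤ G u)
    (hN : ∀ s, 0 < s → s < π →
      volume {l | distr h l ∈ Ioo s (2 * π - s)} ≤ ENNReal.ofReal (2 * G (s / 2)))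
    {n : ℕ} {ε x : ℕ → ℝ} (hε : ∀ i, |ε i| = 1) (hx : Monotone x)
    (h0 : x 0 = 0) (hn : x n = 2 * π) :
    signedSum n ε x (conjLog h) ≤ 8 / π * ∫ u in 0..(π / 2), G u * logCot u := by
  obtain ⟨c, hc1, hc2⟩ := exists_distr_level hh hp pi_pos (by linarith [pi_pos])
  obtain ⟨k, hk⟩ := conjLog_sub_const hh c
  have e1 : signedSum n ε x (conjLog h) = signedSum n ε x (conjLog fun t => h t - c) := by
    simp only [signedSum, hk, sub_sub_sub_cancel_right]
  have hnn : ∀ s, s ∈ Icc 0 π → 0 ≤ 2 / π * logCot (s / 2) * (2 * G (s / 2)) := fun s hs =>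
    mul_nonneg (mul_nonneg (by positivity)
      (logCot_nonneg (by linarith [hs.1]) (by linarith [hs.2])))
      (mul_nonneg zero_le_two (hG0 _ (by linarith [hs.1]) (by linarith [hs.2])))
  have hint : IntervalIntegrable (fun s => 2 / π * logCot (s / 2) * (2 * G (s / 2))) volume 0 π := by
    have h1 : IntervalIntegrable (fun s => logCot (s / 2)) volume 0 π := by
      have := (intervalIntegrable_logCot 0 (π / 2)).comp_mul_left (c := 1 / 2)
      convert this using 1
      · ext s
        ring_nf
      · simp
      · field_simp
    exact (h1.const_mul (2 / π)).mul_continuousOn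
      (continuous_const.mul (hG.comp (by fun_prop : Continuous fun s : ℝ => s / 2))).continuousOn
  set S := jumpKernel n ε x with hS
  have hSm : Measurable S := measurable_jumpKernel n ε x
  have hw : Measurable fun s => ENNReal.ofReal (starKernel s) := measurable_starKernel.ennreal_ofReal
  have hdm : Measurable (distr h) := (distr_antitone (h := h)).measurable
  rw [e1, signedSum_conjLog (h := fun t => h t - c) (hh.sub continuous_const), ← integral_starKernel,
    intervalIntegral.integral_of_le two_pi_pos.le]
  refine integral_le_of_lintegral_ofReal_le
    (intervalIntegral.integral_nonneg pi_pos.le hnn) ?_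
  calc ∫⁻ t in Ioc 0 (2 * π), ENNReal.ofReal ((h t - c) * S t)
      ≤ ∫⁻ t in Ioc 0 (2 * π), (ENNReal.ofReal (h t - c) * ENNReal.ofReal (S t) +
          ENNReal.ofReal (c - h t) * ENNReal.ofReal (-S t)) := by
        refine lintegral_mono fun t => ?_
        rcases le_total c (h t) with hc | hc
        · rw [ENNReal.ofReal_mul (sub_nonneg.2 hc)]
          exact le_self_add
        · rw [← neg_mul_neg, neg_sub, ENNReal.ofReal_mul (sub_nonneg.2 hc)]
          exact le_add_self
    _ ≤ (∫⁻ s in Ioi 0, ENNReal.ofReal (starKernel s) * volume {l | c < l ∧ s < distr h l}) +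
          ∫⁻ s in Ioi 0, ENNReal.ofReal (starKernel s) *
            volume {l | l < c ∧ s < 2 * π - distr h l} := by
        rw [lintegral_add_left (by fun_prop)]
        refine add_le_add ?_ ?_
        · exact lintegral_layer_le hh.measurable hSm.ennreal_ofReal hw
            (fun E hE _ => lintegral_jumpKernel_le hε hx h0 hn E hE) c
        · refine lintegral_layer_below_le hh.measurable hSm.neg.ennreal_ofReal hw
            (fun E hE _ => ?_) c
          simp only [hS, Pi.neg_apply, neg_jumpKernel]
          exact lintegral_jumpKernel_le (fun i => by rw [abs_neg, hε]) hx h0 hn E hE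
    _ ≤ ∫⁻ s in Ioi 0, (Ioo 0 π).indicator
          (fun s => ENNReal.ofReal (2 / π * logCot (s / 2) * (2 * G (s / 2)))) s := by
        refine (le_lintegral_add _ _).trans (lintegral_mono fun s => ?_)
        by_cases hs : s ∈ Ioo 0 π
        · have hu : volume {l | c < l ∧ s < distr h l} +
              volume {l | l < c ∧ s < 2 * π - distr h l} ≤ ENNReal.ofReal (2 * G (s / 2)) := by
            rw [← measure_union]
            · refine (measure_mono ?_).trans (hN s hs.1 hs.2)
              rintro l (⟨h1, h2⟩ | ⟨h1, h2⟩)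
              · exact ⟨h2, by linarith [hc1 l h1, hs.2]⟩
              · exact ⟨by linarith [hc2 l h1, hs.2], by linarith⟩
            · exact Set.disjoint_left.2 fun l h1 h2 => lt_asymm h1.1 h2.1
            · exact (measurableSet_lt measurable_id measurable_const).inter
                (measurableSet_lt measurable_const (measurable_const.sub hdm))
          simp only [starKernel, indicator_of_mem hs]
          rw [← mul_add, ENNReal.ofReal_mul (mul_nonneg (by positivity)
            (logCot_nonneg (by linarith [hs.1]) (by linarith [hs.2])))]
          exact mul_le_mul_right hu _
        · simp [starKernel, hs]
    _ = _ := by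
        rw [lintegral_indicator measurableSet_Ioo, Measure.restrict_restrict measurableSet_Ioo,
          inter_eq_left.2 Ioo_subset_Ioi_self, intervalIntegral.integral_of_le pi_pos.le,
          integral_Ioc_eq_integral_Ioo, ofReal_integral_eq_lintegral_ofReal]
        · rw [intervalIntegrable_iff_integrableOn_Ioo_of_le pi_pos.le] at hint
          exact hint
        · exact (ae_restrict_iff' measurableSet_Ioo).2
            (ae_of_all _ fun s hs => hnn s (Ioo_subset_Icc_self hs))

/-- The total variation of the conjugate function is controlled by the level sets of `h`. -/
theorem eVariationOn_conjLog_le {h G : ℝ → ℝ} (hh : Continuous h)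
    (hp : Function.Periodic h (2 * π)) (hG : Continuous G)
    (hG0 : ∀ u, 0 ≤ u → u ≤ π / 2 → 0 ≤ G u)
    (hN : ∀ s, 0 < s → s < π →
      volume {l | distr h l ∈ Ioo s (2 * π - s)} ≤ ENNReal.ofReal (2 * G (s / 2))) :
    eVariationOn (conjLog h) (Icc 0 (2 * π)) ≤
      ENNReal.ofReal (8 / π * ∫ u in 0..(π / 2), G u * logCot u) := by
  refine iSup_le fun ⟨n, u, hu, hmem⟩ => ?_
  set x : ℕ → ℝ := fun i => i.casesOn 0 fun j => if j ≤ n then u j else 2 * π with hxdef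
  have hx0 : x 0 = 0 := rfl
  have hxs : ∀ j, x (j + 1) = if j ≤ n then u j else 2 * π := fun _ => rfl
  have hxm : Monotone x := by
    refine monotone_nat_of_le_succ fun i => ?_
    rcases i with _ | i
    · rw [hx0, hxs, if_pos n.zero_le]
      exact (hmem 0).1
    · rw [hxs, hxs]
      split_ifs with h1 h2 h2
      · exact hu i.le_succ
      · exact (hmem i).2
      · omega
      · exact le_rfl
  have hxn : x (n + 2) = 2 * π := by rw [hxs, if_neg (by omega)]
  set ε : ℕ → ℝ := fun i => if 0 ≤ conjLog h (x (i + 1)) - conjLog h (x i) then 1 else -1 with hε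
  have hε1 : ∀ i, |ε i| = 1 := fun i => by
    simp only [hε]
    split_ifs <;> simp
  have hεs : ∀ i, ε i * (conjLog h (x (i + 1)) - conjLog h (x i)) =
      |conjLog h (x (i + 1)) - conjLog h (x i)| := fun i => by
    simp only [hε]
    split_ifs with h1
    · rw [one_mul, abs_of_nonneg h1]
    · rw [neg_one_mul, abs_of_neg (not_le.1 h1)]
  have key := signedSum_conjLog_le hh hp hG hG0 hN (n := n + 2) hε1 hxm hx0 hxn
  simp only [signedSum, hεs] at key
  have hsum : ∑ i ∈ Finset.range n, edist (conjLog h (u (i + 1))) (conjLog h (u i)) =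
      ENNReal.ofReal (∑ i ∈ Finset.range n, |conjLog h (u (i + 1)) - conjLog h (u i)|) := by
    rw [ENNReal.ofReal_sum_of_nonneg fun _ _ => abs_nonneg _]
    exact Finset.sum_congr rfl fun i _ => by rw [edist_dist, Real.dist_eq]
  refine hsum.trans_le (ENNReal.ofReal_le_ofReal (le_trans ?_ key))
  rw [Finset.sum_range_succ', Finset.sum_range_succ]
  have : ∑ i ∈ Finset.range n, |conjLog h (u (i + 1)) - conjLog h (u i)| =
      ∑ i ∈ Finset.range n, |conjLog h (x (i + 1 + 1)) - conjLog h (x (i + 1))| := by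
    refine Finset.sum_congr rfl fun i hi => ?_
    have := Finset.mem_range.1 hi
    rw [hxs, hxs, if_pos (by omega), if_pos (by omega)]
  rw [this]
  linarith [abs_nonneg (conjLog h (x (n + 1 + 1)) - conjLog h (x (n + 1))),
    abs_nonneg (conjLog h (x (0 + 1)) - conjLog h (x 0))]

/-- The Abel means of the Fourier series of `logCot`. -/
def abelLogCot (ρ u : ℝ) : ℝ :=
  log ((1 + ρ ^ 2 + 2 * ρ * cos u) / (1 + ρ ^ 2 - 2 * ρ * cos u)) / 2

lemma abelLogCot_one (u : ℝ) : abelLogCot 1 u = logCot u := by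
  have h1 : (1 : ℝ) + 1 ^ 2 + 2 * 1 * cos u = 4 * cos (u / 2) ^ 2 := by
    rw [cos_sq, mul_div_cancel₀ u two_ne_zero]; ring
  have h2 : (1 : ℝ) + 1 ^ 2 - 2 * 1 * cos u = 4 * sin (u / 2) ^ 2 := by
    rw [sin_sq, cos_sq, mul_div_cancel₀ u two_ne_zero]; ring
  rw [abelLogCot, h1, h2, logCot_eq, mul_div_mul_left _ _ four_ne_zero, ← div_pow, log_pow,
    tan_eq_sin_div_cos, ← log_inv, inv_div]
  push_cast
  ring

lemma hasSum_abelLogCot {ρ : ℝ} (h0 : 0 ≤ ρ) (h1 : ρ < 1) (u : ℝ) :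
    HasSum (fun i : ℕ => 2 * (ρ ^ (2 * i + 1) * cos ((2 * i + 1) * u) / (2 * i + 1)))
      (abelLogCot ρ u) := by
  set z : ℂ := ρ * Complex.exp (u * Complex.I) with hz
  have hn : ‖z‖ = ρ := by
    rw [hz, norm_mul, Complex.norm_exp_ofReal_mul_I, mul_one, Complex.norm_real, norm_of_nonneg h0]
  have hs := (Complex.hasSum_arctan (z := -Complex.I * z) (by simp [hn, h1])).mul_left Complex.I
  have hre : z.re = ρ * cos u := by
    rw [hz, Complex.re_ofReal_mul, Complex.exp_ofReal_mul_I_re]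
  have him : z.im = ρ * sin u := by
    rw [hz, Complex.im_ofReal_mul, Complex.exp_ofReal_mul_I_im]
  have hsc := sin_sq_add_cos_sq u
  have e1 : ‖1 + z‖ ^ 2 = 1 + ρ ^ 2 + 2 * ρ * cos u := by
    rw [Complex.sq_norm, Complex.normSq_apply]
    simp only [Complex.add_re, Complex.add_im, Complex.one_re, Complex.one_im, hre, him]
    linear_combination ρ ^ 2 * hsc
  have e2 : ‖1 - z‖ ^ 2 = 1 + ρ ^ 2 - 2 * ρ * cos u := by
    rw [Complex.sq_norm, Complex.normSq_apply]
    simp only [Complex.sub_re, Complex.sub_im, Complex.one_re, Complex.one_im, hre, him]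
    linear_combination ρ ^ 2 * hsc
  have harc : Complex.I * Complex.arctan (-Complex.I * z) =
      ((1 / 2 : ℝ) : ℂ) * Complex.log ((1 + z) / (1 - z)) := by
    have : -Complex.I * z * Complex.I = z := by
      linear_combination -z * Complex.I_mul_I
    rw [Complex.arctan, this]
    push_cast
    linear_combination -(1 / 2 : ℂ) * Complex.log ((1 + z) / (1 - z)) * Complex.I_mul_I
  have hval : (Complex.I * Complex.arctan (-Complex.I * z)).re * 2 = abelLogCot ρ u := by
    rw [harc, Complex.re_ofReal_mul, Complex.log_re, norm_div, abelLogCot, ← e1, ← e2, ← div_pow,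
      log_pow]
    push_cast
    ring
  have hs' := (Complex.hasSum_re hs).mul_left 2
  rw [mul_comm _ (Complex.re _), hval] at hs'
  refine hs'.congr_fun fun i => ?_
  have hI : (-Complex.I) ^ (2 * i + 1) = (-1) ^ i * -Complex.I := by
    rw [pow_succ, pow_mul, neg_sq, Complex.I_sq]
  have hpow : z ^ (2 * i + 1) =
      (ρ ^ (2 * i + 1) : ℝ) * Complex.exp (((2 * i + 1) * u : ℝ) * Complex.I) := by
    rw [hz, mul_pow, ← Complex.exp_nat_mul]
    push_cast
    ring_nf
  have hsq : ((-1 : ℂ) ^ i) * (-1) ^ i = 1 := by rw [← mul_pow]; simp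
  have : Complex.I * ((-1) ^ i * (-Complex.I * z) ^ (2 * i + 1) / ((2 * i + 1 : ℕ) : ℂ)) =
      (ρ ^ (2 * i + 1) / (2 * i + 1) : ℝ) * Complex.exp (((2 * i + 1) * u : ℝ) * Complex.I) := by
    rw [mul_pow, hI, hpow]
    push_cast
    linear_combination -(ρ : ℂ) ^ (2 * i + 1) / (2 * i + 1) * Complex.exp ((2 * i + 1) * u * Complex.I)
      * (Complex.I * Complex.I * hsq + Complex.I_mul_I)
  rw [this, Complex.re_ofReal_mul, Complex.exp_ofReal_mul_I_re]
  ring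

lemma abs_abelLogCot_le {ρ u : ℝ} (h0 : 0 ≤ ρ) (hu0 : 0 < u) (hu1 : u ≤ π / 2) :
    |abelLogCot ρ u| ≤ logCot u := by
  have hc0 : 0 ≤ cos u := cos_nonneg_of_mem_Icc ⟨by linarith, hu1⟩
  have hc1 : cos u < 1 := by
    rw [← cos_zero]
    exact cos_lt_cos_of_nonneg_of_le_pi_div_two le_rfl hu1 hu0
  have hpos : 0 < 1 + ρ ^ 2 - 2 * ρ * cos u := by nlinarith [sq_nonneg (1 - ρ)]
  have hρc : 0 ≤ ρ * cos u := mul_nonneg h0 hc0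
  rw [← abelLogCot_one, abelLogCot, abelLogCot, abs_of_nonneg]
  · refine div_le_div_of_nonneg_right (log_le_log (div_pos (by linarith) hpos) ?_) zero_le_two
    rw [div_le_div_iff₀ hpos (by linarith)]
    nlinarith [mul_nonneg hc0 (sq_nonneg (1 - ρ))]
  · refine div_nonneg (log_nonneg ?_) zero_le_two
    rw [le_div_iff₀ hpos]
    linarith

lemma integral_mul_abelLogCot {G : ℝ → ℝ} (hG : Continuous G) {ρ : ℝ} (h0 : 0 ≤ ρ) (h1 : ρ < 1) :
    ∫ u in 0..(π / 2), G u * abelLogCot ρ u =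
      2 * ∑' i : ℕ, ρ ^ (2 * i + 1) *
        ((∫ u in 0..(π / 2), G u * cos ((2 * i + 1) * u)) / (2 * i + 1)) := by
  have hs : Summable fun i : ℕ => 2 * ρ ^ (2 * i + 1) := by
    have := (summable_geometric_of_lt_one (sq_nonneg ρ) (by nlinarith)).mul_left (2 * ρ)
    refine this.congr fun i => ?_
    rw [pow_succ ρ (2 * i), pow_mul]
    ring
  have hterm : ∀ (i : ℕ) u,
      |2 * (ρ ^ (2 * i + 1) * cos ((2 * i + 1) * u) / (2 * i + 1))| ≤ 2 * ρ ^ (2 * i + 1) := by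
    intro i u
    rw [abs_mul, abs_div, abs_mul, abs_two, abs_of_nonneg (pow_nonneg h0 _),
      abs_of_pos (by positivity : (0 : ℝ) < 2 * i + 1)]
    refine mul_le_mul_of_nonneg_left ((div_le_self (by positivity) ?_).trans ?_) zero_le_two
    · linarith [(Nat.cast_nonneg i : (0 : ℝ) ≤ i)]
    · exact mul_le_of_le_one_right (pow_nonneg h0 _) (abs_cos_le_one _)
  have key := intervalIntegral.hasSum_integral_of_dominated_convergence (μ := volume)
    (a := 0) (b := π / 2) (f := fun u => G u * abelLogCot ρ u)
    (F := fun (i : ℕ) u => G u * (2 * (ρ ^ (2 * i + 1) * cos ((2 * i + 1) * u) / (2 * i + 1))))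
    (fun (i : ℕ) u => |G u| * (2 * ρ ^ (2 * i + 1)))
    (fun i => by fun_prop)
    (fun i => ae_of_all _ fun u _ => by
      rw [norm_mul, norm_eq_abs, norm_eq_abs]
      exact mul_le_mul_of_nonneg_left (hterm i u) (abs_nonneg _))
    (ae_of_all _ fun u _ => hs.mul_left _)
    (by
      simp only [tsum_mul_left]
      exact (hG.abs.mul continuous_const).intervalIntegrable _ _)
    (ae_of_all _ fun u _ => (hasSum_abelLogCot h0 h1 u).mul_left _)
  rw [← key.tsum_eq, ← tsum_mul_left]
  refine tsum_congr fun i => ?_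
  rw [← mul_div_assoc, ← mul_div_assoc, ← intervalIntegral.integral_const_mul,
    ← intervalIntegral.integral_const_mul, ← intervalIntegral.integral_div]
  refine intervalIntegral.integral_congr fun u _ => ?_
  ring

/-- The integral of `G * logCot` as a series in the odd cosine coefficients of `G`. -/
lemma integral_mul_logCot {G : ℝ → ℝ} (hG : Continuous G) {C : ℝ}
    (hC : ∀ i : ℕ, |∫ u in 0..(π / 2), G u * cos ((2 * i + 1) * u)| ≤ C / (2 * i + 1)) :
    ∫ u in 0..(π / 2), G u * logCot u =
      2 * ∑' i : ℕ, (∫ u in 0..(π / 2), G u * cos ((2 * i + 1) * u)) / (2 * i + 1) := by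
  have hev : ∀ᶠ ρ : ℝ in nhdsWithin 1 (Iio 1), 0 ≤ ρ ∧ ρ < 1 := by
    filter_upwards [Ioo_mem_nhdsLT (zero_lt_one' ℝ)] with ρ hρ
    exact ⟨hρ.1.le, hρ.2⟩
  have hid : Tendsto (fun ρ : ℝ => ρ) (nhdsWithin 1 (Iio 1)) (nhds 1) :=
    tendsto_id.mono_left nhdsWithin_le_nhds
  have hl : Tendsto (fun ρ => ∫ u in 0..(π / 2), G u * abelLogCot ρ u) (nhdsWithin 1 (Iio 1))
      (nhds (∫ u in 0..(π / 2), G u * logCot u)) := by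
    refine intervalIntegral.tendsto_integral_filter_of_dominated_convergence
      (fun u => |G u| * logCot u) (Eventually.of_forall fun ρ => ?_) ?_ ?_ ?_
    · have : Measurable (abelLogCot ρ) := by
        unfold abelLogCot
        fun_prop
      exact hG.aestronglyMeasurable.mul this.aestronglyMeasurable
    · filter_upwards [hev] with ρ hρ
      refine ae_of_all _ fun u hu => ?_
      rw [uIoc_of_le (by positivity)] at hu
      rw [norm_mul, norm_eq_abs, norm_eq_abs]
      exact mul_le_mul_of_nonneg_left (abs_abelLogCot_le hρ.1 hu.1 hu.2) (abs_nonneg _)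
    · exact (intervalIntegrable_logCot _ _).continuousOn_mul hG.abs.continuousOn
    · refine ae_of_all _ fun u hu => ?_
      rw [uIoc_of_le (by positivity)] at hu
      rw [← abelLogCot_one]
      refine Tendsto.const_mul _ ?_
      have hc0 : 0 ≤ cos u := cos_nonneg_of_mem_Icc ⟨by linarith [hu.1, pi_pos], hu.2⟩
      have hc1 : cos u < 1 := by
        rw [← cos_zero]
        exact cos_lt_cos_of_nonneg_of_le_pi_div_two le_rfl hu.2 hu.1
      have hc : ContinuousAt (fun ρ => abelLogCot ρ u) 1 := by
        unfold abelLogCot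
        have hd : (1 : ℝ) + 1 ^ 2 - 2 * 1 * cos u ≠ 0 := by linarith
        have hn : ContinuousAt (fun ρ : ℝ => 1 + ρ ^ 2 + 2 * ρ * cos u) 1 := by fun_prop
        have hm : ContinuousAt (fun ρ : ℝ => 1 + ρ ^ 2 - 2 * ρ * cos u) 1 := by fun_prop
        exact ((hn.div hm hd).log (div_ne_zero (by linarith) hd)).div_const 2
      exact hc.tendsto.mono_left nhdsWithin_le_nhds
  have hsum : Summable fun i : ℕ => C / (2 * (i : ℝ) + 1) ^ 2 := by
    have := (summable_nat_add_iff 1).2 (Real.summable_one_div_nat_pow.2 one_lt_two)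
    refine (this.mul_left |C|).of_norm_bounded fun i => ?_
    rw [norm_div, norm_pow, norm_eq_abs, norm_eq_abs, mul_one_div,
      abs_of_pos (by positivity : (0 : ℝ) < 2 * i + 1)]
    push_cast
    gcongr
    linarith [(Nat.cast_nonneg i : (0 : ℝ) ≤ i)]
  have hr := (tendsto_tsum_of_dominated_convergence (𝓕 := nhdsWithin (1 : ℝ) (Iio 1))
    (f := fun (ρ : ℝ) (i : ℕ) => ρ ^ (2 * i + 1) *
        ((∫ u in 0..(π / 2), G u * cos ((2 * i + 1) * u)) / (2 * i + 1)))
    (g := fun (i : ℕ) => (∫ u in 0..(π / 2), G u * cos ((2 * i + 1) * u)) / (2 * i + 1)) hsum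
    (fun i => by
      have := (hid.pow (2 * i + 1)).mul_const
        ((∫ u in 0..(π / 2), G u * cos ((2 * (i : ℝ) + 1) * u)) / (2 * (i : ℝ) + 1))
      rwa [one_pow, one_mul] at this)
    (by
      filter_upwards [hev] with ρ hρ
      intro i
      have hi : (0 : ℝ) < 2 * i + 1 := by positivity
      rw [norm_mul, norm_div, norm_pow, norm_eq_abs, norm_eq_abs, norm_eq_abs, abs_of_pos hi,
        abs_of_nonneg hρ.1, sq, ← div_div]
      refine (mul_le_of_le_one_left (by positivity) (pow_le_one₀ hρ.1 hρ.2.le)).trans ?_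
      exact div_le_div_of_nonneg_right (hC i) hi.le)).const_mul 2
  refine tendsto_nhds_unique (hl.congr' ?_) hr
  filter_upwards [hev] with ρ hρ
  exact integral_mul_abelLogCot hG hρ.1 hρ.2

section coefficients

variable {F : ℝ → ℝ}

lemma IsProfile.iterate_lift (hF : IsProfile F) (j : ℕ) : IsProfile (lift₂^[j] F) := by
  induction j with
  | zero => exact hF
  | succ j ih =>
    rw [Function.iterate_succ_apply']
    exact ih.lift

lemma cos_odd_mul_pi_div_two_sub (i : ℕ) (v : ℝ) :
    cos ((2 * i + 1) * (π / 2 - v)) = (-1) ^ i * sin ((2 * i + 1) * v) := by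
  have : (2 * (i : ℝ) + 1) * (π / 2 - v) = (π / 2 - (2 * i + 1) * v) + i * π := by ring
  rw [this, cos_add_nat_mul_pi, cos_pi_div_two_sub]

lemma integral_slope_mul_cos (hF : IsProfile F) {m : ℝ} (hm : m ≠ 0) :
    ∫ u in 0..(π / 2), slope₂ F u * cos (m * u) = (∫ u in 0..(π / 2), F u * sin (m * u)) / m := by
  have hv : ∀ u, HasDerivAt (fun u => sin (m * u) / m) (cos (m * u)) u := fun u => by
    have h : HasDerivAt (fun u => m * u) m u := by simpa using (hasDerivAt_id u).const_mul m
    exact (h.sin.div_const m).congr_deriv (by field_simp)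
  rw [intervalIntegral.integral_mul_deriv_eq_deriv_mul (fun u _ => hF.hasDerivAt_slope u)
    (fun u _ => hv u) (hF.cont.neg.intervalIntegrable _ _)
    (Continuous.intervalIntegrable (by fun_prop) _ _), ← intervalIntegral.integral_div]
  have : slope₂ F (π / 2) = 0 := intervalIntegral.integral_same
  simp only [this, mul_zero, sin_zero, zero_div, zero_mul, sub_zero, zero_sub, neg_mul,
    intervalIntegral.integral_neg, neg_neg, mul_div_assoc]

lemma integral_lift_mul_sin (hF : IsProfile F) (i : ℕ) :
    ∫ u in 0..(π / 2), lift₂ F u * sin ((2 * i + 1) * u) =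
      (∫ u in 0..(π / 2), F u * sin ((2 * i + 1) * u)) / (2 * i + 1) ^ 2 := by
  have hm : (2 * (i : ℝ) + 1) ≠ 0 := by positivity
  set m := 2 * (i : ℝ) + 1 with hmdef
  have hv : ∀ u, HasDerivAt (fun u => -cos (m * u) / m) (sin (m * u)) u := fun u => by
    have h : HasDerivAt (fun u => m * u) m u := by simpa using (hasDerivAt_id u).const_mul m
    exact (h.cos.neg.div_const m).congr_deriv (by field_simp)
  have hcos : cos (m * (π / 2)) = 0 := by
    have := cos_odd_mul_pi_div_two_sub i 0
    simpa using this
  rw [intervalIntegral.integral_mul_deriv_eq_deriv_mul (fun u _ => hF.hasDerivAt_lift u)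
    (fun u _ => hv u) (hF.continuous_slope.intervalIntegrable _ _)
    (Continuous.intervalIntegrable (by fun_prop) _ _), hcos, hF.lift.zero]
  rw [sq, ← div_div, ← integral_slope_mul_cos hF hm, ← intervalIntegral.integral_div]
  simp only [neg_zero, zero_div, mul_zero, zero_mul, sub_zero, zero_sub, neg_div, mul_neg,
    intervalIntegral.integral_neg, neg_neg, mul_div_assoc]

lemma integral_iterate_lift_mul_sin (hF : IsProfile F) (i j : ℕ) :
    ∫ u in 0..(π / 2), lift₂^[j] F u * sin ((2 * i + 1) * u) =
      (∫ u in 0..(π / 2), F u * sin ((2 * i + 1) * u)) / (2 * i + 1) ^ (2 * j) := by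
  induction j with
  | zero => simp
  | succ j ih =>
    rw [Function.iterate_succ_apply', integral_lift_mul_sin (hF.iterate_lift j), ih, div_div,
      ← pow_add]
    ring_nf

lemma integral_pi_div_two_sub_mul_cos (F : ℝ → ℝ) (i : ℕ) :
    ∫ u in 0..(π / 2), F (π / 2 - u) * cos ((2 * i + 1) * u) =
      (-1) ^ i * ∫ u in 0..(π / 2), F u * sin ((2 * i + 1) * u) := by
  have := intervalIntegral.integral_comp_sub_left
    (fun v => F v * cos ((2 * i + 1) * (π / 2 - v))) (π / 2) (a := 0) (b := π / 2)
  simp only [sub_sub_cancel, sub_self, sub_zero] at this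
  rw [this, ← intervalIntegral.integral_const_mul]
  refine intervalIntegral.integral_congr fun v _ => ?_
  simp only [cos_odd_mul_pi_div_two_sub]
  ring

lemma abs_integral_mul_sin_le (hF : IsProfile F) (m : ℝ) :
    |∫ u in 0..(π / 2), F u * sin (m * u)| ≤ F (π / 2) * (π / 2) := by
  have := intervalIntegral.norm_integral_le_of_norm_le_const (a := 0) (b := π / 2)
    (f := fun u => F u * sin (m * u)) (C := F (π / 2)) fun u hu => by
      rw [uIoc_of_le (by positivity)] at hu
      have h0 := hF.nonneg hu.1.le (by linarith [hu.2, pi_pos])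
      rw [norm_mul, norm_eq_abs, norm_eq_abs, abs_of_nonneg h0]
      exact (mul_le_of_le_one_right h0 (abs_sin_le_one _)).trans
        (hF.mono ⟨hu.1.le, hu.2⟩ ⟨by positivity, le_rfl⟩ hu.2)
  rwa [sub_zero, abs_of_pos (by positivity), norm_eq_abs] at this

lemma integral_slope_mul_logCot (hF : IsProfile F) (j : ℕ) :
    ∫ u in 0..(π / 2), slope₂ (lift₂^[j] F) u * logCot u =
      2 * ∑' i : ℕ, (∫ u in 0..(π / 2), F u * sin ((2 * i + 1) * u)) /
        (2 * i + 1) ^ (2 * j + 2) := by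
  have hj := hF.iterate_lift j
  have hm : ∀ i : ℕ, (2 * (i : ℝ) + 1) ≠ 0 := fun i => by positivity
  rw [integral_mul_logCot hj.continuous_slope (C := lift₂^[j] F (π / 2) * (π / 2)) fun i => ?_]
  · refine congrArg _ (tsum_congr fun i => ?_)
    rw [integral_slope_mul_cos hj (hm i), integral_iterate_lift_mul_sin hF, div_div, div_div,
      pow_add, sq]
  · rw [integral_slope_mul_cos hj (hm i), abs_div, abs_of_pos (by positivity : (0:ℝ) < 2 * i + 1)]
    exact div_le_div_of_nonneg_right (abs_integral_mul_sin_le hj _) (by positivity)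

lemma integral_lift_mul_logCot (hF : IsProfile F) (j : ℕ) :
    ∫ u in 0..(π / 2), lift₂^[j + 1] F (π / 2 - u) * logCot u =
      2 * ∑' i : ℕ, (-1) ^ i * (∫ u in 0..(π / 2), F u * sin ((2 * i + 1) * u)) /
        (2 * i + 1) ^ (2 * j + 3) := by
  have hj := hF.iterate_lift j
  have hG : Continuous fun u => lift₂^[j + 1] F (π / 2 - u) :=
    (hF.iterate_lift (j + 1)).cont.comp (continuous_const.sub continuous_id)
  rw [integral_mul_logCot hG (C := lift₂^[j] F (π / 2) * (π / 2)) fun i => ?_]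
  · refine congrArg _ (tsum_congr fun i => ?_)
    rw [integral_pi_div_two_sub_mul_cos (lift₂^[j + 1] F), integral_iterate_lift_mul_sin hF,
      mul_div_assoc, div_div, ← pow_succ, mul_div_assoc]
    rfl
  · have hm : (1 : ℝ) ≤ 2 * i + 1 := by linarith [(Nat.cast_nonneg i : (0 : ℝ) ≤ i)]
    rw [integral_pi_div_two_sub_mul_cos (lift₂^[j + 1] F), Function.iterate_succ_apply',
      integral_lift_mul_sin hj, abs_mul, abs_pow, abs_neg, abs_one, one_pow, one_mul, abs_div,
      abs_of_pos (by positivity : (0 : ℝ) < (2 * i + 1) ^ 2)]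
    have hb := abs_integral_mul_sin_le hj (2 * i + 1)
    exact (div_le_div_of_nonneg_left (abs_nonneg _) (by linarith) (by nlinarith)).trans
      (div_le_div_of_nonneg_right hb (by linarith))

end coefficients

lemma logCot_neg (u : ℝ) : logCot (-u) = logCot u := by
  have : logSin (-u + π) = logSin (u + π) := by
    rw [← logSin_neg, ← logSin_periodic]
    ring_nf
  rw [logCot, logCot, this, logSin_neg]

lemma logCot_pi_sub (u : ℝ) : logCot (π - u) = -logCot u := by
  have h1 : logSin (π - u + π) = logSin u := by
    rw [← logSin_neg, ← logSin_periodic]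
    ring_nf
  have h2 : logSin (π - u) = logSin (u + π) := by
    rw [← logSin_neg, ← logSin_periodic]
    ring_nf
  rw [logCot, logCot, h1, h2, neg_sub]

lemma conjLog_pi_sub_zero {G : ℝ → ℝ} (hG : Continuous G) (he : ∀ u, G (-u) = G u)
    (hs : ∀ u, G (π - u) = -G u) :
    conjLog G π - conjLog G 0 = 4 / π * ∫ u in 0..(π / 2), G u * logCot u := by
  have hq : ∀ a b, IntervalIntegrable (fun u => G u * logCot u) volume a b := fun a b =>
    (intervalIntegrable_logCot a b).continuousOn_mul hG.continuousOn
  have h1 : conjLog G π - conjLog G 0 = 1 / π * ∫ u in 0..(2 * π), G u * logCot u := by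
    have hs1 := intervalIntegrable_mul_logSin_sub hG 0 (2 * π) π
    have hs0 := intervalIntegrable_mul_logSin_sub hG 0 (2 * π) 0
    rw [conjLog, conjLog, ← mul_sub, ← intervalIntegral.integral_sub hs1 hs0]
    congr 1
    refine intervalIntegral.integral_congr fun u _ => ?_
    have : logSin (u - π) = logSin (u + π) := by
      rw [← logSin_periodic]
      ring_nf
    simp only [logCot, this, sub_zero]
    ring
  have hpi : ∀ u, G (u + π) * logCot (u + π) = G u * logCot u := fun u => by
    have e : u + π = π - -u := by ring
    rw [e, hs, logCot_pi_sub, he, logCot_neg, neg_mul_neg]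
  have h2 : ∫ u in π..(2 * π), G u * logCot u = ∫ u in 0..π, G u * logCot u := by
    have := intervalIntegral.integral_comp_add_right (fun u => G u * logCot u) π (a := 0) (b := π)
    rw [zero_add, ← two_mul] at this
    rw [← this]
    exact intervalIntegral.integral_congr fun u _ => hpi u
  have h3 : ∫ u in (π / 2)..π, G u * logCot u = ∫ u in 0..(π / 2), G u * logCot u := by
    have := intervalIntegral.integral_comp_sub_left (fun u => G u * logCot u) π
      (a := 0) (b := π / 2)
    rw [sub_zero, sub_half] at this
    rw [← this]
    refine intervalIntegral.integral_congr fun u _ => ?_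
    simp only [hs, logCot_pi_sub, neg_mul_neg]
  rw [h1, ← intervalIntegral.integral_add_adjacent_intervals (hq 0 π) (hq π _), h2,
    ← intervalIntegral.integral_add_adjacent_intervals (hq 0 (π / 2)) (hq (π / 2) π), h3]
  ring

lemma conjLog_two_pi (h : ℝ → ℝ) : conjLog h (2 * π) = conjLog h 0 := by
  simp only [conjLog, sub_zero, logSin_periodic.sub_eq]

lemma le_eVariationOn_conjLog {G : ℝ → ℝ} (hG : Continuous G) (he : ∀ u, G (-u) = G u)
    (hs : ∀ u, G (π - u) = -G u) :
    ENNReal.ofReal (8 / π * ∫ u in 0..(π / 2), G u * logCot u) ≤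
      eVariationOn (conjLog G) (Icc 0 (2 * π)) := by
  have hd := conjLog_pi_sub_zero hG he hs
  have hπ := pi_pos
  have hv := eVariationOn.Icc_add_Icc (conjLog G) hπ.le (by linarith : π ≤ 2 * π) (mem_univ _)
  rw [univ_inter, univ_inter, univ_inter] at hv
  have h1 := eVariationOn.edist_le (conjLog G) (right_mem_Icc.2 hπ.le) (left_mem_Icc.2 hπ.le)
  have h2 := eVariationOn.edist_le (conjLog G) (s := Icc π (2 * π)) (left_mem_Icc.2 (by linarith))
    (right_mem_Icc.2 (by linarith))
  rw [conjLog_two_pi] at h2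
  have h3 : ENNReal.ofReal (conjLog G π - conjLog G 0) ≤ edist (conjLog G π) (conjLog G 0) := by
    rw [edist_dist, Real.dist_eq]
    exact ENNReal.ofReal_le_ofReal (le_abs_self _)
  rw [← hv]
  refine le_trans ?_ (add_le_add (h3.trans h1) (h3.trans h2))
  refine le_of_eq_of_le ?_ ENNReal.ofReal_add_le
  rw [hd]
  ring_nf

lemma hasDerivAt_iteratedDeriv {f : ℝ → ℝ} {r k : ℕ} (hf : ContDiff ℝ r f) (hk : k < r) (x : ℝ) :
    HasDerivAt (iteratedDeriv k f) (iteratedDeriv (k + 1) f x) x := by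
  rw [iteratedDeriv_succ]
  exact (hf.differentiable_iteratedDeriv k (by exact_mod_cast hk) x).hasDerivAt

lemma periodic_iteratedDeriv {f : ℝ → ℝ} {c : ℝ} (hf : Function.Periodic f c) (k : ℕ) :
    Function.Periodic (iteratedDeriv k f) c := fun x => by
  have := iteratedDeriv_comp_add_const k f c
  rw [show (fun z => f (z + c)) = f from funext hf] at this
  exact (congrFun this x).symm

lemma MemWrH.hasModulus {ω f : ℝ → ℝ} {r : ℕ} (hω : IsConcaveModulus ω) (hf : MemWrH r ω f)
    (j k : ℕ) (hjk : k + 2 * j = r) :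
    HasModulus (lift₂^[j] (baseProfile ω)) (iteratedDeriv k f) := by
  induction j generalizing k with
  | zero =>
    obtain rfl : k = r := by omega
    exact hasModulus_base hω (periodic_iteratedDeriv hf.1 k) hf.2.2
  | succ j ih =>
    rw [Function.iterate_succ_apply']
    exact HasModulus.lift ((isProfile_base hω).iterate_lift j)
      (hasDerivAt_iteratedDeriv hf.2.1 (by omega)) (hasDerivAt_iteratedDeriv hf.2.1 (by omega))
      (ih (k + 2) (by omega)) (periodic_iteratedDeriv hf.1 k)

lemma MemWrH.of_hasDerivAt {ω f h : ℝ → ℝ} {r : ℕ} (hh : MemWrH r ω h)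
    (hp : Function.Periodic f (2 * π)) (hd : ∀ x, HasDerivAt f (h x) x) : MemWrH (r + 1) ω f := by
  have e : deriv f = h := funext fun x => (hd x).deriv
  refine ⟨hp, ?_, ?_⟩
  · push_cast
    exact contDiff_succ_iff_deriv.2 ⟨fun x => (hd x).differentiableAt, by simp, e ▸ hh.2.1⟩
  · rw [iteratedDeriv_succ', e]
    exact hh.2.2

lemma MemWrH.neg {ω f : ℝ → ℝ} {r : ℕ} (hf : MemWrH r ω f) : MemWrH r ω (fun x => -f x) := by
  refine ⟨fun x => congrArg _ (hf.1 x), hf.2.1.neg, fun x y => ?_⟩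
  rw [iteratedDeriv_fun_neg, iteratedDeriv_fun_neg, neg_sub_neg, abs_sub_comm]
  exact hf.2.2 x y

section extremal

variable {F ω : ℝ → ℝ} {r : ℕ}

lemma IsProfile.slope_periodic (hF : IsProfile F) : Function.Periodic (slope₂ F) (2 * π) := by
  have h : ∀ u, slope₂ F (u + π) = -slope₂ F u := fun u => by
    rw [← hF.slope_neg u, ← hF.slope_pi_sub]
    ring_nf
  intro u
  rw [two_mul, ← add_assoc, h, h, neg_neg]

lemma memWrH_slope (hF : IsProfile F) (hm : ∀ c, MemWrH r ω fun x => F (x + c)) (c : ℝ) :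
    MemWrH (r + 1) ω fun x => slope₂ F (x + c) :=
  (hm c).neg.of_hasDerivAt (hF.slope_periodic.add_const c)
    fun x => (hF.hasDerivAt_slope (x + c)).comp_add_const x c

lemma memWrH_lift (hF : IsProfile F) (hm : ∀ c, MemWrH r ω fun x => F (x + c)) (c : ℝ) :
    MemWrH (r + 2) ω fun x => lift₂ F (x + c) :=
  (memWrH_slope hF hm c).of_hasDerivAt (hF.lift.periodic.add_const c)
    fun x => (hF.hasDerivAt_lift (x + c)).comp_add_const x c

lemma memWrH_iterate_lift (hω : IsConcaveModulus ω) (j : ℕ) (c : ℝ) :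
    MemWrH (2 * j) ω fun x => lift₂^[j] (baseProfile ω) (x + c) := by
  have hF := isProfile_base hω
  induction j generalizing c with
  | zero =>
    refine ⟨hF.periodic.add_const c, ?_, fun x y => ?_⟩
    · exact contDiff_zero.2 (hF.cont.comp (continuous_id.add continuous_const))
    · simpa using abs_baseProfile_sub_le hω (x + c) (y + c)
  | succ j ih =>
    rw [Function.iterate_succ_apply']
    exact memWrH_lift (hF.iterate_lift j) ih c

end extremal

lemma sSup_eVariationOn_conj {ω G f₀ : ℝ → ℝ} {r : ℕ} (hr : 1 ≤ r) (hG : Continuous G)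
    (he : ∀ u, G (-u) = G u) (hs : ∀ u, G (π - u) = -G u)
    (hG0 : ∀ u, 0 ≤ u → u ≤ π / 2 → 0 ≤ G u)
    (hN : ∀ f, MemWrH r ω f → ∀ s, 0 < s → s < π →
      volume {l | distr (iteratedDeriv 1 f) l ∈ Ioo s (2 * π - s)} ≤ ENNReal.ofReal (2 * G (s / 2)))
    (hf₀ : MemWrH r ω f₀) (hd : ∀ x, HasDerivAt f₀ (G x) x) :
    sSup {y : ENNReal | ∃ f g : ℝ → ℝ, MemWrH r ω f ∧ ConjFn f g ∧
        y = eVariationOn g (Icc 0 (2 * π))} =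
      ENNReal.ofReal (8 / π * ∫ u in 0..(π / 2), G u * logCot u) := by
  have hconj : ∀ f g, MemWrH r ω f → (ConjFn f g ↔ g = conjLog (iteratedDeriv 1 f)) :=
    fun f g hf => conjFn_iff (hasDerivAt_iteratedDeriv hf.2.1 hr)
      (hf.2.1.continuous_iteratedDeriv 1 (by exact_mod_cast hr)) (periodic_iteratedDeriv hf.1 1) g
  refine le_antisymm (sSup_le ?_) ?_
  · rintro _ ⟨f, g, hf, hg, rfl⟩
    rw [(hconj f g hf).1 hg]
    exact eVariationOn_conjLog_le (hf.2.1.continuous_iteratedDeriv 1 (by exact_mod_cast hr))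
      (periodic_iteratedDeriv hf.1 1) hG hG0 (hN f hf)
  · have e : iteratedDeriv 1 f₀ = G := by
      rw [iteratedDeriv_one]
      exact funext fun x => (hd x).deriv
    refine (le_eVariationOn_conjLog hG he hs).trans (le_sSup ⟨f₀, conjLog G, hf₀, ?_, rfl⟩)
    exact (hconj _ _ hf₀).2 (by rw [e])

lemma integral_baseProfile_mul_sin {ω : ℝ → ℝ} (hω : IsConcaveModulus ω) (m : ℝ) :
    ∫ u in 0..(π / 2), baseProfile ω u * sin (m * u) =
      (∫ t in 0..(π / 2), ω (2 * t) * sin (m * t)) / 2 := by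
  rw [← intervalIntegral.integral_div]
  refine intervalIntegral.integral_congr fun u hu => ?_
  rw [uIcc_of_le (by positivity)] at hu
  simp only [baseProfile_eq hω hu.1 hu.2]
  ring

/-- sharp estimate for the total variation over the conjugate class. -/
theorem conj_variation_sup (ω : ℝ → ℝ) (hω : IsConcaveModulus ω) (r : ℕ) (hr : 2 ≤ r) :
    sSup {y : ENNReal | ∃ f g : ℝ → ℝ, MemWrH r ω f ∧ ConjFn f g ∧
        y = eVariationOn g (Icc 0 (2 * π))} =
      ENNReal.ofReal (4 * ∑' i : ℕ, (-1 : ℝ) ^ (i * r) *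
        ((2 / π) * ∫ t in (0:ℝ)..(π / 2), ω (2 * t) * Real.sin ((2 * i + 1) * t)) /
          (2 * (i : ℝ) + 1) ^ r) := by
  have hF := isProfile_base hω
  have hπ := pi_ne_zero
  obtain ⟨j, rfl | rfl⟩ : ∃ j, r = 2 * j + 2 ∨ r = 2 * j + 3 := ⟨(r - 2) / 2, by omega⟩
  · have hj := hF.iterate_lift j
    rw [sSup_eVariationOn_conj (G := slope₂ (lift₂^[j] (baseProfile ω))) (by omega)
      hj.continuous_slope hj.slope_neg hj.slope_pi_sub (fun u => hj.slope_nonneg)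
      (fun f hf s => volume_distr_Ioo_le_slope hj (hasDerivAt_iteratedDeriv hf.2.1 (by omega))
        (hf.hasModulus hω j 2 (by omega)) (periodic_iteratedDeriv hf.1 1))
      (by simpa using memWrH_lift hj (memWrH_iterate_lift hω j) 0) hj.hasDerivAt_lift,
      integral_slope_mul_logCot hF, ← tsum_mul_left, ← tsum_mul_left, ← tsum_mul_left]
    congr 1
    refine tsum_congr fun i => ?_
    rw [integral_baseProfile_mul_sin hω, show i * (2 * j + 2) = 2 * (i * (j + 1)) by ring, pow_mul,
      neg_one_sq, one_pow]
    generalize ∫ t in 0..(π / 2), ω (2 * t) * sin ((2 * (i : ℝ) + 1) * t) = S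
    field_simp
    ring
  · have hj := hF.iterate_lift (j + 1)
    have hd : ∀ x, HasDerivAt (fun x => slope₂ (lift₂^[j + 1] (baseProfile ω)) (x + -(π / 2)))
        (lift₂^[j + 1] (baseProfile ω) (π / 2 - x)) x := fun x =>
      ((hj.hasDerivAt_slope (x + -(π / 2))).comp_add_const x _).congr_deriv (by
        rw [← hj.odd]
        ring_nf)
    rw [sSup_eVariationOn_conj (G := fun u => lift₂^[j + 1] (baseProfile ω) (π / 2 - u)) (r := 2 * j + 3)
      (by omega)
      (hj.cont.comp (continuous_const.sub continuous_id))
      (fun u => by rw [← hj.symm]; ring_nf) (fun u => by rw [← hj.odd]; ring_nf)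
      (fun u h0 h1 => hj.nonneg (by linarith) (by linarith [pi_pos]))
      (fun f hf s h0 h1 => by
        have := volume_distr_Ioo_le_profile hj
          (hf.2.1.continuous_iteratedDeriv 1 (by exact_mod_cast (by omega : 1 ≤ 2 * j + 3)))
          (hf.hasModulus hω (j + 1) 1 (by omega)) (periodic_iteratedDeriv hf.1 1) h0 h1
        rwa [sub_div] at this)
      (memWrH_slope hj (memWrH_iterate_lift hω (j + 1)) _) hd,
      integral_lift_mul_logCot hF, ← tsum_mul_left, ← tsum_mul_left, ← tsum_mul_left]
    congr 1
    refine tsum_congr fun i => ?_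
    rw [integral_baseProfile_mul_sin hω, show i * (2 * j + 3) = 2 * (i * (j + 1)) + i by ring,
      pow_add (-1 : ℝ), pow_mul (-1 : ℝ), neg_one_sq, one_pow, one_mul]
    generalize ∫ t in 0..(π / 2), ω (2 * t) * sin ((2 * (i : ℝ) + 1) * t) = S
    field_simp
    ring
end
end

section
/- For every f ∈ H_ω with ω concave and Dini (∫₀^ε ω(t)/t dt < ∞), and every x, the conjugate satisfies the bound |f̃(x)| ≤ (1/π) ∫₀^{π} ω(2 sin(t/2) · c) /t · C dt–type estimate; concretely, |f̃(x) − f̃(y)| ≤ C [∫₀^{|x−y|} ω(t)/t dt + |x−y| ∫_{|x−y|}^{π} ω(t)/t² dt] for an absolute constant C, so f̃ is uniformly continuous (Zygmund-type estimate). -/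
open MeasureTheory Real Filter Set

noncomputable section

/-- The conjugate kernel `cot (s / 2) / 2`. -/
def cotKernel (s : ℝ) : ℝ := cos (s / 2) / (2 * sin (s / 2))

lemma div_two_mul_tan_half (a u : ℝ) : a / (2 * tan (u / 2)) = a * cotKernel u := by
  rw [cotKernel, tan_eq_sin_div_cos, ← mul_div_assoc, div_div_eq_mul_div, mul_div_assoc]

lemma cotKernel_neg (s : ℝ) : cotKernel (-s) = -cotKernel s := by
  simp only [cotKernel, neg_div, cos_neg, sin_neg, mul_neg, div_neg]

lemma cotKernel_pi : cotKernel π = 0 := by simp [cotKernel]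

lemma div_pi_le_sin_half {s : ℝ} (h0 : 0 ≤ s) (h1 : s ≤ π) : s / π ≤ sin (s / 2) := by
  have h := mul_le_sin (x := s / 2) (by linarith) (by linarith)
  calc s / π = 2 / π * (s / 2) := by ring
    _ ≤ _ := h

lemma sin_half_pos {s : ℝ} (h0 : 0 < s) (h1 : s ≤ π) : 0 < sin (s / 2) :=
  (div_pos h0 pi_pos).trans_le (div_pi_le_sin_half h0.le h1)

lemma abs_cotKernel_le {s : ℝ} (h0 : 0 < s) (h1 : s ≤ π) : |cotKernel s| ≤ π / 2 / s := by
  have hs := sin_half_pos h0 h1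
  have hb := div_pi_le_sin_half h0.le h1
  have hc := abs_cos_le_one (s / 2)
  rw [cotKernel, abs_div, abs_of_pos (by positivity : 0 < 2 * sin (s / 2)),
    div_le_div_iff₀ (by positivity) h0]
  rw [div_le_iff₀ pi_pos] at hb
  nlinarith

lemma hasDerivAt_cotKernel {s : ℝ} (h0 : 0 < s) (h1 : s ≤ π) :
    HasDerivAt cotKernel (-(1 / (4 * sin (s / 2) ^ 2))) s := by
  have hs := (sin_half_pos h0 h1).ne'
  have hd : HasDerivAt (fun s : ℝ => s / 2) (1 / 2) s := (hasDerivAt_id s).div_const 2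
  have h := hd.cos.div (hd.sin.const_mul 2) (by positivity)
  refine h.congr_deriv ?_
  field_simp
  linear_combination (-4) * sin_sq_add_cos_sq (s / 2)

lemma continuousOn_cotKernel : ContinuousOn cotKernel (Ioc 0 π) := fun _ hs =>
  (hasDerivAt_cotKernel hs.1 hs.2).continuousAt.continuousWithinAt

lemma abs_deriv_cotKernel_le {s : ℝ} (h0 : 0 < s) (h1 : s ≤ π) :
    |-(1 / (4 * sin (s / 2) ^ 2))| ≤ π ^ 2 / 4 / s ^ 2 := by
  have hs := sin_half_pos h0 h1
  have hb := div_pi_le_sin_half h0.le h1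
  rw [abs_neg, abs_of_pos (by positivity), div_le_div_iff₀ (by positivity) (by positivity)]
  rw [div_le_iff₀ pi_pos] at hb
  have := pow_le_pow_left₀ h0.le hb 2
  nlinarith

/-- The truncated principal value integral, folded onto `[δ, π]`. -/
lemma setIntegral_truncated_eq {f : ℝ → ℝ} (hf : Continuous f) (x : ℝ) {δ : ℝ} (h0 : 0 < δ)
    (h1 : δ ≤ π) :
    ∫ t in {t : ℝ | δ ≤ |t - x| ∧ |t - x| ≤ π}, f t / (2 * tan ((t - x) / 2)) =
      ∫ s in δ..π, (f (x + s) - f (x - s)) * cotKernel s := by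
  have hK : ContinuousOn cotKernel (Icc δ π) :=
    continuousOn_cotKernel.mono fun s hs => ⟨h0.trans_le hs.1, hs.2⟩
  have hset : {t : ℝ | δ ≤ |t - x| ∧ |t - x| ≤ π} = Icc (x - π) (x - δ) ∪ Icc (x + δ) (x + π) := by
    ext t
    simp only [mem_ofPred_eq, mem_union, mem_Icc, le_abs, abs_le]
    constructor
    · rintro ⟨h | h, h2, h3⟩
      · right; constructor <;> linarith
      · left; constructor <;> linarith
    · rintro (⟨h2, h3⟩ | ⟨h2, h3⟩)
      · exact ⟨Or.inr (by linarith), by linarith, by linarith⟩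
      · exact ⟨Or.inl (by linarith), by linarith, by linarith⟩
  have hR : ContinuousOn (fun t => f t * cotKernel (t - x)) (Icc (x + δ) (x + π)) :=
    hf.continuousOn.mul (hK.comp (by fun_prop) fun t ht =>
      ⟨by linarith [ht.1], by linarith [ht.2]⟩)
  have hL : ContinuousOn (fun t => f t * cotKernel (t - x)) (Icc (x - π) (x - δ)) := by
    have : ContinuousOn (fun t => f t * -cotKernel (x - t)) (Icc (x - π) (x - δ)) :=
      hf.continuousOn.mul (hK.comp (by fun_prop) fun t ht =>
        ⟨by linarith [ht.2], by linarith [ht.1]⟩).neg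
    refine this.congr fun t _ => ?_
    simp only [← cotKernel_neg, neg_sub]
  have hdisj : Disjoint (Icc (x - π) (x - δ)) (Icc (x + δ) (x + π)) := by
    rw [Set.disjoint_left]
    intro t ht ht'
    linarith [ht.2, ht'.1]
  have hu : uIcc δ π = Icc δ π := uIcc_of_le h1
  have i1 : IntervalIntegrable (fun s => f (x + s) * cotKernel s) volume δ π :=
    ContinuousOn.intervalIntegrable
      ((hf.comp (continuous_const.add continuous_id)).continuousOn.mul (hu ▸ hK))
  have i2 : IntervalIntegrable (fun s => f (x - s) * cotKernel s) volume δ π :=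
    ContinuousOn.intervalIntegrable
      ((hf.comp (continuous_const.sub continuous_id)).continuousOn.mul (hu ▸ hK))
  simp only [div_two_mul_tan_half]
  rw [hset, setIntegral_union hdisj measurableSet_Icc (hL.integrableOn_Icc) (hR.integrableOn_Icc),
    integral_Icc_eq_integral_Ioc, integral_Icc_eq_integral_Ioc,
    ← intervalIntegral.integral_of_le (by linarith), ← intervalIntegral.integral_of_le (by linarith),
    ← intervalIntegral.integral_comp_sub_left, ← intervalIntegral.integral_comp_add_left]
  simp only [sub_mul]
  rw [intervalIntegral.integral_sub i1 i2]
  simp only [add_sub_cancel_left, sub_sub_cancel_left, cotKernel_neg, mul_neg,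
    intervalIntegral.integral_neg]
  ring

section Modulus

variable {ω f : ℝ → ℝ}

lemma IsConcaveModulus.nonneg (hω : IsConcaveModulus ω) {t : ℝ} (ht : 0 ≤ t) : 0 ≤ ω t :=
  hω.2.2.2.2.1 t ht

lemma IsConcaveModulus.apply_two_mul_le (hω : IsConcaveModulus ω) {t : ℝ} (ht : 0 ≤ t) :
    ω (2 * t) ≤ 2 * ω t := by
  have := hω.2.2.2.1 t t ht ht
  rw [two_mul, two_mul]
  exact this

lemma IsConcaveModulus.intervalIntegrable_div (hω : IsConcaveModulus ω) (hD : DiniCondition ω)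
    {b : ℝ} (hb : 0 ≤ b) : IntervalIntegrable (fun t => ω t / t) volume 0 b := by
  obtain ⟨ε, hε, hi⟩ := hD
  rw [intervalIntegrable_iff_integrableOn_Ioc_of_le hb]
  have h2 : IntegrableOn (fun t => ω t / t) (Icc ε b) :=
    (hω.1.continuousOn.div continuousOn_id fun t ht => (hε.trans_le ht.1).ne').integrableOn_Icc
  refine (hi.union h2).mono_set fun t ht => ?_
  rcases lt_or_ge t ε with h | h
  · exact Or.inl ⟨ht.1, h⟩
  · exact Or.inr ⟨h, ht.2⟩

lemma IsConcaveModulus.integral_div_mono (hω : IsConcaveModulus ω) (hD : DiniCondition ω)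
    {a b c : ℝ} (ha : 0 ≤ a) (hab : a ≤ b) (hbc : b ≤ c) :
    ∫ t in a..b, ω t / t ≤ ∫ t in (0 : ℝ)..c, ω t / t := by
  refine intervalIntegral.integral_mono_interval ha hab hbc ?_
    (hω.intervalIntegrable_div hD (ha.trans (hab.trans hbc)))
  filter_upwards [ae_restrict_mem measurableSet_Ioc] with t ht
  exact div_nonneg (hω.nonneg ht.1.le) ht.1.le

lemma IsConcaveModulus.le_integral_div (hω : IsConcaveModulus ω) (hD : DiniCondition ω)
    {h : ℝ} (hh : 0 < h) : ω h ≤ ∫ t in (0 : ℝ)..h, ω t / t := by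
  have hc : ∫ _ in (0 : ℝ)..h, ω h / h = ω h := by
    rw [intervalIntegral.integral_const, sub_zero, smul_eq_mul, mul_div_cancel₀ _ hh.ne']
  rw [← hc]
  refine intervalIntegral.integral_mono_on_of_le_Ioo hh.le intervalIntegrable_const
    (hω.intervalIntegrable_div hD hh.le) fun t ht => ?_
  have hconc := hω.2.2.2.2.2.2 (mem_Ici.2 hh.le) (mem_Ici.2 le_rfl) (div_nonneg ht.1.le hh.le)
    (sub_nonneg.2 ((div_le_one hh).2 ht.2.le)) (add_sub_cancel (t / h) 1)
  simp only [smul_eq_mul, mul_zero, add_zero, hω.2.2.1, div_mul_cancel₀ _ hh.ne'] at hconc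
  rw [div_le_div_iff₀ hh ht.1]
  rw [div_mul_eq_mul_div, div_le_iff₀ hh] at hconc
  linarith

lemma IsConcaveModulus.intervalIntegrable_div_sq (hω : IsConcaveModulus ω) {a b : ℝ}
    (ha : 0 < a) (hb : 0 < b) : IntervalIntegrable (fun t => ω t / t ^ 2) volume a b := by
  refine ContinuousOn.intervalIntegrable (hω.1.continuousOn.div (by fun_prop) fun t ht => ?_)
  have : 0 < t := (lt_min ha hb).trans_le ht.1
  positivity

lemma IsConcaveModulus.mul_integral_div_sq_le (hω : IsConcaveModulus ω) (hD : DiniCondition ω)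
    {h b : ℝ} (hh : 0 < h) (h1 : h ≤ 1) (hb : 1 ≤ b) :
    h * ∫ t in h..b, ω t / t ^ 2 ≤
      (∫ t in (0 : ℝ)..√h, ω t / t) + √h * ∫ t in (0 : ℝ)..b, ω t / t := by
  have hr : 0 < √h := sqrt_pos.2 hh
  have hsq : √h * √h = h := mul_self_sqrt hh.le
  have hr1 : √h ≤ 1 := sqrt_le_one.2 h1
  have hhr : h ≤ √h := by nlinarith
  have hrb : √h ≤ b := hr1.trans hb
  have hb0 : 0 < b := hr.trans_le hrb
  have ii : ∀ {u v : ℝ}, 0 < u → u ≤ v → IntervalIntegrable (fun t => ω t / t) volume u v :=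
    fun {u v} hu huv => (hω.intervalIntegrable_div hD (hu.le.trans huv)).mono_set
      (by rw [uIcc_of_le huv, uIcc_of_le (hu.le.trans huv)]; exact Icc_subset_Icc_left hu.le)
  rw [← intervalIntegral.integral_add_adjacent_intervals
    (hω.intervalIntegrable_div_sq hh hr) (hω.intervalIntegrable_div_sq hr hb0), mul_add]
  refine add_le_add ?_ ?_
  · refine le_trans ?_ (hω.integral_div_mono hD hh.le hhr le_rfl)
    rw [← intervalIntegral.integral_const_mul]
    refine intervalIntegral.integral_mono_on hhr
      ((hω.intervalIntegrable_div_sq hh hr).const_mul h) (ii hh hhr) fun t ht => ?_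
    have ht0 : 0 < t := hh.trans_le ht.1
    have hw := hω.nonneg ht0.le
    rw [← mul_div_assoc, div_le_div_iff₀ (by positivity) ht0]
    have := mul_le_mul_of_nonneg_right ht.1 (mul_nonneg hw ht0.le)
    nlinarith
  · refine le_trans ?_
      (mul_le_mul_of_nonneg_left (hω.integral_div_mono hD hr.le hrb le_rfl) hr.le)
    rw [← intervalIntegral.integral_const_mul, ← intervalIntegral.integral_const_mul]
    refine intervalIntegral.integral_mono_on hrb
      ((hω.intervalIntegrable_div_sq hr hb0).const_mul h) ((ii hr hrb).const_mul _) fun t ht => ?_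
    have ht0 : 0 < t := hr.trans_le ht.1
    have hw := hω.nonneg ht0.le
    rw [← mul_div_assoc, ← mul_div_assoc, div_le_div_iff₀ (by positivity) ht0]
    have := mul_le_mul_of_nonneg_right ht.1 (mul_nonneg hr.le (mul_nonneg hw ht0.le))
    linear_combination this - (ω t * t) * hsq

lemma MemH.continuous (hω : IsConcaveModulus ω) (hf : MemH ω f) : Continuous f := by
  refine continuous_iff_continuousAt.2 fun x => ?_
  rw [ContinuousAt, tendsto_iff_dist_tendsto_zero]
  have h0 : Tendsto (fun y => ω |y - x|) (nhds x) (nhds 0) := by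
    have : Continuous fun y => ω |y - x| := hω.1.comp (by fun_prop)
    simpa [hω.2.2.1] using this.tendsto x
  exact squeeze_zero (fun _ => dist_nonneg) (fun y => hf.2 y x) h0

lemma MemH.abs_sub_reflect_le (hω : IsConcaveModulus ω) (hf : MemH ω f) (x : ℝ) {s : ℝ}
    (hs : 0 ≤ s) : |f (x + s) - f (x - s)| ≤ 2 * ω s := by
  refine (hf.2 _ _).trans ?_
  rw [show x + s - (x - s) = 2 * s by ring, abs_of_nonneg (by linarith)]
  exact hω.apply_two_mul_le hs

lemma MemH.abs_integral_sub_le (hω : IsConcaveModulus ω) (hf : MemH ω f) (a b : ℝ) {h : ℝ}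
    (hh : 0 ≤ h) :
    |(∫ t in a..a + h, f t) - ∫ t in b..b + h, f t| ≤ h * ω |a - b| := by
  have hc := hf.continuous hω
  have shift : ∀ c, ∫ t in c..c + h, f t = ∫ t in (0 : ℝ)..h, f (c + t) := fun c => by
    rw [intervalIntegral.integral_comp_add_left, add_zero]
  rw [shift, shift, ← intervalIntegral.integral_sub
    (Continuous.intervalIntegrable (by fun_prop) _ _)
    (Continuous.intervalIntegrable (by fun_prop) _ _)]
  have := intervalIntegral.norm_integral_le_of_norm_le_const (a := 0) (b := h)
    (f := fun t => f (a + t) - f (b + t)) (C := ω |a - b|) fun t _ => by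
      simpa using hf.2 (a + t) (b + t)
  rw [norm_eq_abs, sub_zero, abs_of_nonneg hh] at this
  linarith

/-- The part of the singular integral near the singularity. -/
lemma MemH.abs_integral_near_le (hω : IsConcaveModulus ω) (hD : DiniCondition ω) (hf : MemH ω f)
    (x : ℝ) {δ h : ℝ} (hδ : 0 < δ) (hδh : δ ≤ h) (hh : h ≤ π) :
    |∫ s in δ..h, (f (x + s) - f (x - s)) * cotKernel s| ≤ π * ∫ t in (0 : ℝ)..h, ω t / t := by
  refine le_trans ?_
    (mul_le_mul_of_nonneg_left (hω.integral_div_mono hD hδ.le hδh le_rfl) pi_pos.le)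
  rw [← intervalIntegral.integral_const_mul, ← norm_eq_abs]
  refine intervalIntegral.norm_integral_le_of_norm_le hδh (ae_of_all _ fun s hs => ?_)
    (ContinuousOn.intervalIntegrable ?_)
  · have hs0 : 0 < s := hδ.trans hs.1
    rw [norm_eq_abs, abs_mul]
    calc _ ≤ (2 * ω s) * (π / 2 / s) :=
          mul_le_mul (hf.abs_sub_reflect_le hω x hs0.le) (abs_cotKernel_le hs0 (hs.2.trans hh))
            (abs_nonneg _) (mul_nonneg zero_le_two (hω.nonneg hs0.le))
      _ = π * (ω s / s) := by ring
  · refine continuousOn_const.mul (hω.1.continuousOn.div continuousOn_id fun t ht => ?_)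
    rw [uIcc_of_le hδh] at ht
    exact (hδ.trans_le ht.1).ne'

/-- The part of the singular integral away from the singularity, integrated by parts against the
increments over intervals of length `h`. -/
lemma MemH.abs_integral_far_le (hω : IsConcaveModulus ω) (hD : DiniCondition ω) (hf : MemH ω f)
    (x : ℝ) {h : ℝ} (hh : 0 < h) (hpi : h ≤ π) :
    |∫ s in h..π, ((f (x + h + s) - f (x + h - s)) - (f (x + s) - f (x - s))) * cotKernel s| ≤
      π * (∫ t in (0 : ℝ)..h, ω t / t) + π ^ 2 / 2 * (h * ∫ t in h..π, ω t / t ^ 2) := by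
  have hc := hf.continuous hω
  set Φ : ℝ → ℝ := fun u => ∫ t in u..u + h, f t with hΦ
  have hΦd : ∀ u, HasDerivAt Φ (f (u + h) - f u) u := fun u => by
    have hP : ∀ v, HasDerivAt (fun v => ∫ t in (0 : ℝ)..v, f t) (f v) v := fun v =>
      (hc.integral_hasStrictDerivAt 0 v).hasDerivAt
    have hEq : Φ = fun u => (∫ t in (0 : ℝ)..u + h, f t) - ∫ t in (0 : ℝ)..u, f t := by
      funext u
      exact (intervalIntegral.integral_interval_sub_left (hc.intervalIntegrable _ _)
        (hc.intervalIntegrable _ _)).symm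
    rw [hEq]
    exact ((hP (u + h)).comp_add_const u h).sub (hP u)
  set Θ : ℝ → ℝ := fun s => (Φ (x + s) - Φ x) + (Φ (x - s) - Φ x) with hΘ
  set θ : ℝ → ℝ := fun s => (f (x + h + s) - f (x + h - s)) - (f (x + s) - f (x - s)) with hθ
  have hΘd : ∀ s, HasDerivAt Θ (θ s) s := fun s => by
    have h1 := ((hΦd (x + s)).comp_const_add x s).sub_const (Φ x)
    have h2 := ((hΦd (x - s)).comp_const_sub x s).sub_const (Φ x)
    refine (h1.add h2).congr_deriv ?_
    rw [hθ]
    simp only [show x + s + h = x + h + s by ring, show x - s + h = x + h - s by ring]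
    ring
  have hΘb : ∀ s, 0 ≤ s → |Θ s| ≤ 2 * h * ω s := fun s hs => by
    have h1 := hf.abs_integral_sub_le hω (x + s) x hh.le
    have h2 := hf.abs_integral_sub_le hω (x - s) x hh.le
    rw [show x + s - x = s by ring, abs_of_nonneg hs] at h1
    rw [show x - s - x = -s by ring, abs_neg, abs_of_nonneg hs] at h2
    calc |Θ s| ≤ |Φ (x + s) - Φ x| + |Φ (x - s) - Φ x| := abs_add_le _ _
      _ ≤ 2 * h * ω s := by linarith
  have hmem : ∀ s ∈ uIcc h π, 0 < s ∧ s ≤ π := fun s hs => by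
    rw [uIcc_of_le hpi] at hs
    exact ⟨hh.trans_le hs.1, hs.2⟩
  have hkc : ContinuousOn (fun s => -(1 / (4 * sin (s / 2) ^ 2))) (uIcc h π) := by
    refine (continuousOn_const.div (by fun_prop) fun s hs => ?_).neg
    have := sin_half_pos (hmem s hs).1 (hmem s hs).2
    positivity
  have hparts := intervalIntegral.integral_deriv_mul_eq_sub (u := Θ) (v := cotKernel)
    (fun s _ => hΘd s) (fun s hs => hasDerivAt_cotKernel (hmem s hs).1 (hmem s hs).2)
    (Continuous.intervalIntegrable (by fun_prop) _ _) hkc.intervalIntegrable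
  have hΘc : Continuous Θ := continuous_iff_continuousAt.2 fun s => (hΘd s).continuousAt
  have hθc : Continuous θ := by fun_prop
  have hkc' : ContinuousOn cotKernel (uIcc h π) := continuousOn_cotKernel.mono hmem
  have i1 : IntervalIntegrable (fun s => θ s * cotKernel s) volume h π :=
    (hθc.continuousOn.mul hkc').intervalIntegrable
  have i2 : IntervalIntegrable (fun s => Θ s * -(1 / (4 * sin (s / 2) ^ 2))) volume h π :=
    (hΘc.continuousOn.mul hkc).intervalIntegrable
  rw [intervalIntegral.integral_add i1 i2, cotKernel_pi, mul_zero, zero_sub] at hparts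
  have hbd : |Θ h * cotKernel h| ≤ π * ∫ t in (0 : ℝ)..h, ω t / t := by
    rw [abs_mul]
    calc _ ≤ (2 * h * ω h) * (π / 2 / h) :=
          mul_le_mul (hΘb h hh.le) (abs_cotKernel_le hh hpi) (abs_nonneg _)
            (mul_nonneg (by positivity) (hω.nonneg hh.le))
      _ = π * ω h := by field_simp
      _ ≤ _ := mul_le_mul_of_nonneg_left (hω.le_integral_div hD hh) pi_pos.le
  have hint : |∫ s in h..π, Θ s * -(1 / (4 * sin (s / 2) ^ 2))| ≤
      π ^ 2 / 2 * (h * ∫ t in h..π, ω t / t ^ 2) := by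
    rw [← intervalIntegral.integral_const_mul, ← intervalIntegral.integral_const_mul,
      ← norm_eq_abs]
    refine intervalIntegral.norm_integral_le_of_norm_le hpi (ae_of_all _ fun s hs => ?_)
      (((hω.intervalIntegrable_div_sq hh pi_pos).const_mul _).const_mul _)
    have hs0 : 0 < s := hh.trans hs.1
    rw [norm_eq_abs, abs_mul]
    calc _ ≤ (2 * h * ω s) * (π ^ 2 / 4 / s ^ 2) :=
          mul_le_mul (hΘb s hs0.le) (abs_deriv_cotKernel_le hs0 hs.2) (abs_nonneg _)
            (mul_nonneg (by positivity) (hω.nonneg hs0.le))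
      _ = _ := by ring
  rw [eq_sub_of_add_eq hparts]
  refine (abs_sub _ _).trans ?_
  rw [abs_neg]
  exact add_le_add hbd hint

lemma MemH.abs_conj_add_sub_le {g : ℝ → ℝ} (hω : IsConcaveModulus ω) (hD : DiniCondition ω)
    (hf : MemH ω f) (hg : ConjFn f g) (x : ℝ) {h : ℝ} (hh : 0 < h) (hpi : h ≤ π) :
    |g (x + h) - g x| ≤
      3 * ((∫ t in (0 : ℝ)..h, ω t / t) + h * ∫ t in h..π, ω t / t ^ 2) := by
  have hc := hf.continuous hω
  refine le_of_tendsto ((hg (x + h)).sub (hg x)).abs ?_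
  filter_upwards [Ioo_mem_nhdsGT hh] with δ hδ
  have hδpi : δ ≤ π := hδ.2.le.trans hpi
  have ii : ∀ z a b, 0 < a → a ≤ b → b ≤ π →
      IntervalIntegrable (fun s => (f (z + s) - f (z - s)) * cotKernel s) volume a b := by
    intro z a b ha hab hb
    refine ContinuousOn.intervalIntegrable (Continuous.continuousOn (by fun_prop) |>.mul
      (continuousOn_cotKernel.mono fun s hs => ?_))
    rw [uIcc_of_le hab] at hs
    exact ⟨ha.trans_le hs.1, hs.2.trans hb⟩
  rw [setIntegral_truncated_eq hc _ hδ.1 hδpi, setIntegral_truncated_eq hc _ hδ.1 hδpi,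
    ← intervalIntegral.integral_add_adjacent_intervals (ii _ _ _ hδ.1 hδ.2.le hpi)
      (ii _ _ _ hh hpi le_rfl),
    ← intervalIntegral.integral_add_adjacent_intervals (ii _ _ _ hδ.1 hδ.2.le hpi)
      (ii _ _ _ hh hpi le_rfl)]
  have hn1 := hf.abs_integral_near_le hω hD (x + h) hδ.1 hδ.2.le hpi
  have hn2 := hf.abs_integral_near_le hω hD x hδ.1 hδ.2.le hpi
  have hfar := hf.abs_integral_far_le hω hD x hh hpi
  simp only [sub_mul _ _ (cotKernel _)] at hn1 hn2 hfar ii ⊢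
  rw [intervalIntegral.integral_sub (ii _ _ _ hh hpi le_rfl) (ii _ _ _ hh hpi le_rfl)] at hfar
  set A := ∫ s in δ..h, (f (x + h + s) * cotKernel s - f (x + h - s) * cotKernel s)
  set B := ∫ s in δ..h, (f (x + s) * cotKernel s - f (x - s) * cotKernel s)
  set A' := ∫ s in h..π, (f (x + h + s) * cotKernel s - f (x + h - s) * cotKernel s)
  set B' := ∫ s in h..π, (f (x + s) * cotKernel s - f (x - s) * cotKernel s)
  set I := ∫ t in (0 : ℝ)..h, ω t / t
  set J := h * ∫ t in h..π, ω t / t ^ 2 with hJ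
  have hJ0 : 0 ≤ J := by
    refine mul_nonneg hh.le (intervalIntegral.integral_nonneg hpi fun t ht => ?_)
    exact div_nonneg (hω.nonneg (hh.le.trans ht.1)) (sq_nonneg t)
  have hpi4 : π ^ 2 / 2 * J ≤ 3 * π * J := by
    refine mul_le_mul_of_nonneg_right ?_ hJ0
    nlinarith [pi_pos, pi_le_four]
  rw [show -(1 / π) * (A + A') - -(1 / π) * (B + B') = -(1 / π) * (A - B + (A' - B')) by ring,
    abs_mul, abs_neg, abs_of_pos (by positivity : 0 < 1 / π), one_div, inv_mul_le_iff₀ pi_pos]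
  have t1 := abs_add_le (A - B) (A' - B')
  have t2 := abs_sub A B
  linarith

lemma MemH.abs_conj_sub_le {g : ℝ → ℝ} (hω : IsConcaveModulus ω) (hD : DiniCondition ω)
    (hf : MemH ω f) (hg : ConjFn f g) {x y : ℝ} (hxy : x ≠ y) (hpi : |x - y| ≤ π) :
    |g x - g y| ≤ 3 * ((∫ t in (0 : ℝ)..|x - y|, ω t / t) +
      |x - y| * ∫ t in |x - y|..π, ω t / t ^ 2) := by
  wlog h : y < x generalizing x y
  · rw [abs_sub_comm (g x), abs_sub_comm x]
    exact this hxy.symm (by rwa [abs_sub_comm]) (lt_of_le_of_ne (not_lt.1 h) hxy)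
  rw [abs_of_pos (sub_pos.2 h)] at hpi ⊢
  simpa using hf.abs_conj_add_sub_le hω hD hg y (sub_pos.2 h) hpi

lemma MemH.uniformContinuous_conj {g : ℝ → ℝ} (hω : IsConcaveModulus ω) (hD : DiniCondition ω)
    (hf : MemH ω f) (hg : ConjFn f g) : UniformContinuous g := by
  set W : ℝ → ℝ := fun h => ∫ t in (0 : ℝ)..h, ω t / t with hW
  have hone : (1 : ℝ) ≤ π := by linarith [pi_gt_three]
  have hW0 : Tendsto W (nhdsWithin 0 (Ici 0)) (nhds 0) := by
    have hc := intervalIntegral.continuousOn_primitive_interval'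
      (hω.intervalIntegrable_div hD zero_le_one) left_mem_uIcc
    have h := (hc 0 left_mem_uIcc).tendsto
    rwa [intervalIntegral.integral_same, uIcc_of_le zero_le_one,
      nhdsWithin_Icc_eq_nhdsGE zero_lt_one] at h
  have hs0 : Tendsto (fun h : ℝ => √h) (nhdsWithin 0 (Ici 0)) (nhdsWithin 0 (Ici 0)) := by
    refine tendsto_nhdsWithin_iff.2 ⟨?_, Eventually.of_forall fun h => sqrt_nonneg h⟩
    simpa using (continuous_sqrt.tendsto 0).mono_left nhdsWithin_le_nhds
  have hB : Tendsto (fun h => 3 * (W h + (W √h + √h * W π))) (nhdsWithin 0 (Ici 0)) (nhds 0) := by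
    have := (hW0.add ((hW0.comp hs0).add
      ((hs0.mono_right nhdsWithin_le_nhds).mul_const (W π)))).const_mul 3
    simpa using this
  rw [Metric.uniformContinuous_iff]
  intro ε hε
  obtain ⟨d, hd, hdB⟩ := Metric.mem_nhdsWithin_iff.1 (hB.eventually_lt_const hε)
  refine ⟨min d 1, lt_min hd one_pos, fun {x y} hxy => ?_⟩
  rw [dist_eq] at hxy ⊢
  rcases eq_or_ne x y with rfl | hne
  · simpa using hε
  have hpos : 0 < |x - y| := abs_pos.2 (sub_ne_zero.2 hne)
  have h1 : |x - y| ≤ 1 := (hxy.trans_le (min_le_right _ _)).le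
  refine (hf.abs_conj_sub_le hω hD hg hne (h1.trans hone)).trans_lt ?_
  have hmem : 3 * (W |x - y| + (W √|x - y| + √|x - y| * W π)) < ε :=
    hdB ⟨by simpa [dist_eq] using hxy.trans_le (min_le_left _ _), hpos.le⟩
  have := hω.mul_integral_div_sq_le hD hpos h1 hone
  linarith

end Modulus

/-- Zygmund-type estimate for the modulus of continuity of the conjugate. -/
theorem conj_zygmund_estimate :
    ∃ C : ℝ, 0 < C ∧ ∀ ω f g : ℝ → ℝ, IsConcaveModulus ω → DiniCondition ω →
      MemH ω f → ConjFn f g →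
      (∀ x y : ℝ, x ≠ y → |x - y| ≤ π →
        |g x - g y| ≤ C * ((∫ t in (0:ℝ)..|x - y|, ω t / t) +
          |x - y| * ∫ t in |x - y|..π, ω t / t ^ 2)) ∧
      UniformContinuous g := by
  exact ⟨3, three_pos, fun _ _ _ hω hD hf hg =>
    ⟨fun _ _ hxy hpi => hf.abs_conj_sub_le hω hD hg hxy hpi, hf.uniformContinuous_conj hω hD hg⟩⟩
end
end
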